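/- Let N ≥ 1 and γ = (γ_0, γ_1, …, γ_N) ∈ ℚ̄^{N+1}. Then the set of vectors a = (a_1, …, a_N) ∈ ℤ^N such that the Laurent polynomial γ_0 + γ_1 t^{a_1} + ⋯ + γ_N t^{a_N} ∈ ℚ̄[t^{±1}] is nonzero and has a multiple root in ℚ̄^× that is not a root of unity, is contained in a finite union of proper linear subspaces of ℤ^N (i.e., subgroups of ℤ^N of rank at most N−1 cut out by nonzero linear forms). -/

import Mathlib

theorem exists_residue_avoiding_progression {p : ℕ} (hp : p.Prime) (W : ℕ) :
    ∃ x : ℕ, ∀ j ≤ W, ¬ p ∣ x + j * (W + 1).factorial := by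
  by_cases hpW : p ≤ W + 1
  · refine ⟨1, fun j _ h => ?_⟩
    have h2 : p ∣ j * (W + 1).factorial := Dvd.dvd.mul_left (hp.dvd_factorial.2 hpW) _
    exact hp.one_lt.ne' (Nat.dvd_one.1 ((Nat.dvd_add_left h2).1 h))
  · by_contra! hcon
    choose j hj hdvd using hcon
    obtain ⟨x, hx, y, hy, hxy, hjj⟩ := Finset.exists_ne_map_eq_of_card_lt_of_maps_to
      (s := Finset.range p) (t := Finset.range (W + 1)) (f := j)
      (by simpa using hpW) (fun x _ => by simpa using Nat.lt_succ_of_le (hj x))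
    apply hxy
    have h1 := hdvd x
    have h2 := hdvd y
    rw [hjj] at h1
    have h3 : x ≡ y [MOD p] := by
      apply Nat.ModEq.add_right_cancel' (j y * (W + 1).factorial)
      exact ((Nat.modEq_zero_iff_dvd.2 h1).trans (Nat.modEq_zero_iff_dvd.2 h2).symm)
    have := Nat.ModEq.eq_of_lt_of_lt h3 (by simpa using hx) (by simpa using hy)
    exact this

theorem exists_forall_coprime_progression (W : ℕ) {N : ℕ} (hN : N ≠ 0) :
    ∃ q : ℕ, ∀ j ≤ W, Nat.Coprime (q + j * (W + 1).factorial) N := by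
  have key : ∀ p : ℕ, ∃ x : ℕ, p.Prime → ∀ j ≤ W, ¬ p ∣ x + j * (W + 1).factorial := by
    intro p
    by_cases hp : p.Prime
    · obtain ⟨x, hx⟩ := exists_residue_avoiding_progression hp W
      exact ⟨x, fun _ => hx⟩
    · exact ⟨0, fun h => absurd h hp⟩
  choose x hx using key
  obtain ⟨q, hq⟩ := Nat.chineseRemainderOfFinset x id N.primeFactors
    (fun p hp => (Nat.prime_of_mem_primeFactors hp).ne_zero)
    (fun p hp r hr hpr => (Nat.coprime_primes (Nat.prime_of_mem_primeFactors hp)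
      (Nat.prime_of_mem_primeFactors hr)).2 hpr)
  refine ⟨q, fun j hj => Nat.coprime_of_dvd fun p hp h1 h2 => ?_⟩
  have hmem : p ∈ N.primeFactors := Nat.mem_primeFactors.2 ⟨hp, h2, hN⟩
  have h3 := hq p hmem
  refine hx p hp j hj ?_
  have h4 := (h3.symm.add_right (j * (W + 1).factorial))
  exact (Nat.modEq_zero_iff_dvd.1 (h4.trans (Nat.modEq_zero_iff_dvd.2 h1)))

theorem exists_conjugation_pow {ι : Type*} [Finite ι] (γ : ι → ℂ) (hγ : ∀ i, IsAlgebraic ℚ (γ i))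
    {ζ : ℂ} {N : ℕ} (hN : N ≠ 0) (hζ : IsPrimitiveRoot ζ N) {u : ℕ} (hu : u.Coprime N) :
    ∃ γ' : ι → ℂ, (∀ i, γ' i ∈ (minpoly ℚ (γ i)).rootSet ℂ) ∧ (∀ i, γ i ≠ 0 → γ' i ≠ 0) ∧
      ∀ (B : Finset ι) (a : ι → ℤ), ∑ i ∈ B, γ i * ζ ^ a i = 0 →
        ∑ i ∈ B, γ' i * (ζ ^ u) ^ a i = 0 := by
  have hζi : IsIntegral ℚ ζ := (hζ.isIntegral (Nat.pos_of_ne_zero hN)).tower_top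
  let A := algebraicClosure ℚ ℂ
  let z : A := ⟨ζ, mem_algebraicClosure_iff.2 hζi.isAlgebraic⟩
  let g : ι → A := fun i => ⟨γ i, mem_algebraicClosure_iff.2 (hγ i)⟩
  have hz : minpoly ℚ z = minpoly ℚ ζ := (minpoly.algebraMap_eq (algebraMap A ℂ).injective z).symm
  have hcyc : minpoly ℚ ζ = minpoly ℚ (ζ ^ u) := by
    rw [← Polynomial.cyclotomic_eq_minpoly_rat hζ (Nat.pos_of_ne_zero hN),
      ← Polynomial.cyclotomic_eq_minpoly_rat (hζ.pow_of_coprime u hu) (Nat.pos_of_ne_zero hN)]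
  have hev : Polynomial.aeval (ζ ^ u) (minpoly ℚ z) = 0 := by
    rw [hz, hcyc]; exact minpoly.aeval _ _
  obtain ⟨φ, hφ⟩ := IntermediateField.exists_algHom_of_splits_of_aeval (F := ℚ) (E := A) (K := ℂ)
    (fun s => ⟨by
      rw [← isAlgebraic_iff_isIntegral]
      exact (isAlgebraic_algebraMap_iff (algebraMap A ℂ).injective).1
        (mem_algebraicClosure_iff.1 s.2), IsAlgClosed.splits _⟩) hev
  refine ⟨fun i => φ (g i), fun i => ?_, fun i hi => ?_, fun B a h => ?_⟩
  · rw [Polynomial.mem_rootSet]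
    refine ⟨minpoly.ne_zero (hγ i).isIntegral, ?_⟩
    have : minpoly ℚ (g i) = minpoly ℚ (γ i) :=
      (minpoly.algebraMap_eq (algebraMap A ℂ).injective (g i)).symm
    rw [← this, Polynomial.aeval_algHom_apply, minpoly.aeval, map_zero]
  · rw [Ne, map_eq_zero]
    exact fun h => hi (congrArg Subtype.val h)
  · have h0 : ∑ i ∈ B, g i * z ^ a i = 0 := by
      apply Subtype.val_injective
      push_cast
      exact h
    have h1 := congrArg φ h0
    simp only [map_sum, map_mul, map_zpow₀, map_zero, hφ] at h1
    exact h1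

theorem exists_eq_of_forall_sum_mul_pow_eq_zero {ι : Type*} (B : Finset ι) (hB : B.Nonempty)
    (c y : ι → ℂ) (hc : ∀ i ∈ B, c i ≠ 0)
    (h : ∀ x < B.card, ∑ i ∈ B, c i * y i ^ x = 0) : ∃ i ∈ B, ∃ j ∈ B, i ≠ j ∧ y i = y j := by
  by_contra! hcon
  let e := B.equivFin
  have := Matrix.eq_zero_of_forall_pow_sum_mul_pow_eq_zero (f := fun k => y (e.symm k))
    (v := fun k => c (e.symm k)) (fun k l hkl => by
      by_contra hne
      exact hcon _ (e.symm k).2 _ (e.symm l).2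
        (fun h => hne (e.symm.injective (Subtype.ext h))) hkl) (fun k => by
      have h1 := h k k.2
      rw [← Finset.sum_coe_sort] at h1
      rw [← h1]
      exact Equiv.sum_comp e.symm (fun b : B => c b * y b ^ (k : ℕ)))
  obtain ⟨b, hb⟩ := hB
  have h2 := congrFun this (e ⟨b, hb⟩)
  simp at h2
  exact hc b hb h2

/-- A weak form of Mann's theorem: a vanishing sum of roots of unity with fixed algebraic
coefficients has two terms whose quotient has bounded order. -/
theorem exists_bounded_order_of_sum_roots_of_unity_eq_zero {ι : Type*} [Fintype ι] (γ : ι → ℂ)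
    (hγ : ∀ i, IsAlgebraic ℚ (γ i)) (hγ0 : ∀ i, γ i ≠ 0) :
    ∃ M : ℕ, 1 ≤ M ∧ ∀ ζ : ℂ, IsOfFinOrder ζ → ∀ (B : Finset ι), B.Nonempty → ∀ a : ι → ℤ,
      ∑ i ∈ B, γ i * ζ ^ a i = 0 → ∃ i ∈ B, ∃ j ∈ B, i ≠ j ∧ (ζ ^ (a i - a j)) ^ M = 1 := by
  classical
  let κ := (i : ι) → ((minpoly ℚ (γ i)).rootSet ℂ)
  obtain ⟨η, _, hη⟩ := Combinatorics.Line.exists_mono_in_high_dimension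
    (Fin (Fintype.card ι + 1)) κ
  let W := Fintype.card η * Fintype.card ι
  refine ⟨(W + 1).factorial * (Fintype.card η).factorial,
    Nat.one_le_iff_ne_zero.2 (mul_ne_zero (Nat.factorial_ne_zero _) (Nat.factorial_ne_zero _)),
    fun ζ hζ B hB a hsum => ?_⟩
  have hN : orderOf ζ ≠ 0 := hζ.orderOf_pos.ne'
  have hprim : IsPrimitiveRoot ζ (orderOf ζ) := IsPrimitiveRoot.orderOf ζ
  have hζ0 : ζ ≠ 0 := hprim.ne_zero hN
  obtain ⟨q, hq⟩ := exists_forall_coprime_progression W hN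
  have hconj : ∀ v : η → Fin (Fintype.card ι + 1), ∃ γ' : ι → ℂ,
      (∀ i, γ' i ∈ (minpoly ℚ (γ i)).rootSet ℂ) ∧ (∀ i, γ i ≠ 0 → γ' i ≠ 0) ∧
      ∀ (B : Finset ι) (a : ι → ℤ), ∑ i ∈ B, γ i * ζ ^ a i = 0 →
        ∑ i ∈ B, γ' i * (ζ ^ (q + (∑ k, (v k : ℕ)) * (W + 1).factorial)) ^ a i = 0 := fun v =>
    exists_conjugation_pow γ hγ hN hprim (hq _ (by
      calc ∑ k, (v k : ℕ) ≤ ∑ k : η, Fintype.card ι :=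
            Finset.sum_le_sum fun k _ => Nat.lt_succ_iff.1 (v k).2
        _ = W := by simp [W]))
  choose G hG1 hG2 hG3 using hconj
  obtain ⟨l, c, hl⟩ := hη (fun v i => ⟨G v i, hG1 v i⟩)
  let s := (Finset.univ.filter fun k => l.idxFun k = none).card
  let t := ∑ k ∈ Finset.univ.filter (fun k => l.idxFun k ≠ none), (((l.idxFun k).getD 0 :
    Fin (Fintype.card ι + 1)) : ℕ)
  have hs : 1 ≤ s := by
    obtain ⟨k, hk⟩ := l.proper
    exact Finset.card_pos.2 ⟨k, by simp [hk]⟩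
  have hsle : s ≤ Fintype.card η := Finset.card_le_univ _
  have hline : ∀ x : Fin (Fintype.card ι + 1), ∑ k, ((l x k : Fin (Fintype.card ι + 1)) : ℕ)
      = s * x + t := by
    intro x
    rw [← Finset.sum_filter_add_sum_filter_not _ (fun k => l.idxFun k = none)]
    congr 1
    · rw [Finset.sum_congr rfl (g := fun _ => (x : ℕ))]
      · simp [s]
      · intro k hk
        rw [Combinatorics.Line.apply_none _ _ _ (by simpa using hk)]
    · refine Finset.sum_congr rfl fun k hk => ?_
      have hk' : l.idxFun k ≠ none := by simpa using hk
      obtain ⟨y, hy⟩ := Option.ne_none_iff_exists'.1 hk'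
      rw [Combinatorics.Line.apply_some hy, hy]
      rfl
  set F := (W + 1).factorial with hF
  have hGc : ∀ x : Fin (Fintype.card ι + 1), ∀ i, G (l x) i = c i := fun x i => by
    have := congrFun (hl x) i
    exact congrArg Subtype.val this
  obtain ⟨i, hi, j, hj, hij, hy⟩ := exists_eq_of_forall_sum_mul_pow_eq_zero B hB
    (fun i => (c i : ℂ) * (ζ ^ (q + t * F)) ^ a i) (fun i => (ζ ^ (s * F)) ^ a i)
    (fun i _ => mul_ne_zero (by
      rw [← hGc 0]; exact hG2 _ i (hγ0 i)) (zpow_ne_zero _ (pow_ne_zero _ hζ0)))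
    (fun x hx => by
      have hx' : x < Fintype.card ι + 1 := lt_of_lt_of_le hx
        ((Finset.card_le_univ B).trans (Nat.le_succ _))
      have h1 := hG3 (l ⟨x, hx'⟩) B a hsum
      rw [← h1]
      refine Finset.sum_congr rfl fun i _ => ?_
      rw [hGc, hline, mul_assoc]
      congr 1
      rw [← zpow_natCast, ← zpow_natCast, ← zpow_natCast, ← zpow_natCast, ← zpow_mul, ← zpow_mul,
        ← zpow_mul, ← zpow_mul, ← zpow_add₀ hζ0]
      congr 1
      push_cast
      ring)
  refine ⟨i, hi, j, hj, hij, ?_⟩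
  obtain ⟨d, hd⟩ := Nat.dvd_factorial hs hsle
  have h5 : (ζ ^ (a i - a j)) ^ (s * F) = 1 := by
    rw [← zpow_natCast, ← zpow_mul, sub_mul, zpow_sub₀ hζ0, div_eq_one_iff_eq (zpow_ne_zero _ hζ0)]
    rw [← zpow_natCast, ← zpow_mul, ← zpow_mul] at hy
    rw [mul_comm, hy, mul_comm]
  rw [hd, show F * (s * d) = s * F * d by ring, pow_mul, h5, one_pow]

open Polynomial in
theorem minpoly_pow_dvd_of_hasseDeriv_eq_zero {L : Type*} [Field L] [CharZero L] {τ : L}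
    (hτ : IsIntegral ℤ τ) {T : ℕ} {F : ℤ[X]}
    (h : ∀ j < T, aeval τ (hasseDeriv j F) = 0) : minpoly ℤ τ ^ T ∣ F := by
  have hdvd : (X - C τ) ^ T ∣ F.map (algebraMap ℤ L) := by
    rw [X_sub_C_pow_dvd_iff, X_pow_dvd_iff]
    intro j hj
    have := taylor_coeff τ (F.map (algebraMap ℤ L)) j
    rw [taylor_apply] at this
    rw [this, show hasseDeriv j (F.map (algebraMap ℤ L)) = (hasseDeriv j F).map (algebraMap ℤ L) by
      ext i; simp [hasseDeriv_coeff, coeff_map], eval_map_algebraMap, h j hj]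
  clear h
  induction T generalizing F with
  | zero => simp
  | succ T ih =>
    have hF : aeval τ F = 0 := by
      have : (X - C τ) ∣ F.map (algebraMap ℤ L) := (dvd_pow_self _ T.succ_ne_zero).trans hdvd
      rwa [dvd_iff_isRoot, IsRoot.def, eval_map_algebraMap] at this
    obtain ⟨G, rfl⟩ := (minpoly.isIntegrallyClosed_dvd hτ hF)
    have hroot : (X - C τ) ∣ (minpoly ℤ τ).map (algebraMap ℤ L) := by
      rw [dvd_iff_isRoot, IsRoot.def, eval_map_algebraMap, minpoly.aeval]
    obtain ⟨h, hh⟩ := hroot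
    have hsep : ((minpoly ℤ τ).map (algebraMap ℤ L)).Separable := by
      have h1 : (minpoly ℚ τ).Separable := (minpoly.irreducible hτ.tower_top).separable
      rw [IsScalarTower.algebraMap_eq ℤ ℚ L, ← Polynomial.map_map,
        ← minpoly.isIntegrallyClosed_eq_field_fractions' ℚ hτ]
      exact h1.map
    have hcop : IsCoprime (X - C τ) h := by
      rw [hh] at hsep
      exact hsep.isCoprime
    rw [pow_succ, mul_comm]
    apply mul_dvd_mul_left
    apply ih
    rw [Polynomial.map_mul, hh, pow_succ', mul_assoc] at hdvd
    have h2 := (mul_dvd_mul_iff_left (X_sub_C_ne_zero τ)).1 hdvd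
    exact (hcop.pow_left (m := T)).dvd_of_dvd_mul_left h2

open Polynomial in
theorem exists_aeval_pow_prime_eq_mul {L : Type*} [CommRing L] (f : ℤ[X]) (τ : L) {p : ℕ}
    (hp : p.Prime) (hf : aeval τ f = 0) : ∃ g : ℤ[X], aeval (τ ^ p) f = p * aeval τ g := by
  have := Fact.mk hp
  have h0 : (expand ℤ p f - f ^ p).map (Int.castRingHom (ZMod p)) = 0 := by
    rw [Polynomial.map_sub, Polynomial.map_pow, map_expand, ZMod.expand_card, sub_self]
  have h1 : C (p : ℤ) ∣ expand ℤ p f - f ^ p := by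
    rw [C_dvd_iff_dvd_coeff]
    intro i
    rw [← ZMod.intCast_zmod_eq_zero_iff_dvd]
    have := congrArg (fun q => coeff q i) h0
    simpa only [coeff_map, coeff_zero, Int.coe_castRingHom] using this
  obtain ⟨g, hg⟩ := h1
  refine ⟨g, ?_⟩
  have h2 := congrArg (aeval τ) hg
  simp only [map_sub, map_mul, map_pow, hf, expand_aeval, zero_pow hp.ne_zero, sub_zero] at h2
  rw [h2]
  simp

theorem eq_zero_of_prod_embeddings_lt_one {L : Type*} [Field L] [NumberField L] {x : L}
    (hx : IsIntegral ℤ x) (h : ∏ σ : L →ₐ[ℚ] ℂ, ‖σ x‖ < 1) : x = 0 := by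
  have h1 := Algebra.norm_eq_prod_embeddings ℚ ℂ x
  have h2 : IsIntegral ℤ (Algebra.norm ℚ x) := Algebra.isIntegral_norm ℚ hx
  obtain ⟨m, hm⟩ := IsIntegrallyClosed.isIntegral_iff.1 h2
  rw [← norm_prod, ← h1, ← hm] at h
  have h3 : m = 0 := by
    simp at h
    rw [← Int.cast_abs] at h
    have : |m| < 1 := by exact_mod_cast h
    exact Int.abs_lt_one_iff.1 this
  rw [h3] at hm
  simpa using hm.symm

theorem one_le_prod_embeddings {L : Type*} [Field L] [NumberField L] {x : L}
    (hx : IsIntegral ℤ x) (h : x ≠ 0) : 1 ≤ ∏ σ : L →ₐ[ℚ] ℂ, ‖σ x‖ := by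
  by_contra! hcon
  exact h (eq_zero_of_prod_embeddings_lt_one hx hcon)

open Polynomial in
theorem norm_aeval_hasseDeriv_le {F : ℤ[X]} {n A : ℕ} (hdeg : F.natDegree < n)
    (hA : ∀ k, |F.coeff k| ≤ A) (T j : ℕ) (hj : j ≤ T) (z : ℂ) :
    ‖aeval z (hasseDeriv j F)‖ ≤ A * n ^ (T + 1) * max 1 ‖z‖ ^ n := by
  have hz1 : 1 ≤ max 1 ‖z‖ := le_max_left _ _
  have hn : 1 ≤ n := by omega
  have hn' : (1 : ℝ) ≤ n := by exact_mod_cast hn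
  rw [aeval_eq_sum_range' (lt_of_le_of_lt (natDegree_hasseDeriv_le F j)
    (lt_of_le_of_lt (Nat.sub_le _ _) hdeg))]
  calc ‖∑ i ∈ Finset.range n, (hasseDeriv j F).coeff i • z ^ i‖
      ≤ ∑ i ∈ Finset.range n, ‖(hasseDeriv j F).coeff i • z ^ i‖ := norm_sum_le _ _
    _ ≤ ∑ i ∈ Finset.range n, A * n ^ T * max 1 ‖z‖ ^ n := by
        refine Finset.sum_le_sum fun i hi => ?_
        have hi : i < n := by simpa using hi
        rw [zsmul_eq_mul, norm_mul, norm_pow, hasseDeriv_coeff]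
        by_cases hij : i + j < n
        · apply mul_le_mul
          · rw [Int.cast_mul, norm_mul, mul_comm]
            apply mul_le_mul
            · rw [Complex.norm_intCast]
              exact_mod_cast hA _
            · simp only [Int.cast_natCast, Complex.norm_natCast]
              calc (((i + j).choose j : ℕ) : ℝ) ≤ ((i + j) ^ j : ℕ) := by
                    exact_mod_cast Nat.choose_le_pow _ _
                _ ≤ (n : ℝ) ^ j := by
                    push_cast
                    gcongr
                    exact_mod_cast hij.le
                _ ≤ (n : ℝ) ^ T := pow_le_pow_right₀ hn' hj
            · positivity
            · positivity
          · calc ‖z‖ ^ i ≤ max 1 ‖z‖ ^ i := by gcongr; exact le_max_right _ _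
              _ ≤ max 1 ‖z‖ ^ n := pow_le_pow_right₀ hz1 hi.le
          · positivity
          · positivity
        · rw [coeff_eq_zero_of_natDegree_lt (by omega)]
          simp
          positivity
    _ = A * n ^ (T + 1) * max 1 ‖z‖ ^ n := by
        rw [Finset.sum_const, Finset.card_range, nsmul_eq_mul]; ring

/-- The product of `max 1 ‖σ τ‖` over the complex embeddings `σ` of a number field. -/
noncomputable def embeddingHeight {L : Type*} [Field L] [NumberField L] (τ : L) : ℝ :=
  ∏ σ : L →ₐ[ℚ] ℂ, max 1 ‖σ τ‖

theorem one_le_embeddingHeight {L : Type*} [Field L] [NumberField L] (τ : L) :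
    1 ≤ embeddingHeight τ := by
  have := Finset.prod_le_prod (s := Finset.univ) (f := fun _ : L →ₐ[ℚ] ℂ => (1 : ℝ))
    (g := fun σ => max 1 ‖σ τ‖) (fun _ _ => zero_le_one) (fun _ _ => le_max_left _ _)
  simpa [embeddingHeight] using this

open Polynomial in
theorem isIntegral_aeval_int {L : Type*} [CommRing L] {τ : L} (hτ : IsIntegral ℤ τ) (p : ℤ[X]) :
    IsIntegral ℤ (aeval τ p) :=
  Algebra.adjoin_le (S := integralClosure ℤ L) (Set.singleton_subset_iff.2 hτ)
    (aeval_mem_adjoin_singleton ℤ τ)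

open Polynomial in
theorem map_aeval_int {L M : Type*} [CommRing L] [CommRing M] (σ : L →+* M) (τ : L) (p : ℤ[X]) :
    σ (aeval τ p) = aeval (σ τ) p :=
  (aeval_algHom_apply σ.toIntAlgHom τ p).symm

open Polynomial in
theorem exists_small_polynomial_hasseDeriv_eq_zero {L : Type*} [Field L] [NumberField L] {τ : L}
    (hτ : IsIntegral ℤ τ) {n A T : ℕ} (hn : 1 ≤ n) (hA : 1 ≤ A)
    (h : ((7 * (A * (n : ℝ) ^ (T + 1))) ^ Module.finrank ℚ L * embeddingHeight τ ^ n) ^ (2 * T)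
      < ((A : ℝ) + 1) ^ n) :
    ∃ F : ℤ[X], F ≠ 0 ∧ F.natDegree < n ∧ (∀ k, |F.coeff k| ≤ A) ∧
      ∀ j < T, aeval τ (hasseDeriv j F) = 0 := by
  classical
  let f : (Fin n → Fin (A + 1)) → ℤ[X] := fun c =>
    ∑ k : Fin n, C ((c k : ℕ) : ℤ) * X ^ (k : ℕ)
  have hcoeff : ∀ c k, (f c).coeff k = if hk : k < n then ((c ⟨k, hk⟩ : ℕ) : ℤ) else 0 := by
    intro c k
    simp only [f, finsetSum_coeff, coeff_C_mul, coeff_X_pow]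
    split_ifs with hk
    · rw [Finset.sum_eq_single ⟨k, hk⟩]
      · simp
      · intro b _ hb
        have : k ≠ b := fun h => hb (Fin.ext h.symm)
        simp [this]
      · simp
    · refine Finset.sum_eq_zero fun b _ => ?_
      have : k ≠ b := fun h => hk (h ▸ b.2)
      simp [this]
  have hlt : ∀ p : ℤ[X], (∀ k, n ≤ k → p.coeff k = 0) → p.natDegree < n := by
    intro p hp
    by_contra! hcon
    have h0 := hp _ hcon
    have : p = 0 := leadingCoeff_eq_zero.1 h0
    rw [this] at hcon
    simp at hcon
    omega
  have hdeg : ∀ c, (f c).natDegree < n := fun c => hlt _ fun k hk => by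
    rw [hcoeff, dif_neg (by omega)]
  have habs : ∀ c k, |(f c).coeff k| ≤ A := by
    intro c k
    rw [hcoeff]
    split_ifs with hk
    · have := (c ⟨k, hk⟩).2
      rw [abs_of_nonneg (by positivity)]
      exact_mod_cast Nat.lt_succ_iff.1 this
    · simp
  let R : (L →ₐ[ℚ] ℂ) → ℝ := fun σ => A * n ^ (T + 1) * max 1 ‖σ τ‖ ^ n
  have hn' : (1 : ℝ) ≤ n := by exact_mod_cast hn
  have hA' : (1 : ℝ) ≤ A := by exact_mod_cast hA
  have hR : ∀ σ, 1 ≤ R σ := fun σ =>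
    one_le_mul_of_one_le_of_one_le (one_le_mul_of_one_le_of_one_le hA' (one_le_pow₀ hn'))
      (one_le_pow₀ (le_max_left _ _))
  let box : (L →ₐ[ℚ] ℂ) → Finset ℤ := fun σ => Finset.Icc (-⌈2 * R σ⌉) ⌈2 * R σ⌉
  have hboxcard : ∀ σ, ((box σ).card : ℝ) ≤ 7 * R σ := by
    intro σ
    simp only [box, Int.card_Icc]
    have h1 : 0 ≤ ⌈2 * R σ⌉ := Int.ceil_nonneg (by linarith [hR σ])
    have h2 : (((⌈2 * R σ⌉ + 1 - -⌈2 * R σ⌉).toNat : ℤ) : ℝ) = 2 * ⌈2 * R σ⌉ + 1 := by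
      rw [Int.toNat_of_nonneg (by omega)]; push_cast; ring
    have h3 := Int.ceil_lt_add_one (2 * R σ)
    rw [← Int.cast_natCast, h2]
    linarith [hR σ]
  have hmem : ∀ σ (x : ℝ), |x| ≤ R σ → ⌊2 * x⌋ ∈ box σ := by
    intro σ x hx
    rw [abs_le] at hx
    simp only [box, Finset.mem_Icc]
    constructor
    · rw [Int.le_floor]; push_cast; linarith [Int.le_ceil (2 * R σ)]
    · exact Int.cast_le.1 ((Int.floor_le (2 * x)).trans
        ((by linarith : 2 * x ≤ 2 * R σ).trans (Int.le_ceil (2 * R σ))))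
  let v : (Fin n → Fin (A + 1)) → (L →ₐ[ℚ] ℂ) × Fin T → ℂ := fun c s =>
    aeval (s.1 τ) (hasseDeriv s.2 (f c))
  have hv : ∀ c s, ‖v c s‖ ≤ R s.1 := fun c s =>
    norm_aeval_hasseDeriv_le (hdeg c) (habs c) T s.2 s.2.2.le _
  let Φ : (Fin n → Fin (A + 1)) → ((L →ₐ[ℚ] ℂ) × Fin T → ℤ × ℤ) := fun c s =>
    (⌊2 * (v c s).re⌋, ⌊2 * (v c s).im⌋)
  let target : Finset ((L →ₐ[ℚ] ℂ) × Fin T → ℤ × ℤ) :=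
    Fintype.piFinset fun s => box s.1 ×ˢ box s.1
  have hcard : target.card < (Finset.univ : Finset (Fin n → Fin (A + 1))).card := by
    have h1 : (target.card : ℝ) ≤ ((7 * (A * (n : ℝ) ^ (T + 1))) ^ Module.finrank ℚ L *
        embeddingHeight τ ^ n) ^ (2 * T) := by
      simp only [target, Fintype.card_piFinset, Finset.card_product]
      push_cast
      rw [Fintype.prod_prod_type]
      simp only [Finset.prod_const, Finset.card_univ, Fintype.card_fin]
      calc ∏ σ : L →ₐ[ℚ] ℂ, (((box σ).card : ℝ) * (box σ).card) ^ T
          ≤ ∏ σ : L →ₐ[ℚ] ℂ, ((7 * R σ) * (7 * R σ)) ^ T := by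
            refine Finset.prod_le_prod (fun _ _ => by positivity) fun σ _ => ?_
            have := hboxcard σ
            gcongr
        _ = _ := by
            have : ∀ σ, ((7 * R σ) * (7 * R σ)) ^ T = ((7 * (A * (n : ℝ) ^ (T + 1))) *
                max 1 ‖σ τ‖ ^ n) ^ (2 * T) := fun σ => by
              simp only [R]
              rw [pow_mul]; congr 1; ring
            simp only [this]
            rw [Finset.prod_pow, Finset.prod_mul_distrib, Finset.prod_pow, Finset.prod_const,
              Finset.card_univ, AlgHom.card]
            rfl
    have h2 := h1.trans_lt h
    have h3 : target.card < (A + 1) ^ n := by exact_mod_cast h2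
    simpa using h3
  obtain ⟨c, -, c', -, hcc, hΦ⟩ := Finset.exists_ne_map_eq_of_card_lt_of_maps_to hcard
    (f := Φ) (fun c _ => by
      simp only [target, Finset.mem_coe, Fintype.mem_piFinset, Finset.mem_product, Φ]
      exact fun s => ⟨hmem _ _ ((Complex.abs_re_le_norm _).trans (hv c s)),
        hmem _ _ ((Complex.abs_im_le_norm _).trans (hv c s))⟩)
  have hdiff : ∀ s, ‖v c s - v c' s‖ < 1 := by
    intro s
    have h1 := congrFun hΦ s
    simp only [Φ, Prod.mk.injEq] at h1
    have h2 := Int.abs_sub_lt_one_of_floor_eq_floor h1.1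
    have h3 := Int.abs_sub_lt_one_of_floor_eq_floor h1.2
    rw [← mul_sub, abs_mul, abs_two] at h2 h3
    refine (Complex.norm_le_abs_re_add_abs_im _).trans_lt ?_
    rw [Complex.sub_re, Complex.sub_im]
    linarith
  refine ⟨f c - f c', ?_, ?_, ?_, ?_⟩
  · intro h0
    apply hcc
    ext k
    have := congrArg (fun p => p.coeff k) h0
    simp only [coeff_sub, hcoeff, coeff_zero, k.2, dif_pos] at this
    exact_mod_cast (sub_eq_zero.1 this)
  · refine hlt _ fun k hk => ?_
    rw [coeff_sub, hcoeff, hcoeff, dif_neg (by omega), dif_neg (by omega), sub_zero]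
  · intro k
    rw [coeff_sub, abs_le, hcoeff, hcoeff]
    split_ifs with hk
    · have h1 := (c ⟨k, hk⟩).2
      have h2 := (c' ⟨k, hk⟩).2
      constructor <;> omega
    · simp
  · intro j hj
    refine eq_zero_of_prod_embeddings_lt_one ?_ ?_
    · exact isIntegral_aeval_int hτ _
    · have h1 : ∀ σ : L →ₐ[ℚ] ℂ, ‖σ (aeval τ (hasseDeriv j (f c - f c')))‖ < 1 := by
        intro σ
        have h2 : σ (aeval τ (hasseDeriv j (f c - f c'))) = v c (σ, ⟨j, hj⟩) - v c' (σ, ⟨j, hj⟩) := by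
          simp only [v, ← map_sub]
          exact (map_aeval_int (σ : L →+* ℂ) _ _)
        rw [h2]; exact hdiff _
      have hne : (Finset.univ : Finset (L →ₐ[ℚ] ℂ)).Nonempty := by
        rw [← Finset.card_pos, Finset.card_univ, AlgHom.card]
        exact Module.finrank_pos
      by_cases h0 : ∃ σ : L →ₐ[ℚ] ℂ, ‖σ (aeval τ (hasseDeriv j (f c - f c')))‖ = 0
      · obtain ⟨σ, hσ⟩ := h0
        rw [Finset.prod_eq_zero (Finset.mem_univ σ) hσ]
        exact one_pos
      · push Not at h0
        calc _ < ∏ σ : L →ₐ[ℚ] ℂ, (1 : ℝ) := Finset.prod_lt_prod_of_nonempty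
              (fun σ _ => lt_of_le_of_ne (norm_nonneg _) (h0 σ).symm) (fun σ _ => h1 σ) hne
          _ = 1 := by simp

section Orbit

variable {G A : Type*} [Group G] [Field A] [MulSemiringAction G A] {t : A} {Z : Finset A}

theorem two_pow_card_le_of_pow_collision (ht : t ≠ 0) (hZ : ∀ z, z ∈ Z ↔ ∃ g : G, z = g • t)
    (S : Finset ℕ) (hS : ∀ p ∈ S, p.Prime)
    (hcol : ∀ p ∈ S, ∃ z ∈ Z, ∃ w ∈ Z, z ≠ w ∧ z ^ p = w ^ p) : 2 ^ S.card ≤ Z.card := by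
  classical
  suffices h : ∃ U ⊆ Z, U.card = 2 ^ S.card ∧ ∀ u ∈ U, u ^ (∏ p ∈ S, p) = t ^ (∏ p ∈ S, p) by
    obtain ⟨U, hUZ, hU, -⟩ := h
    exact hU ▸ Finset.card_le_card hUZ
  induction S using Finset.induction_on with
  | empty => exact ⟨{t}, by simpa using (hZ t).2 ⟨1, by simp⟩, by simp, by simp⟩
  | insert p S hpS ih =>
    obtain ⟨U, hUZ, hU, hUt⟩ := ih (fun q hq => hS q (Finset.mem_insert_of_mem hq))
      (fun q hq => hcol q (Finset.mem_insert_of_mem hq))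
    obtain ⟨z, hz, w, hw, hzw, hzwp⟩ := hcol p (Finset.mem_insert_self _ _)
    obtain ⟨g, rfl⟩ := (hZ z).1 hz
    obtain ⟨h, rfl⟩ := (hZ w).1 hw
    set s := g⁻¹ * h with hs
    have hst : s • t ≠ t := fun hst => hzw (by
      rw [hs, mul_smul, inv_smul_eq_iff] at hst; exact hst.symm)
    have hstp : (s • t) ^ p = t ^ p := by
      rw [hs, mul_smul, ← smul_pow', ← hzwp, smul_pow', inv_smul_smul]
    set P := ∏ q ∈ S, q with hP
    have hmem : ∀ u ∈ U, s • u ∈ Z := fun u hu => by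
      obtain ⟨k, rfl⟩ := (hZ u).1 (hUZ hu)
      exact (hZ _).2 ⟨s * k, (mul_smul _ _ _).symm⟩
    have hcop : Nat.Coprime p P := Nat.Coprime.prod_right fun q hq =>
      (Nat.coprime_primes (hS p (Finset.mem_insert_self _ _))
        (hS q (Finset.mem_insert_of_mem hq))).2 (fun h => hpS (h ▸ hq))
    have hdisj : Disjoint U (U.image (s • ·)) := by
      rw [Finset.disjoint_left]
      intro u hu hu'
      obtain ⟨v, hv, rfl⟩ := Finset.mem_image.1 hu'
      have h1 := hUt _ hu
      simp only [← smul_pow', hUt v hv] at h1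
      rw [smul_pow'] at h1
      have h2 : (s • t / t) ^ P = 1 := by rw [div_pow, h1, div_self (pow_ne_zero _ ht)]
      have h3 : (s • t / t) ^ p = 1 := by rw [div_pow, hstp, div_self (pow_ne_zero _ ht)]
      have h4 : (s • t / t) = 1 := by
        have := pow_gcd_eq_one.2 ⟨h3, h2⟩
        rwa [hcop, pow_one] at this
      exact hst ((div_eq_one_iff_eq ht).1 h4)
    refine ⟨U ∪ U.image (s • ·), ?_, ?_, ?_⟩
    · refine Finset.union_subset hUZ fun x hx => ?_
      obtain ⟨v, hv, rfl⟩ := Finset.mem_image.1 hx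
      exact hmem v hv
    · rw [Finset.card_union_of_disjoint hdisj, Finset.card_image_of_injective _
        (MulAction.injective s), hU, Finset.card_insert_of_notMem hpS, pow_succ]
      ring
    · intro u hu
      rw [Finset.prod_insert hpS]
      rcases Finset.mem_union.1 hu with hu | hu
      · rw [mul_comm, pow_mul, hUt u hu, ← pow_mul]
      · obtain ⟨v, hv, rfl⟩ := Finset.mem_image.1 hu
        rw [mul_comm, pow_mul, ← smul_pow', hUt v hv, smul_pow', ← pow_mul, mul_comm, pow_mul,
          hstp, ← pow_mul]

theorem pow_ne_pow_of_mem_orbit (hZ : ∀ z, z ∈ Z ↔ ∃ g : G, z = g • t) (ν : A → ℝ)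
    (hν0 : ∀ z, 0 ≤ ν z) (hν : ∀ z n, ν (z ^ n) = ν z ^ n) (h1 : ∃ z ∈ Z, 1 < ν z) {p q : ℕ}
    (hpq : p < q) {z w : A} (hz : z ∈ Z) (hw : w ∈ Z) : z ^ p ≠ w ^ q := by
  intro h
  obtain ⟨y, hy, hmax⟩ := Finset.exists_max_image Z ν ⟨z, hz⟩
  obtain ⟨x, hx, hx1⟩ := h1
  obtain ⟨g, hg⟩ := (hZ y).1 hy
  obtain ⟨k, hk⟩ := (hZ w).1 hw
  obtain ⟨l, hl⟩ := (hZ z).1 hz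
  have hyw : y = (g * k⁻¹) • w := by rw [hk, smul_smul, mul_assoc, inv_mul_cancel, mul_one, hg]
  have h2 : y ^ q = ((g * k⁻¹) • z) ^ p := by rw [hyw, ← smul_pow', ← h, smul_pow']
  have h3 : (g * k⁻¹) • z ∈ Z := (hZ _).2 ⟨g * k⁻¹ * l, by rw [hl, smul_smul]⟩
  have h4 := congrArg ν h2
  rw [hν, hν] at h4
  have h5 : ν y ^ q ≤ ν y ^ p := h4 ▸ pow_le_pow_left₀ (hν0 _) (hmax _ h3) p
  exact absurd h5 (not_le.2 (pow_lt_pow_right₀ (hx1.trans_le (hmax x hx)) hpq))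

open Polynomial in
theorem mul_card_le_natDegree_of_forall_pow_isRoot (ht : t ≠ 0)
    (hZ : ∀ z, z ∈ Z ↔ ∃ g : G, z = g • t) (ν : A → ℝ)
    (hν0 : ∀ z, 0 ≤ ν z) (hν : ∀ z n, ν (z ^ n) = ν z ^ n) (h1 : ∃ z ∈ Z, 1 < ν z)
    (S : Finset ℕ) (hS : ∀ p ∈ S, p.Prime) (m : ℕ) (hm : m + Nat.log 2 Z.card ≤ S.card)
    (F : A[X]) (hF : F ≠ 0) (hroot : ∀ p ∈ S, ∀ z ∈ Z, F.IsRoot (z ^ p)) :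
    m * Z.card ≤ F.natDegree := by
  classical
  let inj : ℕ → Prop := fun p => ∀ z ∈ Z, ∀ w ∈ Z, z ^ p = w ^ p → z = w
  have hbad : (S.filter fun p => ¬ inj p).card ≤ Nat.log 2 Z.card := by
    have hne : Z.card ≠ 0 := by
      obtain ⟨z, hz, -⟩ := h1
      exact Finset.card_ne_zero_of_mem hz
    refine Nat.le_log_of_pow_le one_lt_two ?_
    refine two_pow_card_le_of_pow_collision (G := G) ht hZ _
      (fun p hp => hS p (Finset.mem_filter.1 hp).1) fun p hp => ?_
    have := (Finset.mem_filter.1 hp).2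
    simp only [inj] at this
    push Not at this
    obtain ⟨z, hz, w, hw, h, hne⟩ := this
    exact ⟨z, hz, w, hw, hne, h⟩
  have hgood : m ≤ (S.filter inj).card := by
    have := Finset.card_filter_add_card_filter_not (s := S) inj
    omega
  have hcard : ((S.filter inj).biUnion fun p => Z.image (· ^ p)).card = (S.filter inj).card * Z.card := by
    rw [Finset.card_biUnion]
    · rw [Finset.sum_const_nat (m := Z.card)]
      intro p hp
      exact Finset.card_image_of_injOn fun z hz w hw h => (Finset.mem_filter.1 hp).2 z hz w hw h
    · intro p _ q _ hpq
      rw [Function.onFun, Finset.disjoint_left]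
      intro x hx hx'
      obtain ⟨z, hz, rfl⟩ := Finset.mem_image.1 hx
      obtain ⟨w, hw, h⟩ := Finset.mem_image.1 hx'
      rcases lt_or_gt_of_ne hpq with hlt | hlt
      · exact pow_ne_pow_of_mem_orbit hZ ν hν0 hν h1 hlt hz hw h.symm
      · exact pow_ne_pow_of_mem_orbit hZ ν hν0 hν h1 hlt hw hz h
  calc m * Z.card ≤ (S.filter inj).card * Z.card := Nat.mul_le_mul_right _ hgood
    _ = ((S.filter inj).biUnion fun p => Z.image (· ^ p)).card := hcard.symm
    _ ≤ F.roots.toFinset.card := Finset.card_le_card fun x hx => by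
        obtain ⟨p, hp, hx⟩ := Finset.mem_biUnion.1 hx
        obtain ⟨z, hz, rfl⟩ := Finset.mem_image.1 hx
        rw [Multiset.mem_toFinset, mem_roots hF]
        exact hroot p (Finset.mem_filter.1 hp).1 z hz
    _ ≤ F.roots.card := Multiset.toFinset_card_le _
    _ ≤ F.natDegree := card_roots' F

end Orbit

open Polynomial in
theorem mul_natDegree_minpoly_le_of_forall_pow_isRoot_of_isAlgClosure {L : Type*} [Field L]
    [NumberField L] (A : Type*) [Field A] [Algebra ℚ A] [IsAlgClosure ℚ A] {τ : L}
    (hτ : IsIntegral ℤ τ) (hτ0 : τ ≠ 0) (hNT : ∀ n : ℕ, 0 < n → τ ^ n ≠ 1)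
    (S : Finset ℕ) (hS : ∀ p ∈ S, p.Prime) (m : ℕ)
    (hm : m + Nat.log 2 (minpoly ℚ τ).natDegree ≤ S.card) (F : ℤ[X]) (hF : F ≠ 0)
    (hroot : ∀ p ∈ S, aeval (τ ^ p) F = 0) : m * (minpoly ℚ τ).natDegree ≤ F.natDegree := by
  classical
  have := IsAlgClosure.isAlgClosed ℚ (K := A)
  have := IsAlgClosure.isAlgebraic (R := ℚ) (K := A)
  have : CharZero A := algebraRat.charZero A
  have : Normal ℚ A := IsAlgClosure.normal ℚ A
  let j : L →ₐ[ℚ] A := IsAlgClosed.lift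
  let ι : A →ₐ[ℚ] ℂ := IsAlgClosed.lift
  have hInt : IsIntegral ℚ (j τ) := hτ.tower_top.map j
  have hmin : minpoly ℚ (j τ) = minpoly ℚ τ := minpoly.algHom_eq j j.injective τ
  let Z : Finset A := ((minpoly ℚ τ).rootSet A).toFinset
  have hsplit : ((minpoly ℚ τ).map (algebraMap ℚ A)).Splits := IsAlgClosed.splits _
  have hZcard : Z.card = (minpoly ℚ τ).natDegree := by
    rw [Set.toFinset_card]
    exact card_rootSet_eq_natDegree (minpoly.irreducible hτ.tower_top).separable hsplit
  have hZ : ∀ z, z ∈ Z ↔ ∃ g : A ≃ₐ[ℚ] A, z = g • j τ := by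
    intro z
    rw [Set.mem_toFinset, ← hmin, ← isConjRoot_iff_mem_minpoly_rootSet hInt]
    constructor
    · intro h
      obtain ⟨g, hg⟩ := (isConjRoot_iff_exists_algEquiv.1 h.symm)
      exact ⟨g, hg.symm⟩
    · rintro ⟨g, rfl⟩
      exact isConjRoot_of_algEquiv _ _
  have hroot' : ∀ p ∈ S, ∀ z ∈ Z, (F.map (Int.castRingHom A)).IsRoot (z ^ p) := by
    intro p hp z hz
    obtain ⟨g, rfl⟩ := (hZ z).1 hz
    have h1 := hroot p hp
    have h2 : aeval (((g : A →+* A).comp (j : L →+* A)) (τ ^ p)) F = 0 := by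
      have h3 := map_aeval_int ((g : A →+* A).comp (j : L →+* A)) (τ ^ p) F
      rw [← h3, h1, map_zero]
    rw [IsRoot.def, ← algebraMap_int_eq, eval_map_algebraMap]
    simpa using h2
  have hbig : ∃ z ∈ Z, 1 < ‖ι z‖ := by
    by_contra! hcon
    obtain ⟨n, hn, h1⟩ := NumberField.Embeddings.pow_eq_one_of_norm_le_one L ℂ hτ0 hτ fun φ => by
      have h2 : φ τ ∈ (minpoly ℚ τ).rootSet ℂ := by
        rw [mem_rootSet]
        refine ⟨minpoly.ne_zero hτ.tower_top, ?_⟩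
        have := aeval_algHom_apply (φ.toRatAlgHom) τ (minpoly ℚ τ)
        rw [minpoly.aeval, map_zero] at this
        exact this
      rw [← hsplit.image_rootSet ι] at h2
      obtain ⟨z, hz, hz'⟩ := h2
      rw [← hz']
      exact hcon z (Set.mem_toFinset.2 hz)
    exact hNT n hn h1
  have := mul_card_le_natDegree_of_forall_pow_isRoot (G := A ≃ₐ[ℚ] A) (t := j τ) (Z := Z)
    (by simpa using hτ0) hZ (fun z => ‖ι z‖) (fun z => norm_nonneg _)
    (fun z n => by simp) hbig S hS m (by rwa [hZcard]) (F.map (Int.castRingHom A))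
    ((Polynomial.map_ne_zero_iff (Int.castRingHom A).injective_int).2 hF) hroot'
  rw [hZcard] at this
  exact this.trans natDegree_map_le

open Polynomial in
theorem mul_natDegree_minpoly_le_of_forall_pow_isRoot {L : Type*} [Field L] [NumberField L] {τ : L}
    (hτ : IsIntegral ℤ τ) (hτ0 : τ ≠ 0) (hNT : ∀ n : ℕ, 0 < n → τ ^ n ≠ 1)
    (S : Finset ℕ) (hS : ∀ p ∈ S, p.Prime) (m : ℕ)
    (hm : m + Nat.log 2 (minpoly ℚ τ).natDegree ≤ S.card) (F : ℤ[X]) (hF : F ≠ 0)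
    (hroot : ∀ p ∈ S, aeval (τ ^ p) F = 0) : m * (minpoly ℚ τ).natDegree ≤ F.natDegree :=
  letI : Algebra ℚ (AlgebraicClosure ℚ) := AlgebraicClosure.instAlgebra ℚ
  mul_natDegree_minpoly_le_of_forall_pow_isRoot_of_isAlgClosure (AlgebraicClosure ℚ) hτ hτ0 hNT
    S hS m hm F hF hroot

open Polynomial in
theorem three_lt_embeddingHeight_pow {L : Type*} [Field L] [NumberField L] {τ : L}
    (hτ : IsIntegral ℤ τ) (hτ0 : τ ≠ 0) (hNT : ∀ n : ℕ, 0 < n → τ ^ n ≠ 1) {κ T Y : ℕ}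
    (hκ : Module.finrank ℚ L ≤ κ * (minpoly ℚ τ).natDegree) (hT : 2 ≤ T)
    (S : Finset ℕ) (hS : ∀ p ∈ S, p.Prime) (hSY : ∀ p ∈ S, p ≤ Y) (hY : 1 ≤ Y)
    (hST : ∀ p ∈ S, 63 * (4 * Module.finrank ℚ L * T ^ 2) ^ 2 < p ^ T)
    (hScard : 4 * κ * T ^ 2 + Nat.log 2 (Module.finrank ℚ L) ≤ S.card) :
    3 < embeddingHeight τ ^ (4 * T ^ 2 * Y) := by
  by_contra! hcon
  set d := Module.finrank ℚ L with hd
  set n := 4 * d * T ^ 2 with hn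
  set H := embeddingHeight τ with hH
  have hd1 : 1 ≤ d := Module.finrank_pos
  have hn1 : 1 ≤ n := Nat.succ_le_of_lt (by positivity)
  have hn1' : (1 : ℝ) ≤ n := by exact_mod_cast hn1
  have hH1 : 1 ≤ H := one_le_embeddingHeight τ
  have hHT : H ^ (4 * T ^ 2) ≤ 3 :=
    (pow_le_pow_right₀ hH1 (Nat.le_mul_of_pos_right _ hY)).trans hcon
  obtain ⟨F, hF0, hFdeg, hFA, hFder⟩ := exists_small_polynomial_hasseDeriv_eq_zero hτ
    (n := n) (A := 21 * n) (T := T) hn1 (by omega) (by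
      have h1 : (7 * (((21 * n : ℕ) : ℝ) * (n : ℝ) ^ (T + 1))) * H ^ (4 * T ^ 2)
          < (((21 * n : ℕ) : ℝ) + 1) ^ (2 * T) := by
        push_cast
        calc (7 * ((21 * (n : ℝ)) * (n : ℝ) ^ (T + 1))) * H ^ (4 * T ^ 2)
            ≤ (7 * ((21 * (n : ℝ)) * (n : ℝ) ^ (T + 1))) * 3 := by gcongr
          _ = (21 * n) * (21 * (n : ℝ) ^ (T + 1)) := by ring
          _ ≤ (21 * n) * (21 ^ (T + 1) * (n : ℝ) ^ (T + 1)) := by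
              gcongr
              exact le_self_pow₀ (by norm_num) (by omega)
          _ = (21 * (n : ℝ)) ^ (T + 2) := by rw [← mul_pow]; ring
          _ ≤ (21 * (n : ℝ)) ^ (2 * T) := pow_le_pow_right₀ (by linarith) (by omega)
          _ < (21 * (n : ℝ) + 1) ^ (2 * T) := by
              apply pow_lt_pow_left₀ (by linarith) (by positivity) (by omega)
      have h2 : H ^ n = (H ^ (4 * T ^ 2)) ^ d := by
        rw [← pow_mul]; congr 1; rw [hn]; ring
      rw [← hH, ← hd, h2, ← mul_pow, ← pow_mul]
      have h3 : (((21 * n : ℕ) : ℝ) + 1) ^ n = ((((21 * n : ℕ) : ℝ) + 1) ^ (2 * T)) ^ (d * (2 * T)) := by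
        rw [← pow_mul]; congr 1; rw [hn]; ring
      rw [h3]
      apply pow_lt_pow_left₀ h1 (by positivity)
      positivity)
  obtain ⟨Q, hQ⟩ := minpoly_pow_dvd_of_hasseDeriv_eq_zero hτ hFder
  have hroot : ∀ p ∈ S, aeval (τ ^ p) F = 0 := by
    intro p hp
    by_contra hne
    obtain ⟨g, hg⟩ := exists_aeval_pow_prime_eq_mul (minpoly ℤ τ) τ (hS p hp) (minpoly.aeval ℤ τ)
    have h1 : aeval (τ ^ p) F = (p : L) ^ T * (aeval τ g ^ T * aeval (τ ^ p) Q) := by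
      rw [hQ, map_mul, map_pow, hg]; ring
    have hInt : IsIntegral ℤ (aeval τ g ^ T * aeval (τ ^ p) Q) :=
      ((isIntegral_aeval_int hτ g).pow T).mul (isIntegral_aeval_int (hτ.pow p) Q)
    have h2 := one_le_prod_embeddings hInt (fun h0 => hne (by rw [h1, h0, mul_zero]))
    have hp0 : (0 : ℝ) < p := by exact_mod_cast (hS p hp).pos
    have h3 : ((p : ℝ) ^ T) ^ d ≤ ∏ σ : L →ₐ[ℚ] ℂ, ‖σ (aeval (τ ^ p) F)‖ := by
      simp only [h1, map_mul, map_pow, map_natCast, norm_mul, norm_pow,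
        Complex.norm_natCast]
      rw [Finset.prod_mul_distrib, Finset.prod_const, Finset.card_univ, AlgHom.card, ← hd]
      refine le_mul_of_one_le_right (by positivity) ?_
      simpa using h2
    have h4 : ∏ σ : L →ₐ[ℚ] ℂ, ‖σ (aeval (τ ^ p) F)‖ ≤
        ∏ σ : L →ₐ[ℚ] ℂ, ((21 * n) * n) * (max 1 ‖σ τ‖ ^ n) ^ p := by
      refine Finset.prod_le_prod (fun _ _ => norm_nonneg _) fun σ _ => ?_
      have h5 := norm_aeval_hasseDeriv_le hFdeg hFA 0 0 le_rfl (σ (τ ^ p))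
      rw [hasseDeriv_zero', zero_add, pow_one] at h5
      have h6 : σ (aeval (τ ^ p) F) = aeval (σ (τ ^ p)) F := map_aeval_int (σ : L →+* ℂ) _ _
      rw [h6]
      refine h5.trans ?_
      have h12 : max 1 ‖σ (τ ^ p)‖ ≤ max 1 ‖σ τ‖ ^ p := by
        rw [map_pow, norm_pow]
        exact max_le (one_le_pow₀ (le_max_left _ _))
          (pow_le_pow_left₀ (norm_nonneg _) (le_max_right _ _) p)
      rw [Nat.cast_mul, Nat.cast_ofNat]
      refine mul_le_mul_of_nonneg_left ?_ (by positivity)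
      exact (pow_le_pow_left₀ (by positivity) h12 n).trans_eq (pow_right_comm _ _ _)
    rw [Finset.prod_mul_distrib, Finset.prod_const, Finset.card_univ, AlgHom.card, ← hd,
      Finset.prod_pow, Finset.prod_pow] at h4
    change _ ≤ _ * (H ^ n) ^ p at h4
    have h7 : (H ^ n) ^ p ≤ 3 ^ d := by
      calc (H ^ n) ^ p = (H ^ (4 * T ^ 2 * p)) ^ d := by
            rw [← pow_mul, ← pow_mul]; congr 1; rw [hn]; ring
        _ ≤ (H ^ (4 * T ^ 2 * Y)) ^ d := by
            gcongr
            exact hSY p hp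
        _ ≤ 3 ^ d := pow_le_pow_left₀ (by positivity) hcon d
    have h8 : ((p : ℝ) ^ T) ^ d ≤ (63 * n ^ 2) ^ d := by
      calc ((p : ℝ) ^ T) ^ d ≤ ((21 * n) * n) ^ d * (H ^ n) ^ p := h3.trans h4
        _ ≤ ((21 * n) * n) ^ d * 3 ^ d := mul_le_mul_of_nonneg_left h7 (by positivity)
        _ = (63 * (n : ℝ) ^ 2) ^ d := by rw [← mul_pow]; ring
    have h9 : (p : ℝ) ^ T ≤ 63 * n ^ 2 := le_of_pow_le_pow_left₀ (by omega) (by positivity) h8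
    have h10 : p ^ T ≤ 63 * n ^ 2 := by exact_mod_cast h9
    exact absurd (hST p hp) (not_lt.2 h10)
  have hDd : (minpoly ℚ τ).natDegree ≤ d := minpoly.natDegree_le τ
  have hfin := mul_natDegree_minpoly_le_of_forall_pow_isRoot hτ hτ0 hNT S hS (4 * κ * T ^ 2)
    ((Nat.add_le_add_left (Nat.log_mono_right hDd) _).trans hScard) F hF0 hroot
  have h11 : n ≤ 4 * κ * T ^ 2 * (minpoly ℚ τ).natDegree := by
    calc n = 4 * T ^ 2 * d := by rw [hn]; ring
      _ ≤ 4 * T ^ 2 * (κ * (minpoly ℚ τ).natDegree) := Nat.mul_le_mul_left _ hκ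
      _ = _ := by ring
  omega

theorem exists_sqrt_le_card_primes :
    ∃ Y₀ : ℕ, ∀ Y : ℕ, Y₀ ≤ Y →
      √(Y : ℝ) ≤ ((Finset.range (Y + 1)).filter fun p => p.Prime ∧ Y < p ^ 2).card := by
  have h1 := (isLittleO_log_rpow_atTop (r := 1 / 2) (by norm_num)).def
    (show (0 : ℝ) < 1 / 20 by norm_num)
  obtain ⟨x₀, hx₀⟩ := Filter.eventually_atTop.1 h1
  refine ⟨max ⌈x₀⌉₊ 3, fun Y hY => ?_⟩
  have hY3 : 3 ≤ Y := (le_max_right _ _).trans hY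
  have hY3' : (3 : ℝ) ≤ Y := by exact_mod_cast hY3
  have hlog := hx₀ Y ((Nat.le_ceil x₀).trans (by exact_mod_cast (le_max_left _ _).trans hY))
  have hl1 : 1 ≤ Real.log Y := by
    rw [Real.le_log_iff_exp_le (by linarith)]
    have := Real.exp_one_lt_d9
    linarith
  rw [← Real.sqrt_eq_rpow, Real.norm_of_nonneg (by linarith),
    Real.norm_of_nonneg (Real.sqrt_nonneg _)] at hlog
  have hs := Real.mul_self_sqrt (show (0 : ℝ) ≤ Y by linarith)
  set s := √(Y : ℝ) with hsdef
  have hs0 : 0 ≤ s := Real.sqrt_nonneg _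
  have hs1 : 1 ≤ s := by nlinarith
  have h2 := Chebyshev.psi_ge Y
  have h3 := Chebyshev.psi_le_primeCounting_mul_log Y
  have hl2 : Real.log (Y + 1) ≤ Real.log Y + 1 := by
    have : Real.log (Y + 1) ≤ Real.log (2 * Y) := Real.log_le_log (by linarith) (by linarith)
    rw [Real.log_mul (by norm_num) (by linarith)] at this
    have := Real.log_two_lt_d9
    linarith
  have hln2 := Real.log_two_gt_d9
  have hpi : 2 * s ≤ Nat.primeCounting Y := by
    by_contra! hcon
    have h5 : (Nat.primeCounting Y : ℝ) * Real.log Y ≤ 2 * s * (1 / 20 * s) :=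
      mul_le_mul hcon.le hlog (by linarith) (by linarith)
    nlinarith
  have hsplit : Nat.primeCounting Y ≤
      ((Finset.range (Y + 1)).filter fun p => p.Prime ∧ Y < p ^ 2).card + Nat.sqrt Y := by
    rw [Nat.primeCounting, Nat.primeCounting', Nat.count_eq_card_filter_range]
    have : (Finset.range (Y + 1)).filter Nat.Prime ⊆
        ((Finset.range (Y + 1)).filter fun p => p.Prime ∧ Y < p ^ 2) ∪ Finset.Icc 1 (Nat.sqrt Y) := by
      intro p hp
      simp only [Finset.mem_filter, Finset.mem_range, Finset.mem_union, Finset.mem_Icc] at hp ⊢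
      by_cases h : Y < p ^ 2
      · exact Or.inl ⟨hp.1, hp.2, h⟩
      · exact Or.inr ⟨hp.2.one_lt.le, Nat.le_sqrt'.2 (not_lt.1 h)⟩
    refine (Finset.card_le_card this).trans ((Finset.card_union_le _ _).trans ?_)
    simp
  have h6 : ((Nat.sqrt Y : ℕ) : ℝ) ≤ s := Real.nat_sqrt_le_real_sqrt
  have h7 : (Nat.primeCounting Y : ℝ) ≤
      ((Finset.range (Y + 1)).filter fun p => p.Prime ∧ Y < p ^ 2).card + (Nat.sqrt Y : ℕ) := by
    exact_mod_cast hsplit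
  linarith

theorem exists_le_log_embeddingHeight (κ : ℕ) {ε : ℝ} (hε : 0 < ε) :
    ∃ c : ℝ, 0 < c ∧ ∀ (L : Type) [Field L] [NumberField L] (τ : L), IsIntegral ℤ τ → τ ≠ 0 →
      (∀ n : ℕ, 0 < n → τ ^ n ≠ 1) → Module.finrank ℚ L ≤ κ * (minpoly ℚ τ).natDegree →
      c ≤ (Module.finrank ℚ L : ℝ) ^ ε * Real.log (embeddingHeight τ) := by
  obtain ⟨Y₀, hY₀⟩ := exists_sqrt_le_card_primes
  obtain ⟨T, hT⟩ := exists_nat_ge (max 2 (4 / ε))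
  have hT2 : 2 ≤ T := by exact_mod_cast (le_max_left _ _).trans hT
  have hTε : 4 ≤ ε * T := by
    have := (le_max_right _ _).trans hT
    rwa [div_le_iff₀' hε] at this
  obtain ⟨Λ, hΛ⟩ := exists_nat_ge (max (Y₀ + 1)
    (max (63 * (4 * T ^ 2) ^ 2 + 1) ((4 * κ * T ^ 2 + 2 * (1 / (ε / 2))) ^ 2)) : ℝ)
  have hΛ1 : (Y₀ : ℝ) + 1 ≤ Λ := (le_max_left _ _).trans hΛ
  have hΛ2 : (63 * (4 * T ^ 2) ^ 2 + 1 : ℝ) ≤ Λ :=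
    ((le_max_left _ _).trans (le_max_right _ _)).trans hΛ
  have hΛ3 : ((4 * κ * T ^ 2 + 2 * (1 / (ε / 2))) ^ 2 : ℝ) ≤ Λ :=
    ((le_max_right _ _).trans (le_max_right _ _)).trans hΛ
  have hΛ0 : (1 : ℝ) ≤ Λ := by
    have : (0 : ℝ) ≤ Y₀ := Nat.cast_nonneg _
    linarith
  have hT0 : (0 : ℝ) < T := by exact_mod_cast (by omega : 0 < T)
  refine ⟨1 / (8 * T ^ 2 * Λ), by positivity, fun L _ _ τ hτ hτ0 hNT hκ => ?_⟩
  set d := Module.finrank ℚ L with hd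
  have hd1 : 1 ≤ d := Module.finrank_pos
  have hd1' : (1 : ℝ) ≤ d := by exact_mod_cast hd1
  have hdε : (1 : ℝ) ≤ (d : ℝ) ^ ε := Real.one_le_rpow hd1' hε.le
  set Y := ⌈Λ * (d : ℝ) ^ ε⌉₊ with hYdef
  have hYge : Λ * (d : ℝ) ^ ε ≤ Y := Nat.le_ceil _
  have hYΛ : (Λ : ℝ) ≤ Y := (le_mul_of_one_le_right (by linarith) hdε).trans hYge
  have hYle : (Y : ℝ) ≤ 2 * (Λ * (d : ℝ) ^ ε) := by
    have := (Nat.ceil_lt_add_one (show 0 ≤ Λ * (d : ℝ) ^ ε by positivity)).le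
    nlinarith
  have hY1 : 1 ≤ Y := by exact_mod_cast hΛ0.trans hYΛ
  have hcard := hY₀ Y (by
    have : (Y₀ : ℝ) ≤ Y := by linarith
    exact_mod_cast this)
  set S := (Finset.range (Y + 1)).filter fun p => p.Prime ∧ Y < p ^ 2 with hS
  have hmemS : ∀ p ∈ S, p ≤ Y ∧ p.Prime ∧ Y < p ^ 2 := by
    intro p hp
    rw [hS, Finset.mem_filter, Finset.mem_range] at hp
    exact ⟨by omega, hp.2⟩
  have hmain := three_lt_embeddingHeight_pow hτ hτ0 hNT hκ hT2 S (fun p hp => (hmemS p hp).2.1)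
    (fun p hp => (hmemS p hp).1) hY1 (by
      intro p hp
      have hp2 : Λ * (d : ℝ) ^ ε ≤ (p : ℝ) ^ 2 := by
        refine hYge.trans ?_
        exact_mod_cast (hmemS p hp).2.2.le
      have h1 : ((63 * (4 * d * T ^ 2) ^ 2 : ℕ) : ℝ) ^ 2 < ((p ^ T : ℕ) : ℝ) ^ 2 := by
        push_cast
        calc ((63 * (4 * d * T ^ 2) ^ 2 : ℝ)) ^ 2 = (63 * (4 * T ^ 2) ^ 2) ^ 2 * (d : ℝ) ^ 4 := by ring
          _ < (Λ : ℝ) ^ 2 * (d : ℝ) ^ 4 := by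
              gcongr
              linarith
          _ ≤ (Λ : ℝ) ^ T * (d : ℝ) ^ (ε * T) := by
              gcongr
              rw [← Real.rpow_natCast]
              exact Real.rpow_le_rpow_of_exponent_le hd1' (by exact_mod_cast hTε)
          _ = (Λ * (d : ℝ) ^ ε) ^ T := by
              rw [mul_pow, ← Real.rpow_natCast ((d : ℝ) ^ ε), ← Real.rpow_mul (by linarith)]
          _ ≤ ((p : ℝ) ^ 2) ^ T := by gcongr
          _ = ((p : ℝ) ^ T) ^ 2 := pow_right_comm _ _ _
      exact_mod_cast lt_of_pow_lt_pow_left₀ 2 (by positivity) h1) (by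
      have h2 : ((4 * κ * T ^ 2 + Nat.log 2 d : ℕ) : ℝ) ≤ √(Y : ℝ) := by
        have h3 : ((Nat.log 2 d : ℕ) : ℝ) ≤ 2 * Real.log d := by
          have h4 := Real.natLog_le_logb d 2
          rw [Real.logb, le_div_iff₀ (Real.log_pos (by norm_num))] at h4
          have := Real.log_two_gt_d9
          have h5 : (0 : ℝ) ≤ (Nat.log 2 d : ℕ) := Nat.cast_nonneg _
          push_cast at h4
          nlinarith
        have h6 := Real.log_le_rpow_div (show (0 : ℝ) ≤ d by linarith) (half_pos hε)
        have hde2 : (1 : ℝ) ≤ (d : ℝ) ^ (ε / 2) := Real.one_le_rpow hd1' (half_pos hε).le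
        apply Real.le_sqrt_of_sq_le
        refine le_trans ?_ hYge
        calc ((4 * κ * T ^ 2 + Nat.log 2 d : ℕ) : ℝ) ^ 2
            ≤ ((4 * κ * T ^ 2 + 2 * (1 / (ε / 2))) * (d : ℝ) ^ (ε / 2)) ^ 2 := by
              gcongr
              push_cast
              have h7 : (0 : ℝ) ≤ 4 * κ * T ^ 2 := by positivity
              have h8 : (d : ℝ) ^ (ε / 2) / (ε / 2) = 1 / (ε / 2) * (d : ℝ) ^ (ε / 2) := by ring
              nlinarith
          _ = (4 * κ * T ^ 2 + 2 * (1 / (ε / 2))) ^ 2 * (d : ℝ) ^ ε := by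
              rw [mul_pow, ← Real.rpow_natCast ((d : ℝ) ^ (ε / 2)), ← Real.rpow_mul (by linarith)]
              congr 2
              push_cast
              ring
          _ ≤ Λ * (d : ℝ) ^ ε := by gcongr
      exact_mod_cast h2.trans hcard)
  have hH1 := one_le_embeddingHeight τ
  have hlogH : 0 ≤ Real.log (embeddingHeight τ) := Real.log_nonneg hH1
  have h9 := Real.log_lt_log (by norm_num) hmain
  rw [Real.log_pow] at h9
  have h10 : 1 ≤ Real.log 3 := by
    rw [Real.le_log_iff_exp_le (by norm_num)]
    have := Real.exp_one_lt_d9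
    linarith
  rw [div_le_iff₀ (by positivity)]
  push_cast at h9
  calc (1 : ℝ) ≤ 4 * T ^ 2 * Y * Real.log (embeddingHeight τ) := by linarith
    _ ≤ 4 * T ^ 2 * (2 * (Λ * (d : ℝ) ^ ε)) * Real.log (embeddingHeight τ) := by gcongr
    _ = _ := by ring

section Gap

variable {L : Type*} [Field L] {ι : Type*}

theorem zpow_le_min_one_pow {t : ℝ} (ht : 0 < t) {k : ℕ} {S₁ S₂ : Finset ι} {a : ι → ℤ}
    (h₁ : ∀ i ∈ S₁, a i ≤ 0) (h₂ : ∀ i ∈ S₂, (k : ℤ) ≤ a i) :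
    (∀ i ∈ S₁, t ^ a i ≤ min 1 t ^ k) ∨ ∀ i ∈ S₂, t ^ a i ≤ min 1 t ^ k := by
  rcases le_or_gt 1 t with h | h
  · left
    intro i hi
    rw [min_eq_left h, one_pow]
    exact zpow_le_one_of_nonpos₀ h (h₁ i hi)
  · right
    intro i hi
    rw [min_eq_right h.le, ← zpow_natCast]
    exact zpow_le_zpow_right_of_le_one₀ ht h.le (h₂ i hi)

theorem norm_sum_le_min_one_pow [Fintype ι] {γ : ι → L} {τ : L} (hτ0 : τ ≠ 0) (σ : L →+* ℂ)
    {C : ℝ} (hC0 : 0 ≤ C) (hC : ∀ i, ‖σ (γ i)‖ ≤ C) {k : ℕ} {S₁ S₂ : Finset ι} {a : ι → ℤ}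
    (h₁ : ∀ i ∈ S₁, a i ≤ 0) (h₂ : ∀ i ∈ S₂, (k : ℤ) ≤ a i)
    (hsum : ∑ i ∈ S₁, γ i * τ ^ a i + ∑ i ∈ S₂, γ i * τ ^ a i = 0) :
    ‖σ (∑ i ∈ S₁, γ i * τ ^ a i)‖ ≤ Fintype.card ι * C * min 1 ‖σ τ‖ ^ k := by
  have key : ∀ S : Finset ι, (∀ i ∈ S, ‖σ τ‖ ^ a i ≤ min 1 ‖σ τ‖ ^ k) →
      ‖σ (∑ i ∈ S, γ i * τ ^ a i)‖ ≤ Fintype.card ι * C * min 1 ‖σ τ‖ ^ k := by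
    intro S hS
    rw [map_sum]
    have hm : 0 ≤ min 1 ‖σ τ‖ ^ k := by positivity
    calc ‖∑ i ∈ S, σ (γ i * τ ^ a i)‖ ≤ ∑ i ∈ S, C * min 1 ‖σ τ‖ ^ k :=
          norm_sum_le_of_le _ fun i hi => by
            rw [map_mul, map_zpow₀, norm_mul, norm_zpow]
            exact mul_le_mul (hC i) (hS i hi) (by positivity) hC0
      _ = S.card * (C * min 1 ‖σ τ‖ ^ k) := by rw [Finset.sum_const, nsmul_eq_mul]
      _ ≤ Fintype.card ι * (C * min 1 ‖σ τ‖ ^ k) := by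
          gcongr
          exact Finset.card_le_univ S
      _ = _ := by ring
  rcases zpow_le_min_one_pow (norm_pos_iff.2 ((map_ne_zero σ).2 hτ0)) h₁ h₂ with h | h
  · exact key S₁ h
  · rw [eq_neg_of_add_eq_zero_left hsum, map_neg, norm_neg]
    exact key S₂ h

theorem embeddingHeight_inv_pow_le [NumberField L] [Fintype ι] {γ : ι → L} {τ : L} (hτ0 : τ ≠ 0)
    (hγ : ∀ i, IsIntegral ℤ (γ i)) (hτ : IsIntegral ℤ τ⁻¹)
    {C : ℝ} (hC0 : 0 ≤ C) (hC : ∀ (σ : L →+* ℂ) i, ‖σ (γ i)‖ ≤ C) {k : ℕ} {S₁ S₂ : Finset ι}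
    {a : ι → ℤ} (h₁ : ∀ i ∈ S₁, a i ≤ 0) (h₂ : ∀ i ∈ S₂, (k : ℤ) ≤ a i)
    (hsum : ∑ i ∈ S₁, γ i * τ ^ a i + ∑ i ∈ S₂, γ i * τ ^ a i = 0)
    (hne : ∑ i ∈ S₁, γ i * τ ^ a i ≠ 0) :
    embeddingHeight τ⁻¹ ^ k ≤ (Fintype.card ι * C) ^ Module.finrank ℚ L := by
  have hInt : IsIntegral ℤ (∑ i ∈ S₁, γ i * τ ^ a i) := by
    refine IsIntegral.sum _ fun i hi => (hγ i).mul ?_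
    obtain ⟨n, hn⟩ := Int.eq_ofNat_of_zero_le (neg_nonneg.2 (h₁ i hi))
    rw [show a i = -(n : ℤ) by omega, zpow_neg, zpow_natCast, ← inv_pow]
    exact hτ.pow n
  have h1 := one_le_prod_embeddings hInt hne
  have hmul : ∀ σ : L →ₐ[ℚ] ℂ, min 1 ‖σ τ‖ * max 1 ‖σ τ⁻¹‖ = 1 := by
    intro σ
    have ht : 0 < ‖σ τ‖ := norm_pos_iff.2 ((map_ne_zero σ).2 hτ0)
    rw [map_inv₀, norm_inv]
    rcases le_total 1 ‖σ τ‖ with h | h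
    · rw [min_eq_left h, max_eq_left (inv_le_one_of_one_le₀ h), one_mul]
    · rw [min_eq_right h, max_eq_right ((one_le_inv₀ ht).2 h), mul_inv_cancel₀ ht.ne']
  have h2 : ∏ σ : L →ₐ[ℚ] ℂ, ‖σ (∑ i ∈ S₁, γ i * τ ^ a i)‖ ≤
      ∏ σ : L →ₐ[ℚ] ℂ, (Fintype.card ι * C * min 1 ‖σ τ‖ ^ k) :=
    Finset.prod_le_prod (fun _ _ => norm_nonneg _) fun σ _ =>
      norm_sum_le_min_one_pow hτ0 (σ : L →+* ℂ) hC0 (hC _) h₁ h₂ hsum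
  have hH : 0 ≤ embeddingHeight τ⁻¹ := zero_le_one.trans (one_le_embeddingHeight _)
  calc embeddingHeight τ⁻¹ ^ k = embeddingHeight τ⁻¹ ^ k * 1 := (mul_one _).symm
    _ ≤ embeddingHeight τ⁻¹ ^ k * ∏ σ : L →ₐ[ℚ] ℂ, (Fintype.card ι * C * min 1 ‖σ τ‖ ^ k) := by
        gcongr
        exact h1.trans h2
    _ = ∏ σ : L →ₐ[ℚ] ℂ, (Fintype.card ι * C) := by
        rw [embeddingHeight, ← Finset.prod_pow, ← Finset.prod_mul_distrib]
        refine Finset.prod_congr rfl fun σ _ => ?_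
        rw [mul_comm, mul_assoc, ← mul_pow, hmul, one_pow, mul_one]
    _ = _ := by rw [Finset.prod_const, Finset.card_univ, AlgHom.card]

open NumberField in
theorem exists_finitePlace_two_le [NumberField L] {u : L} (hu : ¬ IsIntegral ℤ u) :
    ∃ v : FinitePlace L, 2 ≤ v u := by
  by_contra! hcon
  apply hu
  have : ∀ v : IsDedekindDomain.HeightOneSpectrum (𝓞 L), v.valuation L u ≤ 1 := by
    intro v
    by_contra! hv
    have h1 := hcon (FinitePlace.mk v)
    have h2 : FinitePlace.mk v u = ‖FinitePlace.embedding v u‖ := rfl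
    rw [h2, FinitePlace.norm_embedding'] at h1
    have hq : (2 : ℕ) ≤ v.asIdeal.absNorm := by
      have := NumberField.HeightOneSpectrum.one_lt_absNorm v
      omega
    have hne : v.valuation L u ≠ 0 := (zero_lt_one.trans hv).ne'
    rw [WithZeroMulInt.toNNReal_neg_apply _ hne] at h1
    have h3 : 1 ≤ (WithZero.unzero hne).toAdd := by
      have h4 : (1 : Multiplicative ℤ) < WithZero.unzero hne := by
        rw [← WithZero.coe_lt_coe, WithZero.coe_unzero]
        exact hv
      exact Int.add_one_le_iff.2 h4
    have hq' : (2 : ℝ) ≤ (v.asIdeal.absNorm : ℝ) := by exact_mod_cast hq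
    have h5 : (v.asIdeal.absNorm : ℝ) ^ (1 : ℤ) ≤
        (v.asIdeal.absNorm : ℝ) ^ (WithZero.unzero hne).toAdd :=
      zpow_le_zpow_right₀ (by linarith) h3
    rw [zpow_one] at h5
    push_cast at h1
    linarith
  obtain ⟨x, hx⟩ := IsDedekindDomain.HeightOneSpectrum.mem_integers_of_valuation_le_one L u this
  rw [← hx]
  exact x.2

open NumberField in
theorem finitePlace_apply_le_one [NumberField L] (v : FinitePlace L) {x : L}
    (hx : IsIntegral ℤ x) : v x ≤ 1 := by
  rw [← FinitePlace.norm_embedding_eq]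
  exact FinitePlace.norm_le_one L v.maximalIdeal ⟨x, hx⟩

open NumberField in
theorem finitePlace_sum_le_min_one_pow [NumberField L] {γ : ι → L} {τ : L} (hτ0 : τ ≠ 0)
    (v : FinitePlace L) (hγ : ∀ i, IsIntegral ℤ (γ i)) {k : ℕ} {S₁ S₂ : Finset ι} {a : ι → ℤ}
    (h₁ : ∀ i ∈ S₁, a i ≤ 0) (h₂ : ∀ i ∈ S₂, (k : ℤ) ≤ a i)
    (hsum : ∑ i ∈ S₁, γ i * τ ^ a i + ∑ i ∈ S₂, γ i * τ ^ a i = 0) :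
    v (∑ i ∈ S₁, γ i * τ ^ a i) ≤ min 1 (v τ) ^ k := by
  have key : ∀ S : Finset ι, (∀ i ∈ S, v τ ^ a i ≤ min 1 (v τ) ^ k) →
      v (∑ i ∈ S, γ i * τ ^ a i) ≤ min 1 (v τ) ^ k := by
    intro S hS
    have hm : 0 ≤ min 1 (v τ) ^ k := pow_nonneg (le_min zero_le_one (apply_nonneg v τ)) _
    rcases S.eq_empty_or_nonempty with rfl | hne
    · simp [hm]
    · refine (IsNonarchimedean.apply_sum_le_sup (f := v) (FinitePlace.add_le v) hne).trans
        (Finset.sup'_le _ _ fun i hi => ?_)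
      rw [map_mul, map_zpow₀]
      calc v (γ i) * v τ ^ a i ≤ 1 * v τ ^ a i :=
            mul_le_mul_of_nonneg_right (finitePlace_apply_le_one v (hγ i))
              (zpow_nonneg (apply_nonneg v τ) _)
        _ ≤ _ := by rw [one_mul]; exact hS i hi
  rcases zpow_le_min_one_pow (FinitePlace.pos_iff.2 hτ0 : 0 < v τ) h₁ h₂ with h | h
  · exact key S₁ h
  · rw [eq_neg_of_add_eq_zero_left hsum, map_neg_eq_map]
    exact key S₂ h

open NumberField in
theorem two_pow_le_of_not_isIntegral_inv [NumberField L] [Fintype ι] {γ : ι → L} {τ : L}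
    (hτ0 : τ ≠ 0) (hγ : ∀ i, IsIntegral ℤ (γ i)) (hτ : ¬ IsIntegral ℤ τ⁻¹)
    {C : ℝ} (hC0 : 0 ≤ C) (hC : ∀ (σ : L →+* ℂ) i, ‖σ (γ i)‖ ≤ C) {k : ℕ} {S₁ S₂ : Finset ι}
    {a : ι → ℤ} (h₁ : ∀ i ∈ S₁, a i ≤ 0) (h₂ : ∀ i ∈ S₂, (k : ℤ) ≤ a i)
    (hsum : ∑ i ∈ S₁, γ i * τ ^ a i + ∑ i ∈ S₂, γ i * τ ^ a i = 0)
    (hne : ∑ i ∈ S₁, γ i * τ ^ a i ≠ 0) :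
    2 ^ k ≤ (Fintype.card ι * C) ^ Module.finrank ℚ L := by
  obtain ⟨v, hv⟩ := exists_finitePlace_two_le hτ
  set A := ∑ i ∈ S₁, γ i * τ ^ a i with hA
  have h3 := prod_abs_eq_one hne
  have h4 : ∏ w : InfinitePlace L, w A ^ w.mult ≤ (Fintype.card ι * C) ^ Module.finrank ℚ L := by
    rw [← InfinitePlace.sum_mult_eq, ← Finset.prod_pow_eq_pow_sum]
    refine Finset.prod_le_prod (fun w _ => pow_nonneg (apply_nonneg w A) _) fun w _ => ?_
    refine pow_le_pow_left₀ (apply_nonneg w A) ?_ _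
    rw [← InfinitePlace.norm_embedding_eq]
    refine (norm_sum_le_min_one_pow hτ0 w.embedding hC0 (hC _) h₁ h₂ hsum).trans ?_
    exact mul_le_of_le_one_right (by positivity)
      (pow_le_one₀ (le_min zero_le_one (norm_nonneg _)) (min_le_left _ _))
  have hle : ∀ w : FinitePlace L, w A ≤ min 1 (w τ) ^ k := fun w =>
    finitePlace_sum_le_min_one_pow hτ0 w hγ h₁ h₂ hsum
  have hle1 : ∀ w : FinitePlace L, w A ≤ 1 := fun w => (hle w).trans
    (pow_le_one₀ (le_min zero_le_one (apply_nonneg w τ)) (min_le_left _ _))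
  have h5 : ∏ᶠ w : FinitePlace L, w A ≤ v A := by
    classical
    have hfin := FinitePlace.hasFiniteMulSupport hne
    rw [finprod_eq_prod_of_mulSupport_subset (s := insert v hfin.toFinset) _ (by
      intro w hw
      exact Finset.mem_coe.2 (Finset.mem_insert_of_mem (hfin.mem_toFinset.2 hw))),
      ← Finset.mul_prod_erase _ _ (Finset.mem_insert_self v _)]
    exact mul_le_of_le_one_right (apply_nonneg v A)
      (Finset.prod_le_one (fun w _ => apply_nonneg w A) fun w _ => hle1 w)
  have h6 : v A * 2 ^ k ≤ 1 := by
    have h7 : v τ * 2 ≤ 1 := by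
      have h8 : v τ * v τ⁻¹ = 1 := by rw [← map_mul, mul_inv_cancel₀ hτ0, map_one]
      have := mul_le_mul_of_nonneg_left hv (apply_nonneg v τ)
      linarith
    calc v A * 2 ^ k ≤ v τ ^ k * 2 ^ k := by
          refine mul_le_mul_of_nonneg_right ((hle v).trans ?_) (by positivity)
          exact pow_le_pow_left₀ (le_min zero_le_one (apply_nonneg v τ)) (min_le_right _ _) k
      _ = (v τ * 2) ^ k := (mul_pow _ _ _).symm
      _ ≤ 1 := pow_le_one₀ (mul_nonneg (apply_nonneg v τ) zero_le_two) h7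
  have h9 : 0 ≤ ∏ w : InfinitePlace L, w A ^ w.mult :=
    Finset.prod_nonneg fun w _ => pow_nonneg (apply_nonneg w A) _
  have hX : 0 ≤ (Fintype.card ι * C) ^ Module.finrank ℚ L := h9.trans h4
  calc (2 : ℝ) ^ k = (∏ w : InfinitePlace L, w A ^ w.mult) * (∏ᶠ w : FinitePlace L, w A) * 2 ^ k := by
        rw [h3, one_mul]
    _ ≤ (Fintype.card ι * C) ^ Module.finrank ℚ L * v A * 2 ^ k := by
        refine mul_le_mul_of_nonneg_right ?_ (by positivity)
        exact (mul_le_mul_of_nonneg_left h5 h9).trans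
          (mul_le_mul_of_nonneg_right h4 (apply_nonneg v A))
    _ = (Fintype.card ι * C) ^ Module.finrank ℚ L * (v A * 2 ^ k) := by ring
    _ ≤ _ := mul_le_of_le_one_right hX h6

end Gap

theorem exists_gap_le_of_numberField (κ : ℕ) {C : ℝ} (hC0 : 0 ≤ C) {ε : ℝ} (hε : 0 < ε)
    {ι : Type} [Fintype ι] :
    ∃ C' : ℝ, 0 < C' ∧ ∀ (L : Type) [Field L] [NumberField L] (γ : ι → L) (τ : L),
      τ ≠ 0 → (∀ n : ℕ, 0 < n → τ ^ n ≠ 1) → (∀ i, IsIntegral ℤ (γ i)) →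
      (∀ (σ : L →+* ℂ) i, ‖σ (γ i)‖ ≤ C) →
      Module.finrank ℚ L ≤ κ * (minpoly ℚ τ⁻¹).natDegree → ∀ (k : ℕ) (S₁ S₂ : Finset ι) (a : ι → ℤ),
      (∀ i ∈ S₁, a i ≤ 0) → (∀ i ∈ S₂, (k : ℤ) ≤ a i) →
      ∑ i ∈ S₁, γ i * τ ^ a i + ∑ i ∈ S₂, γ i * τ ^ a i = 0 →
      ∑ i ∈ S₁, γ i * τ ^ a i ≠ 0 → (k : ℝ) ≤ C' * (Module.finrank ℚ L : ℝ) ^ (1 + ε) := by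
  obtain ⟨c, hc, hdob⟩ := exists_le_log_embeddingHeight κ hε
  set M := Real.log (max 1 (Fintype.card ι * C)) with hM
  have hM0 : 0 ≤ M := Real.log_nonneg (le_max_left _ _)
  have hl2 : 0 < Real.log 2 := Real.log_pos (by norm_num)
  refine ⟨(M + 1) / c + (M + 1) / Real.log 2, by positivity, ?_⟩
  intro L _ _ γ τ hτ0 hNT hγ hC hκ k S₁ S₂ a h₁ h₂ hsum hne
  set d := Module.finrank ℚ L with hd
  have hd1 : (1 : ℝ) ≤ d := by exact_mod_cast (Module.finrank_pos : 0 < Module.finrank ℚ L)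
  have hpos : 0 < ((d : ℝ)) ^ (1 + ε) := by positivity
  have hcd : (Fintype.card ι * C) ^ d ≤ (max 1 (Fintype.card ι * C)) ^ d :=
    pow_le_pow_left₀ (by positivity) (le_max_right _ _) _
  by_cases hInt : IsIntegral ℤ τ⁻¹
  · have h1 := (embeddingHeight_inv_pow_le hτ0 hγ hInt hC0 hC h₁ h₂ hsum hne).trans hcd
    have h2 := hdob L τ⁻¹ hInt (inv_ne_zero hτ0) (fun n hn h => hNT n hn (by
      rwa [inv_pow, inv_eq_one] at h)) hκ
    have hH := one_le_embeddingHeight τ⁻¹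
    have h3 := Real.log_le_log (by positivity) h1
    rw [Real.log_pow, Real.log_pow, ← hM] at h3
    have h4 : (k : ℝ) * c ≤ M * (d : ℝ) ^ (1 + ε) := by
      calc (k : ℝ) * c ≤ k * ((d : ℝ) ^ ε * Real.log (embeddingHeight τ⁻¹)) := by gcongr
        _ = (k * Real.log (embeddingHeight τ⁻¹)) * (d : ℝ) ^ ε := by ring
        _ ≤ (d * M) * (d : ℝ) ^ ε := by gcongr
        _ = M * (d : ℝ) ^ (1 + ε) := by rw [Real.rpow_add (by linarith), Real.rpow_one]; ring
    have h5 : (k : ℝ) ≤ (M / c) * (d : ℝ) ^ (1 + ε) := by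
      rw [div_mul_eq_mul_div, le_div_iff₀ hc]
      exact h4
    refine h5.trans (mul_le_mul_of_nonneg_right ?_ hpos.le)
    have h6 : M / c ≤ (M + 1) / c := by gcongr; linarith
    have h7 : 0 ≤ (M + 1) / Real.log 2 := by positivity
    linarith
  · have h1 := (two_pow_le_of_not_isIntegral_inv hτ0 hγ hInt hC0 hC h₁ h₂ hsum hne).trans hcd
    have h3 := Real.log_le_log (by positivity) h1
    rw [Real.log_pow, Real.log_pow, ← hM] at h3
    have hdd : (d : ℝ) ≤ (d : ℝ) ^ (1 + ε) := by
      conv_lhs => rw [← Real.rpow_one (d : ℝ)]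
      exact Real.rpow_le_rpow_of_exponent_le hd1 (by linarith)
    have h5 : (k : ℝ) ≤ (M / Real.log 2) * (d : ℝ) ^ (1 + ε) := by
      rw [div_mul_eq_mul_div, le_div_iff₀ hl2]
      exact h3.trans (by rw [mul_comm]; gcongr)
    refine h5.trans (mul_le_mul_of_nonneg_right ?_ hpos.le)
    have h6 : M / Real.log 2 ≤ (M + 1) / Real.log 2 := by gcongr; linarith
    have h7 : 0 ≤ (M + 1) / c := by positivity
    linarith

open IntermediateField in
theorem exists_gap_le (K : IntermediateField ℚ ℂ) [FiniteDimensional ℚ K] {ι : Type} [Fintype ι]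
    (γ : ι → K) {ε : ℝ} (hε : 0 < ε) :
    ∃ C : ℝ, 0 < C ∧ ∀ τ : ℂ, IsAlgebraic ℚ τ → τ ≠ 0 → (∀ n : ℕ, 0 < n → τ ^ n ≠ 1) →
      ∀ (k : ℕ) (m : ℤ) (S₁ S₂ : Finset ι) (a : ι → ℤ),
      (∀ i ∈ S₁, a i ≤ m) → (∀ i ∈ S₂, m + k ≤ a i) →
      ∑ i ∈ S₁, (γ i : ℂ) * τ ^ a i + ∑ i ∈ S₂, (γ i : ℂ) * τ ^ a i = 0 →
      ∑ i ∈ S₁, (γ i : ℂ) * τ ^ a i ≠ 0 →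
      (k : ℝ) ≤ C * ((minpoly K τ).natDegree : ℝ) ^ (1 + ε) := by
  classical
  obtain ⟨N, hN0, hN⟩ : ∃ N : ℤ, N ≠ 0 ∧ ∀ i, IsIntegral ℤ ((N : K) * γ i) := by
    obtain ⟨N, hN0, hN⟩ := exists_integral_multiples ℤ ℚ (Finset.univ.image γ)
    refine ⟨N, hN0, fun i => ?_⟩
    have := hN (γ i) (Finset.mem_image_of_mem _ (Finset.mem_univ i))
    rwa [zsmul_eq_mul] at this
  have : NumberField K := ⟨⟩
  set C₀ : ℝ := ∑ σ : K →ₐ[ℚ] ℂ, ∑ i, ‖σ ((N : K) * γ i)‖ with hC₀def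
  have hC₀ : 0 ≤ C₀ := Finset.sum_nonneg fun _ _ => Finset.sum_nonneg fun _ _ => norm_nonneg _
  obtain ⟨C, hC, hgap⟩ := exists_gap_le_of_numberField (Module.finrank ℚ K) hC₀ hε (ι := ι)
  refine ⟨C * (Module.finrank ℚ K : ℝ) ^ (1 + ε), by
    have : 0 < Module.finrank ℚ K := Module.finrank_pos
    positivity, fun τ hτ hτ0 hNT k m S₁ S₂ a h₁ h₂ hsum hne => ?_⟩
  have hτK : IsIntegral K τ := hτ.isIntegral.tower_top
  let L := K⟮τ⟯
  have : FiniteDimensional K L := adjoin.finiteDimensional hτK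
  have : FiniteDimensional ℚ L := FiniteDimensional.trans ℚ K L
  have : NumberField L := ⟨⟩
  let τ' : L := AdjoinSimple.gen K τ
  have hτ' : (τ' : ℂ) = τ := AdjoinSimple.coe_gen K τ
  have hτ'0 : τ' ≠ 0 := fun h => hτ0 (by rw [← hτ', h]; rfl)
  have hfin : Module.finrank ℚ L = Module.finrank ℚ K * (minpoly K τ).natDegree := by
    rw [← adjoin.finrank hτK, Module.finrank_mul_finrank]
  let γ' : ι → L := fun i => algebraMap K L ((N : K) * γ i)
  have hγ'c : ∀ i, ((γ' i : L) : ℂ) = N * (γ i : ℂ) := by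
    intro i
    have : ((γ' i : L) : ℂ) = (((N : K) * γ i : K) : ℂ) := rfl
    rw [this]
    push_cast
    rfl
  have hdeg : (minpoly K τ).natDegree ≤ (minpoly ℚ τ'⁻¹).natDegree := by
    have h1 : minpoly ℚ τ'⁻¹ = minpoly ℚ τ⁻¹ := by
      have := minpoly.algHom_eq (L.val.restrictScalars ℚ) (RingHom.injective _) τ'⁻¹
      rw [← this]
      congr 1
    have hinv : IsIntegral K τ⁻¹ := hτK.inv
    have h2 : K⟮τ⁻¹⟯ = K⟮τ⟯ := by
      apply le_antisymm <;> rw [adjoin_simple_le_iff]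
      · exact inv_mem (mem_adjoin_simple_self K τ)
      · simpa using inv_mem (mem_adjoin_simple_self K τ⁻¹)
    rw [h1, ← adjoin.finrank hτK, ← h2, adjoin.finrank hinv]
    have h3 := minpoly.dvd_map_of_isScalarTower ℚ K τ⁻¹
    have h4 : (minpoly ℚ τ⁻¹).map (algebraMap ℚ K) ≠ 0 := by
      rw [Polynomial.map_ne_zero_iff (algebraMap ℚ K).injective]
      exact minpoly.ne_zero hτ.isIntegral.inv
    exact (Polynomial.natDegree_le_of_dvd h3 h4).trans_eq (Polynomial.natDegree_map _)
  have hval : ∀ S : Finset ι, ((∑ i ∈ S, γ' i * τ' ^ (a i - m) : L) : ℂ) =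
      N * τ ^ (-m) * ∑ i ∈ S, (γ i : ℂ) * τ ^ a i := by
    intro S
    rw [Finset.mul_sum]
    have : ((∑ i ∈ S, γ' i * τ' ^ (a i - m) : L) : ℂ) =
        ∑ i ∈ S, ((γ' i : L) : ℂ) * (τ' : ℂ) ^ (a i - m) := by
      have hz : ∀ n : ℤ, ((τ' ^ n : L) : ℂ) = (τ' : ℂ) ^ n := map_zpow₀ (algebraMap L ℂ) τ'
      simp [hz]
    rw [this]
    refine Finset.sum_congr rfl fun i _ => ?_
    rw [hγ'c, hτ', sub_eq_add_neg, zpow_add₀ hτ0]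
    ring
  have hNC : (N : ℂ) ≠ 0 := by exact_mod_cast hN0
  have hfac : (N : ℂ) * τ ^ (-m) ≠ 0 := mul_ne_zero hNC (zpow_ne_zero _ hτ0)
  have key := hgap L γ' τ' hτ'0 (fun n hn h => hNT n hn (by
      rw [← hτ']
      exact_mod_cast congrArg (fun x : L => (x : ℂ)) h))
    (fun i => map_isIntegral_int (algebraMap K L) (hN i)) (fun σ i => ?_)
    (by rw [hfin]; exact Nat.mul_le_mul_left _ hdeg) k S₁ S₂ (fun i => a i - m)
    (fun i hi => by have := h₁ i hi; omega)
    (fun i hi => by have := h₂ i hi; omega) (by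
      apply Subtype.ext
      have h5 : ((∑ i ∈ S₁, γ' i * τ' ^ (a i - m) + ∑ i ∈ S₂, γ' i * τ' ^ (a i - m) : L) : ℂ) = 0 := by
        rw [L.coe_add, hval, hval, ← mul_add, hsum, mul_zero]
      exact h5) (by
      intro h
      have h6 := hval S₁
      rw [h] at h6
      exact mul_ne_zero hfac hne h6.symm)
  · refine key.trans_eq ?_
    rw [hfin, Nat.cast_mul, Real.mul_rpow (Nat.cast_nonneg _) (Nat.cast_nonneg _), mul_assoc]
  · let σK : K →ₐ[ℚ] ℂ := (σ.comp (algebraMap K L)).toRatAlgHom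
    have h7 : ‖σ (γ' i)‖ ≤ ∑ i, ‖σK ((N : K) * γ i)‖ :=
      Finset.single_le_sum (f := fun i => ‖σK ((N : K) * γ i)‖) (fun _ _ => norm_nonneg _)
        (Finset.mem_univ i)
    refine h7.trans ?_
    exact Finset.single_le_sum (f := fun σ : K →ₐ[ℚ] ℂ => ∑ i, ‖σ ((N : K) * γ i)‖)
      (fun _ _ => Finset.sum_nonneg fun _ _ => norm_nonneg _) (Finset.mem_univ σK)

theorem apply_det_le {A : Type*} [CommRing A] (deg : A → ℕ) (h0 : deg 0 = 0) (h1 : deg 1 = 0)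
    (hneg : ∀ x, deg (-x) = deg x) (hadd : ∀ x y, deg (x + y) ≤ max (deg x) (deg y))
    (hmul : ∀ x y, deg (x * y) ≤ deg x + deg y) {m : Type*} [Fintype m] [DecidableEq m]
    (M : Matrix m m A) {δ : ℕ} (hM : ∀ i j, deg (M i j) ≤ δ) :
    deg M.det ≤ Fintype.card m * δ := by
  rw [Matrix.det_apply]
  refine Finset.sum_induction (p := fun x => deg x ≤ Fintype.card m * δ) _
    (fun x y hx hy => (hadd x y).trans (max_le hx hy)) (by simp [h0]) fun σ _ => ?_
  have hp : ∀ s : Finset m, deg (∏ i ∈ s, M (σ i) i) ≤ s.card * δ := fun s => by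
    classical
    induction s using Finset.induction_on with
    | empty => simp [h1]
    | insert i s hi ih =>
      rw [Finset.prod_insert hi, Finset.card_insert_of_notMem hi]
      linarith [hmul (M (σ i) i) (∏ i ∈ s, M (σ i) i), hM (σ i) i]
  rcases Int.units_eq_one_or (Equiv.Perm.sign σ) with h | h
  · simpa [h] using hp Finset.univ
  · simpa [h, hneg] using hp Finset.univ

open Polynomial in
theorem exists_C_mem_span_pair {A : Type*} [CommRing A] [IsDomain A] (deg : A → ℕ)
    (h0 : deg 0 = 0) (h1 : deg 1 = 0)
    (hneg : ∀ x, deg (-x) = deg x) (hadd : ∀ x y, deg (x + y) ≤ max (deg x) (deg y))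
    (hmul : ∀ x y, deg (x * y) ≤ deg x + deg y) (f g : A[X]) {δ : ℕ}
    (hf : ∀ i, deg (f.coeff i) ≤ δ) (hg : ∀ i, deg (g.coeff i) ≤ δ)
    (hfg : IsCoprime (f.map (algebraMap A (FractionRing A))) (g.map (algebraMap A (FractionRing A)))) :
    ∃ ρ : A, ρ ≠ 0 ∧ C ρ ∈ Ideal.span {f, g} ∧ deg ρ ≤ (f.natDegree + g.natDegree + 1) * δ := by
  have hinj := IsFractionRing.injective A (FractionRing A)
  by_cases H : f.natDegree ≠ 0 ∨ g.natDegree ≠ 0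
  · refine ⟨f.resultant g, ?_, ?_, ?_⟩
    · have := resultant_ne_zero _ _ hfg
      rw [natDegree_map_eq_of_injective hinj, natDegree_map_eq_of_injective hinj,
        resultant_map_map] at this
      exact fun h => this (by rw [h, map_zero])
    · obtain ⟨p, q, -, -, h⟩ := exists_mul_add_mul_eq_C_resultant f g le_rfl le_rfl H
      rw [← h, Ideal.mem_span_pair]
      exact ⟨p, q, by ring⟩
    · have := apply_det_le deg h0 h1 hneg hadd hmul (sylvester f g f.natDegree g.natDegree) (δ := δ)
        (fun i j => by
          rw [sylvester, Matrix.of_apply]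
          induction j using Fin.addCases with
          | left j => simp only [Fin.addCases_left]; split_ifs <;> simp [h0, hg]
          | right j => simp only [Fin.addCases_right]; split_ifs <;> simp [h0, hf])
      rw [Fintype.card_fin] at this
      exact this.trans (Nat.mul_le_mul_right _ (Nat.le_succ _))
  · push Not at H
    obtain ⟨a, ha⟩ := natDegree_eq_zero.1 H.1
    obtain ⟨b, hb⟩ := natDegree_eq_zero.1 H.2
    by_cases ha0 : a = 0
    · refine ⟨b, fun hb0 => ?_, ?_, ?_⟩
      · simp [← ha, ← hb, ha0, hb0, IsCoprime] at hfg
      · rw [hb]; exact Ideal.subset_span (by simp)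
      · have := hg 0
        rw [← hb, coeff_C_zero] at this
        nlinarith
    · refine ⟨a, ha0, ?_, ?_⟩
      · rw [ha]; exact Ideal.subset_span (by simp)
      · have := hf 0
        rw [← ha, coeff_C_zero] at this
        nlinarith

open Polynomial in
theorem isCoprime_map_of_irreducible {A : Type*} [CommRing A] [IsDomain A]
    [UniqueFactorizationMonoid A] {f g : A[X]} (hf : Irreducible f) (hf0 : f.natDegree ≠ 0)
    (h : ¬ f ∣ g) :
    IsCoprime (f.map (algebraMap A (FractionRing A))) (g.map (algebraMap A (FractionRing A))) := by
  classical
  let : NormalizedGCDMonoid A := Classical.arbitrary _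
  have hp := hf.isPrimitive hf0
  exact ((hp.irreducible_iff_irreducible_map_fraction_map (K := FractionRing A)).1
    hf).coprime_iff_not_dvd.2 fun hd => h (hp.dvd_of_fraction_map_dvd_fraction_map hd)

theorem exists_rename_some_mem_span_pair {A : Type*} [Field A] {σ : Type*} [Finite σ]
    {P S : MvPolynomial (Option σ) A} (hP : Irreducible P) (hPS : ¬ P ∣ S) :
    ∃ ρ : MvPolynomial σ A, ρ ≠ 0 ∧ MvPolynomial.rename some ρ ∈ Ideal.span {P, S} ∧
      ρ.totalDegree ≤ (P.totalDegree + S.totalDegree + 1) ^ 2 := by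
  classical
  set Φ := MvPolynomial.optionEquivLeft A σ with hΦ
  have hsymm : ∀ ρ : MvPolynomial σ A, Φ (MvPolynomial.rename some ρ) = Polynomial.C ρ := by
    intro ρ
    induction ρ using MvPolynomial.induction_on with
    | C a => simp [hΦ, MvPolynomial.optionEquivLeft_C]
    | add p q hp hq => simp [hp, hq]
    | mul_X p i hp => rw [map_mul, map_mul, hp]; simp [hΦ, MvPolynomial.optionEquivLeft_X_some]
  have hPi : Irreducible (Φ P) := (MulEquiv.irreducible_iff Φ).2 hP
  have hdeg1 (p : MvPolynomial (Option σ) A) : (Φ p).natDegree ≤ p.totalDegree :=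
    (MvPolynomial.natDegree_optionEquivLeft A p).trans_le (MvPolynomial.degreeOf_le_totalDegree _ _)
  have hdeg2 (p : MvPolynomial (Option σ) A) (i : ℕ) : ((Φ p).coeff i).totalDegree ≤ p.totalDegree :=
    MvPolynomial.totalDegree_coeff_optionEquivLeft_le _ _ _ _
  by_cases h0 : (Φ P).natDegree = 0
  · obtain ⟨ρ, hρ⟩ := Polynomial.natDegree_eq_zero.1 h0
    refine ⟨ρ, fun h => hPi.ne_zero (by rw [← hρ, h, map_zero]), ?_, ?_⟩
    · have : MvPolynomial.rename some ρ = P := Φ.injective (by rw [hsymm, hρ])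
      rw [this]
      exact Ideal.subset_span (by simp)
    · have := hdeg2 P 0
      rw [← hρ, Polynomial.coeff_C_zero] at this
      exact this.trans (le_trans (by omega) (Nat.le_self_pow two_ne_zero _))
  · obtain ⟨ρ, hρ, hmem, hdeg⟩ := exists_C_mem_span_pair (A := MvPolynomial σ A)
      MvPolynomial.totalDegree (by simp) (by simp) (fun x => MvPolynomial.totalDegree_neg x)
      MvPolynomial.totalDegree_add MvPolynomial.totalDegree_mul (Φ P) (Φ S)
      (δ := P.totalDegree + S.totalDegree) (fun i => (hdeg2 P i).trans (Nat.le_add_right _ _))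
      (fun i => (hdeg2 S i).trans (Nat.le_add_left _ _))
      (isCoprime_map_of_irreducible hPi h0 (fun h => hPS ((map_dvd_iff Φ).1 h)))
    refine ⟨ρ, hρ, ?_, ?_⟩
    · rw [Ideal.mem_span_pair] at hmem ⊢
      obtain ⟨a, b, h⟩ := hmem
      refine ⟨Φ.symm a, Φ.symm b, Φ.injective ?_⟩
      simp [hsymm, h]
    · nlinarith [hdeg, hdeg1 P, hdeg1 S]

theorem exists_rename_val_mem_span_pair {A : Type*} [Field A] {σ : Type*} [Finite σ] (j : σ)
    {P S : MvPolynomial σ A} (hP : Irreducible P) (hPS : ¬ P ∣ S) :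
    ∃ ρ : MvPolynomial {i // i ≠ j} A, ρ ≠ 0 ∧
      MvPolynomial.rename Subtype.val ρ ∈ Ideal.span {P, S} ∧
      ρ.totalDegree ≤ (P.totalDegree + S.totalDegree + 1) ^ 2 := by
  classical
  set Φ := MvPolynomial.renameEquiv A (Equiv.optionSubtypeNe j).symm with hΦ
  obtain ⟨ρ, hρ, hmem, hdeg⟩ := exists_rename_some_mem_span_pair (P := Φ P) (S := Φ S)
    ((MulEquiv.irreducible_iff Φ).2 hP) (fun h => hPS ((map_dvd_iff Φ).1 h))
  refine ⟨ρ, hρ, ?_, ?_⟩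
  · have hs : Φ (MvPolynomial.rename Subtype.val ρ) = MvPolynomial.rename some ρ := by
      rw [hΦ, MvPolynomial.renameEquiv_apply, MvPolynomial.rename_rename]
      congr 1
      congr 1
      funext i
      simp [Equiv.optionSubtypeNe_symm_apply, i.2]
    rw [Ideal.mem_span_pair] at hmem ⊢
    obtain ⟨a, b, h⟩ := hmem
    refine ⟨Φ.symm a, Φ.symm b, Φ.injective ?_⟩
    rw [hs, ← h]
    simp only [map_add, map_mul, AlgEquiv.apply_symm_apply]
  · rwa [hΦ, MvPolynomial.totalDegree_renameEquiv, MvPolynomial.totalDegree_renameEquiv] at hdeg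

/-- The transcendence degree over `K` of the extension generated by a family of complex numbers. -/
noncomputable def familyTrdeg (K : Type*) [Field K] [Algebra K ℂ] {α : Type*} (u : α → ℂ) : ℕ∞ :=
  (AlgebraicIndependent.matroid K ℂ).eRk (Set.range u)

section
variable {K : Type*} [Field K] [Algebra K ℂ]

theorem familyTrdeg_le_of_isAlgebraic {α β : Type*} {u : α → ℂ} {x : β → ℂ}
    (h : ∀ i, IsAlgebraic (Algebra.adjoin K (Set.range x)) (u i)) :
    familyTrdeg K u ≤ familyTrdeg K x := by
  unfold familyTrdeg
  rw [← Matroid.eRk_closure_eq _ (Set.range x)]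
  refine Matroid.eRk_mono _ ?_
  rw [AlgebraicIndependent.matroid_closure_eq]
  rintro _ ⟨i, rfl⟩
  exact h i

theorem card_le_familyTrdeg {α : Type*} [Fintype α] {u : α → ℂ} (h : AlgebraicIndependent K u) :
    (Fintype.card α : ℕ∞) ≤ familyTrdeg K u := by
  have hi : (AlgebraicIndependent.matroid K ℂ).Indep (Set.range u) := by
    rw [AlgebraicIndependent.matroid_indep_iff]
    exact h.coe_range
  rw [familyTrdeg, hi.eRk_eq_encard, ← Set.image_univ,
    h.injective.injOn.encard_image, Set.encard_univ, ENat.card_eq_coe_fintype_card]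

theorem familyTrdeg_mono {α β : Type*} (u : α → ℂ) (f : β → α) :
    familyTrdeg K (u ∘ f) ≤ familyTrdeg K u :=
  Matroid.eRk_mono _ (Set.range_comp_subset_range f u)

theorem exists_algebraicIndependent_ne {α : Type*} [Fintype α] [Nonempty α] {u : α → ℂ}
    (h : (Fintype.card α : ℕ∞) ≤ familyTrdeg K u + 1) :
    ∃ j : α, AlgebraicIndependent K (fun i : {i // i ≠ j} => u i) := by
  classical
  obtain ⟨B, hB⟩ := (AlgebraicIndependent.matroid K ℂ).exists_isBasis (Set.range u)
    (Set.subset_univ _)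
  have hBi : AlgebraicIndependent K (fun b : B => (b : ℂ)) :=
    AlgebraicIndependent.matroid_indep_iff.1 hB.indep
  rw [familyTrdeg, ← hB.encard_eq_eRk] at h
  have hsub := hB.subset
  choose g hg using fun b : B => hsub b.2
  have hginj : Function.Injective g := fun b b' hbb => Subtype.ext (by rw [← hg b, ← hg b', hbb])
  have hcard : Fintype.card α ≤ (Set.range g).ncard + 1 := by
    have hfin : (Set.range g).Finite := Set.toFinite _
    rw [← Set.image_univ, Set.ncard_image_of_injective _ hginj, Set.ncard_univ]
    have : Finite B := Finite.of_injective g hginj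
    rw [← B.toFinite.cast_ncard_eq, ← Nat.card_coe_set_eq] at h
    exact_mod_cast h
  obtain ⟨j, hj⟩ : ∃ j, ∀ i ≠ j, i ∈ Set.range g := by
    by_contra! hcon
    obtain ⟨i₁, -, h₁⟩ := hcon (Classical.arbitrary α)
    obtain ⟨i₂, h₁₂, h₂⟩ := hcon i₁
    have hsub : Set.range g ⊆ ({i₁, i₂} : Set α)ᶜ := fun x hx hx' => by
      rcases hx' with rfl | rfl
      exacts [h₁ hx, h₂ hx]
    have := Set.ncard_le_ncard hsub (Set.toFinite _)
    rw [Set.ncard_compl, Set.ncard_pair h₁₂.symm, Nat.card_eq_fintype_card] at this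
    have : 2 ≤ Fintype.card α := by
      simpa [Set.ncard_pair h₁₂.symm] using Set.ncard_le_card ({i₁, i₂} : Set α)
    omega
  choose f hf using fun i : {i // i ≠ j} => hj i i.2
  refine ⟨j, ?_⟩
  have := hBi.comp f fun i i' hii => Subtype.ext (by rw [← hf i, ← hf i', hii])
  convert this using 2 with i
  rw [Function.comp_apply, ← hg, hf]

end

section
variable {K : Type*} [Field K] [Algebra K ℂ]

theorem isAlgebraic_zpow {R : Subalgebra K ℂ} {x : ℂ} (hx : IsAlgebraic R x) (n : ℤ) :
    IsAlgebraic R (x ^ n) := by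
  cases n with
  | ofNat n => simpa using hx.pow n
  | negSucc n => simpa [zpow_negSucc] using (hx.pow (n + 1)).inv

theorem isAlgebraic_prod {ι : Type*} {R : Subalgebra K ℂ} (s : Finset ι) {x : ι → ℂ}
    (hx : ∀ i, IsAlgebraic R (x i)) : IsAlgebraic R (∏ i ∈ s, x i) :=
  Finset.prod_induction _ (IsAlgebraic R) (fun _ _ ha hb => ha.mul hb) isAlgebraic_one
    fun i _ => hx i

theorem isAlgebraic_adjoin_range {ι : Type*} (x : ι → ℂ) (i : ι) :
    IsAlgebraic (Algebra.adjoin K (Set.range x)) (x i) :=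
  isAlgebraic_algebraMap (⟨x i, Algebra.subset_adjoin ⟨i, rfl⟩⟩ : Algebra.adjoin K (Set.range x))

theorem isAlgebraic_exp_sum_mul {ι α : Type*} [Fintype α] (z : α → ℂ) (e : α → ι → ℤ) (i : ι) :
    IsAlgebraic (Algebra.adjoin K (Set.range fun j => Complex.exp (z j)))
      (Complex.exp (∑ j, z j * e j i)) := by
  rw [Complex.exp_sum]
  refine isAlgebraic_prod _ fun j => ?_
  rw [mul_comm, Complex.exp_int_mul]
  exact isAlgebraic_zpow (isAlgebraic_adjoin_range (fun j => Complex.exp (z j)) j) _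

theorem exists_int_dual {ι α : Type*} [Fintype ι] [Fintype α] [DecidableEq α] {e : α → ι → ℤ}
    (he : LinearIndependent ℂ (fun j i => (e j i : ℂ))) (j : α) :
    ∃ (D : ℤ) (m : ι → ℤ), D ≠ 0 ∧ ∀ j', ∑ i, m i * e j' i = if j' = j then D else 0 := by
  classical
  have hQ : LinearIndependent ℚ (fun j i => (e j i : ℚ)) := by
    have h1 := he.restrict_scalars' ℚ
    let f : (ι → ℚ) →ₗ[ℚ] (ι → ℂ) := LinearMap.pi fun i =>
      (Algebra.linearMap ℚ ℂ).comp (LinearMap.proj i)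
    refine LinearIndependent.of_comp f ?_
    convert h1 using 2 with j'
    ext i
    simp [f]
  let L := Fintype.linearCombination ℚ (fun j i => (e j i : ℚ))
  obtain ⟨g, hg⟩ := LinearMap.exists_leftInverse_of_injective L
    (LinearMap.ker_eq_bot.2 (linearIndependent_iff_injective_fintypeLinearCombination.1 hQ))
  have hge : ∀ j', g (fun i => (e j' i : ℚ)) = Pi.single j' 1 := fun j' => by
    have := LinearMap.congr_fun hg (Pi.single j' 1)
    simpa [L, Fintype.linearCombination_apply_single] using this
  obtain ⟨D, hD⟩ := IsLocalization.exist_integer_multiples_of_finite (nonZeroDivisors ℤ)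
    (fun i : ι => g (Pi.single i 1) j)
  choose m hm using hD
  refine ⟨D, m, nonZeroDivisors.ne_zero D.2, fun j' => ?_⟩
  have h1 : ∑ i, (e j' i : ℚ) * g (Pi.single i 1) j = if j' = j then 1 else 0 := by
    have h2 : (fun i => (e j' i : ℚ)) = ∑ i, (e j' i : ℚ) • Pi.single i (1 : ℚ) := by
      ext i
      simp [Finset.sum_apply, Pi.single_apply]
    have h3 := hge j'
    rw [h2, map_sum] at h3
    have := congrFun h3 j
    simpa [Pi.single_apply, eq_comm] using this
  have h4 : ((∑ i, m i * e j' i : ℤ) : ℚ) = ((if j' = j then (D : ℤ) else 0 : ℤ) : ℚ) := by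
    push_cast
    rw [← mul_one ((D : ℤ) : ℚ), ← mul_zero ((D : ℤ) : ℚ), ← mul_ite, ← h1, Finset.mul_sum]
    refine Finset.sum_congr rfl fun i _ => ?_
    have := hm i
    simp only [algebraMap_int_eq, eq_intCast, zsmul_eq_mul] at this
    rw [this]; ring
  exact_mod_cast h4

theorem isAlgebraic_exp_of_linearIndependent {ι α : Type*} [Fintype ι] [Fintype α]
    {e : α → ι → ℤ} (he : LinearIndependent ℂ (fun j i => (e j i : ℂ))) (z : α → ℂ) (j : α) :
    IsAlgebraic (Algebra.adjoin K (Set.range fun i => Complex.exp (∑ j, z j * e j i)))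
      (Complex.exp (z j)) := by
  classical
  obtain ⟨D, m, hD, hm⟩ := exists_int_dual he j
  set x := fun i => Complex.exp (∑ j, z j * e j i) with hx
  have h1 : Complex.exp (z j) ^ D = ∏ i, x i ^ m i := by
    simp only [hx, ← Complex.exp_int_mul, ← Complex.exp_sum]
    congr 1
    simp_rw [Finset.mul_sum]
    rw [Finset.sum_comm]
    have : ∀ j', ∑ i, (m i : ℂ) * (z j' * e j' i) = z j' * if j' = j then (D : ℂ) else 0 := by
      intro j'
      have := congrArg (Int.cast : ℤ → ℂ) (hm j')
      push_cast at this
      rw [← this, Finset.mul_sum]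
      exact Finset.sum_congr rfl fun i _ => by ring
    simp only [this]
    simp
    ring
  have h2 : IsAlgebraic (Algebra.adjoin K (Set.range x)) (Complex.exp (z j) ^ D) := by
    rw [h1]
    exact isAlgebraic_prod _ fun i => isAlgebraic_zpow (isAlgebraic_adjoin_range x i) _
  have h3 : IsAlgebraic (Algebra.adjoin K (Set.range x)) (Complex.exp (z j) ^ D.natAbs) := by
    rcases Int.natAbs_eq D with h | h
    · rw [h, zpow_natCast] at h2
      exact h2
    · rw [h, zpow_neg, zpow_natCast] at h2
      exact IsAlgebraic.inv_iff.1 h2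
  exact h3.of_pow (Int.natAbs_pos.2 hD)

theorem exists_irreducible_forall_dvd {α : Type*} [Finite α] {u : α → ℂ} {j : α}
    (hj : AlgebraicIndependent K (fun i : {i // i ≠ j} => u i)) {G : MvPolynomial α K}
    (hG : G ≠ 0) (hGu : MvPolynomial.aeval u G = 0) :
    ∃ P : MvPolynomial α K, Irreducible P ∧ MvPolynomial.aeval u P = 0 ∧
      ∀ S : MvPolynomial α K, MvPolynomial.aeval u S = 0 → P ∣ S := by
  have hk : (RingHom.ker (MvPolynomial.aeval (R := K) u)).IsPrime := RingHom.ker_isPrime _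
  obtain ⟨P, hP, hPp⟩ := hk.exists_mem_prime_of_ne_bot
    (fun h => hG (by rw [← Ideal.mem_bot, ← h]; exact hGu))
  refine ⟨P, hPp.irreducible, hP, fun S hS => ?_⟩
  by_contra hPS
  obtain ⟨ρ, hρ, hmem, -⟩ := exists_rename_val_mem_span_pair j hPp.irreducible hPS
  have h0 : MvPolynomial.aeval u (MvPolynomial.rename Subtype.val ρ) = 0 := by
    refine (Ideal.span_le.2 ?_ hmem : _ ∈ RingHom.ker (MvPolynomial.aeval (R := K) u))
    rintro _ (rfl | rfl)
    exacts [hP, hS]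
  rw [MvPolynomial.aeval_rename] at h0
  exact hρ ((algebraicIndependent_iff.1 hj) ρ h0)

open Polynomial in
theorem exists_aeval_eq_zero_of_algebraicIndependent {σ : Type*} {θ : σ → ℂ}
    (hθ : AlgebraicIndependent K θ) {R : MvPolynomial (Option σ) K}
    (hR : R.degreeOf none ≠ 0) :
    ∃ u : Option σ → ℂ, (∀ i, u (some i) = θ i) ∧ MvPolynomial.aeval u R = 0 := by
  set φ : MvPolynomial σ K →+* ℂ := (MvPolynomial.aeval (R := K) θ).toRingHom with hφ
  have hinj : Function.Injective φ := hθ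
  set f := (MvPolynomial.optionEquivLeft K σ R).map φ with hf
  have hdeg : f.degree ≠ 0 := by
    intro h
    apply hR
    rw [← MvPolynomial.natDegree_optionEquivLeft, ← natDegree_map_eq_of_injective hinj]
    exact natDegree_eq_of_degree_eq_some h
  obtain ⟨z, hz⟩ := IsAlgClosed.exists_root f hdeg
  refine ⟨fun i => i.elim z θ, fun i => rfl, ?_⟩
  have h1 : ∀ p : MvPolynomial (Option σ) K, MvPolynomial.aeval (fun i => i.elim z θ) p =
      eval z ((MvPolynomial.optionEquivLeft K σ p).map φ) := by
    intro p
    induction p using MvPolynomial.induction_on with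
    | C a => simp [MvPolynomial.optionEquivLeft_C, hφ]
    | add p q hp hq => simp [hp, hq]
    | mul_X p i hp =>
      rw [map_mul, map_mul, Polynomial.map_mul, eval_mul, hp]
      congr 1
      cases i with
      | none => simp [MvPolynomial.optionEquivLeft_X_none]
      | some i => simp [MvPolynomial.optionEquivLeft_X_some, hφ]
  rw [h1]
  exact hz

theorem exists_generic_point {α : Type*} [Finite α] {θ : α → ℂ} (hθ : AlgebraicIndependent K θ)
    {R : MvPolynomial α K} (hR : Irreducible R) :
    ∃ (u : α → ℂ) (j : α), AlgebraicIndependent K (fun i : {i // i ≠ j} => u i) ∧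
      MvPolynomial.aeval u R = 0 ∧ ∀ S, ¬ R ∣ S → MvPolynomial.aeval u S ≠ 0 := by
  classical
  obtain ⟨j, hj⟩ : ∃ j, R.degreeOf j ≠ 0 := by
    by_contra! h
    have h0 : R.totalDegree = 0 := by
      rw [MvPolynomial.totalDegree_eq_zero_iff]
      intro m hm i
      have := MvPolynomial.monomial_le_degreeOf i hm
      rw [h i] at this
      omega
    rw [MvPolynomial.totalDegree_eq_zero_iff_eq_C] at h0
    refine hR.not_isUnit ?_
    rw [h0]
    refine (IsUnit.mk0 _ fun h1 => hR.ne_zero ?_).map MvPolynomial.C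
    rw [h0, h1, map_zero]
  set E := Equiv.optionSubtypeNe j with hE
  obtain ⟨u, hu, hu0⟩ := exists_aeval_eq_zero_of_algebraicIndependent
    (hθ.comp (Subtype.val : {i // i ≠ j} → α) Subtype.val_injective)
    (R := MvPolynomial.rename E.symm R) (by
      have : none = E.symm j := by simp [hE]
      rwa [this, MvPolynomial.degreeOf_rename_of_injective E.symm.injective])
  rw [MvPolynomial.aeval_rename] at hu0
  have hu' : ∀ i : {i // i ≠ j}, (u ∘ E.symm) i = θ i := fun i => by
    have : E.symm i = some i := by simp [hE, Equiv.optionSubtypeNe_symm_apply, i.2]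
    rw [Function.comp_apply, this, hu]
    rfl
  have hind : AlgebraicIndependent K (fun i : {i // i ≠ j} => (u ∘ E.symm) i) := by
    simp_rw [hu']
    exact hθ.comp _ Subtype.val_injective
  refine ⟨u ∘ E.symm, j, hind, hu0, fun S hS h0 => ?_⟩
  obtain ⟨P, hP, -, hdvd⟩ := exists_irreducible_forall_dvd hind hR.ne_zero hu0
  exact hS (((hP.associated_of_dvd hR (hdvd R hu0)).symm.dvd).trans (hdvd S h0))

end

theorem exists_algebraicIndependent_complex (K : IntermediateField ℚ ℂ) [FiniteDimensional ℚ K]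
    (α : Type) [Finite α] : ∃ θ : α → ℂ, AlgebraicIndependent K θ := by
  obtain ⟨ι, x, hx⟩ := exists_isTranscendenceBasis' ℚ ℂ
  have hc : Cardinal.mk ℂ = Cardinal.mk ι :=
    IsAlgClosed.cardinal_eq_cardinal_transcendence_basis_of_aleph0_lt' x hx
      (by simp) (by rw [Cardinal.mk_complex]; exact Cardinal.aleph0_lt_continuum)
  have : Infinite ι := by
    rw [Cardinal.infinite_iff, ← hc, Cardinal.mk_complex]
    exact Cardinal.aleph0_le_continuum
  obtain ⟨n, ⟨f⟩⟩ := Finite.exists_equiv_fin α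
  refine ⟨_, (hx.1.extendScalars K).comp (fun a => Infinite.natEmbedding ι (f a)) ?_⟩
  exact (Infinite.natEmbedding ι).injective.comp (Fin.val_injective.comp f.injective)

theorem sum_mul_pow_ne_zero {s : Type*} [Fintype s] {σ : s → ℕ} (hσ : Function.Injective σ)
    {B : ℕ} {x : s → ℤ} (hx : x ≠ 0) (hxB : ∀ i, |x i| < B) :
    ∑ i, x i * (B : ℤ) ^ σ i ≠ 0 := by
  classical
  obtain ⟨i₁, hi₁⟩ := Function.ne_iff.1 hx
  obtain ⟨i₀, hi₀, hmin⟩ := Finset.exists_min_image (Finset.univ.filter fun i => x i ≠ 0) σ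
    ⟨i₁, by simpa using hi₁⟩
  simp only [Finset.mem_filter, Finset.mem_univ, true_and] at hi₀ hmin
  have hB : (B : ℤ) ≠ 0 := by
    have := (abs_nonneg (x i₀)).trans_lt (hxB i₀)
    exact this.ne'
  intro h
  rw [← Finset.add_sum_erase _ _ (Finset.mem_univ i₀)] at h
  have hdvd : (B : ℤ) ^ (σ i₀ + 1) ∣ ∑ i ∈ Finset.univ.erase i₀, x i * (B : ℤ) ^ σ i := by
    refine Finset.dvd_sum fun i hi => ?_
    by_cases hxi : x i = 0
    · simp [hxi]
    · refine Dvd.dvd.mul_left (pow_dvd_pow _ ?_) _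
      have h1 := hmin i hxi
      have h2 : σ i₀ ≠ σ i := fun h => (Finset.ne_of_mem_erase hi) (hσ h).symm
      omega
  have h1 : (B : ℤ) ^ (σ i₀ + 1) ∣ x i₀ * (B : ℤ) ^ σ i₀ := by
    rw [eq_neg_of_add_eq_zero_left h]
    exact hdvd.neg_right
  rw [pow_succ, mul_comm (x i₀)] at h1
  exact hi₀ (Int.eq_zero_of_abs_lt_dvd (Int.dvd_of_mul_dvd_mul_left (pow_ne_zero _ hB) h1) (hxB i₀))

section
open Polynomial
variable {K : Type*} [Field K] {s : Type*} [Fintype s]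

theorem aeval_X_pow_monomial (m : s → ℕ) (α : s →₀ ℕ) (c : K) :
    MvPolynomial.aeval (fun i => (X : K[X]) ^ m i) (MvPolynomial.monomial α c) =
      monomial (∑ i, α i * m i) c := by
  rw [MvPolynomial.aeval_monomial, Finsupp.prod_fintype _ _ (by simp), ← C_mul_X_pow_eq_monomial,
    ← Finset.prod_pow_eq_pow_sum]
  simp_rw [← pow_mul, mul_comm (m _)]
  rfl

theorem coeff_aeval_X_pow {m : s → ℕ} {B : ℕ}
    (hm : ∀ x : s → ℤ, x ≠ 0 → (∀ i, |x i| < B) → ∑ i, x i * (m i : ℤ) ≠ 0)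
    {p : MvPolynomial s K} (hp : p.totalDegree < B) {α : s →₀ ℕ} (hα : ∀ i, α i < B) :
    (MvPolynomial.aeval (fun i => (X : K[X]) ^ m i) p).coeff (∑ i, α i * m i) = p.coeff α := by
  classical
  conv_lhs => rw [p.as_sum]
  simp only [map_sum, aeval_X_pow_monomial, finsetSum_coeff, coeff_monomial]
  have key : ∀ β ∈ p.support, (∑ i, β i * m i = ∑ i, α i * m i) → β = α := by
    intro β hβ h
    by_contra hne
    refine hm (fun i => (β i : ℤ) - α i) (fun h0 => hne (Finsupp.ext fun i => ?_)) (fun i => ?_) ?_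
    · have := congrFun h0 i
      simp only [Pi.zero_apply] at this
      omega
    · have h1 : β i < B := ((MvPolynomial.monomial_le_degreeOf i hβ).trans
        (MvPolynomial.degreeOf_le_totalDegree _ _)).trans_lt hp
      have h2 := hα i
      rw [abs_lt]; constructor <;> omega
    · have : ((∑ i, β i * m i : ℕ) : ℤ) = ((∑ i, α i * m i : ℕ) : ℤ) := by rw [h]
      push_cast at this
      simp [sub_mul, this]
  rw [Finset.sum_eq_single α]
  · simp
  · intro β hβ hne
    rw [if_neg fun h => hne (key β hβ h)]
  · intro h
    simpa using h

theorem aeval_X_pow_ne_zero {m : s → ℕ} {B : ℕ}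
    (hm : ∀ x : s → ℤ, x ≠ 0 → (∀ i, |x i| < B) → ∑ i, x i * (m i : ℤ) ≠ 0)
    {p : MvPolynomial s K} (hp : p.totalDegree < B) (hp0 : p ≠ 0) :
    MvPolynomial.aeval (fun i => (X : K[X]) ^ m i) p ≠ 0 := by
  obtain ⟨α, hα⟩ := MvPolynomial.exists_coeff_ne_zero hp0
  intro h
  refine hα ?_
  rw [← coeff_aeval_X_pow hm hp (α := α), h, coeff_zero]
  exact fun i => ((MvPolynomial.monomial_le_degreeOf i (MvPolynomial.mem_support_iff.2 hα)).trans
    (MvPolynomial.degreeOf_le_totalDegree _ _)).trans_lt hp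

theorem natDegree_aeval_X_pow_le {m : s → ℕ} {b : ℕ} (hb : ∀ i, m i ≤ b) (p : MvPolynomial s K) :
    (MvPolynomial.aeval (fun i => (X : K[X]) ^ m i) p).natDegree ≤ p.totalDegree * b := by
  classical
  conv_lhs => rw [p.as_sum]
  rw [map_sum]
  refine natDegree_sum_le_of_forall_le _ _ fun α hα => ?_
  rw [aeval_X_pow_monomial]
  refine (natDegree_monomial_le _).trans ?_
  calc ∑ i, α i * m i ≤ ∑ i, α i * b := Finset.sum_le_sum fun i _ => Nat.mul_le_mul_left _ (hb i)
    _ = (α.sum fun _ e => e) * b := by rw [← Finset.sum_mul, Finsupp.sum_fintype _ _ (by simp)]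
    _ ≤ _ := Nat.mul_le_mul_right _ (MvPolynomial.le_totalDegree hα)

theorem not_pow_card_dvd_sum_monomial {ι : Type*} {S : Finset ι} (hS : S.Nonempty) {c : ι → ℂ}
    (hc : ∀ i ∈ S, c i ≠ 0) {n : ι → ℕ} (hn : ∀ i ∈ S, ∀ j ∈ S, i ≠ j → n i ≠ n j) {ζ : ℂ}
    (hζ : ζ ≠ 0) : ¬ (X - C ζ) ^ S.card ∣ ∑ i ∈ S, monomial (n i) (c i) := by
  intro h
  have hx : ∀ x ≤ S.card,
      (X - C ζ) ^ (S.card - x) ∣ ∑ i ∈ S, monomial (n i) (c i * (n i : ℂ) ^ x) := by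
    intro x
    induction x with
    | zero => intro _; simpa using h
    | succ x ih =>
      intro hxS
      obtain ⟨q, hq⟩ := ih (by omega)
      have h1 : ∑ i ∈ S, monomial (n i) (c i * (n i : ℂ) ^ (x + 1)) =
          X * derivative (∑ i ∈ S, monomial (n i) (c i * (n i : ℂ) ^ x)) := by
        rw [derivative_sum, Finset.mul_sum]
        refine Finset.sum_congr rfl fun i _ => ?_
        rw [derivative_monomial]
        rcases Nat.eq_zero_or_pos (n i) with h0 | h0
        · simp [h0]
        · rw [X_mul_monomial, Nat.sub_add_cancel h0]
          congr 1
          ring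
      have h2 : S.card - x = (S.card - (x + 1)) + 1 := by omega
      rw [h1, hq, h2, pow_succ, mul_assoc, derivative_mul, derivative_pow]
      have h3 : (X - C ζ) ^ (S.card - (x + 1)) ∣
          C ((S.card - (x + 1) : ℕ) : ℂ) * (X - C ζ) ^ (S.card - (x + 1) - 1) *
            derivative (X - C ζ) * ((X - C ζ) * q) := by
        generalize S.card - (x + 1) = y
        cases y with
        | zero => simp
        | succ y =>
          exact ⟨C ((y + 1 : ℕ) : ℂ) * derivative (X - C ζ) * q, by
            rw [Nat.add_sub_cancel, pow_succ]; ring⟩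
      exact Dvd.dvd.mul_left (dvd_add h3 ⟨_, rfl⟩) _
  obtain ⟨i, hi, j, hj, hij, hnij⟩ := exists_eq_of_forall_sum_mul_pow_eq_zero S hS
    (fun i => c i * ζ ^ n i) (fun i => (n i : ℂ)) (fun i hi => mul_ne_zero (hc i hi)
      (pow_ne_zero _ hζ)) (fun x hxS => by
        have h1 := (dvd_pow_self (X - C ζ) (by omega : S.card - x ≠ 0)).trans (hx x hxS.le)
        rw [dvd_iff_isRoot, IsRoot.def, eval_finsetSum] at h1
        rw [← h1]
        refine Finset.sum_congr rfl fun i _ => ?_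
        rw [eval_monomial]; ring)
  exact hn i hi j hj hij (by exact_mod_cast hnij)

end

section
open Polynomial
variable {K : Type*} [Field K] [Algebra K ℂ] {s : Type*} [Fintype s]

omit [Fintype s] in
theorem aeval_map_aeval_X_pow (m : s → ℕ) (p : MvPolynomial s K) (ζ : ℂ) :
    eval ζ ((MvPolynomial.aeval (fun i => (X : K[X]) ^ m i) p).map (algebraMap K ℂ)) =
      MvPolynomial.aeval (fun i => ζ ^ m i) p := by
  rw [eval_map_algebraMap, ← AlgHom.comp_apply]
  congr 1
  ext i
  simp

omit [Algebra K ℂ] [Fintype s] in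
theorem totalDegree_sum_monomial_le {ι : Type*} (S : Finset ι) (γ : ι → K) {α : ι → s →₀ ℕ} {d : ℕ}
    (hd : ∀ i ∈ S, ((α i).sum fun _ e => e) ≤ d) :
    (∑ i ∈ S, MvPolynomial.monomial (α i) (γ i)).totalDegree ≤ d :=
  MvPolynomial.totalDegree_finsetSum_le fun i hi =>
    (MvPolynomial.totalDegree_monomial_le _ _).trans (hd i hi)

omit [Algebra K ℂ] [Fintype s] in
theorem sum_monomial_ne_zero {ι : Type*} {S : Finset ι} (hS : S.Nonempty) {γ : ι → K}
    (hγ : ∀ i ∈ S, γ i ≠ 0) {α : ι → s →₀ ℕ} (hα : ∀ i ∈ S, ∀ j ∈ S, i ≠ j → α i ≠ α j) :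
    ∑ i ∈ S, MvPolynomial.monomial (α i) (γ i) ≠ 0 := by
  classical
  obtain ⟨i₀, hi₀⟩ := hS
  intro h
  have := congrArg (MvPolynomial.coeff (α i₀)) h
  rw [MvPolynomial.coeff_sum, Finset.sum_eq_single i₀] at this
  · exact hγ i₀ hi₀ (by simpa using this)
  · intro i hi hne
    rw [MvPolynomial.coeff_monomial, if_neg (hα i hi i₀ hi₀ hne)]
  · exact fun h => (h hi₀).elim

theorem exists_not_isOfFinOrder_root {ι : Type*} {S : Finset ι} (hS : S.Nonempty) {γ : ι → K}
    (hγ : ∀ i ∈ S, γ i ≠ 0) {M : ℕ}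
    (hM : ∀ ζ : ℂ, IsOfFinOrder ζ → ∀ a : ι → ℤ, ∑ i ∈ S, algebraMap K ℂ (γ i) * ζ ^ a i = 0 →
      ∃ i ∈ S, ∃ j ∈ S, i ≠ j ∧ (ζ ^ (a i - a j)) ^ M = 1)
    {α : ι → s →₀ ℕ} {d : ℕ} (hd : ∀ i ∈ S, ((α i).sum fun _ e => e) ≤ d)
    {P : MvPolynomial s K} (hP : Irreducible P)
    (hPG : P ∣ ∑ i ∈ S, MvPolynomial.monomial (α i) (γ i))
    (hPQ : ∀ i ∈ S, ∀ j ∈ S, i ≠ j →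
      ¬ P ∣ MvPolynomial.monomial (M • α i) 1 - MvPolynomial.monomial (M • α j) 1)
    {j : s} (hj : P.degreeOf j ≠ 0) (hXj : ¬ MvPolynomial.X j ∣ P) {m : s → ℕ} {B : ℕ}
    (hm : ∀ x : s → ℤ, x ≠ 0 → (∀ i, |x i| < B) → ∑ i, x i * (m i : ℤ) ≠ 0)
    (hmj : ∀ i ≠ j, m i * B ≤ m j) (hmj0 : 0 < m j)
    (hB : d + S.card ^ 3 * (d + M * d + 1) ^ 2 < B) :
    ∃ τ : ℂ, τ ≠ 0 ∧ ¬ IsOfFinOrder τ ∧ MvPolynomial.aeval (fun i => τ ^ m i) P = 0 := by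
  classical
  by_contra! hcon
  have hα : ∀ i ∈ S, ∀ j ∈ S, i ≠ j → α i ≠ α j := fun i hi j hj hij h =>
    hPQ i hi j hj hij (by simp [h])
  have hG0 := sum_monomial_ne_zero hS hγ hα
  have hGd := totalDegree_sum_monomial_le S γ hd
  set G := ∑ i ∈ S, MvPolynomial.monomial (α i) (γ i) with hG
  have hPd : P.totalDegree ≤ d :=
    (MvPolynomial.totalDegree_le_of_dvd_of_isDomain hPG hG0).trans hGd
  have hB0 : 0 < B := by omega
  have hcard : 1 ≤ S.card := hS.card_pos
  -- the auxiliary polynomials without the variable `j`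
  have hρ : ∀ p ∈ S.offDiag, ∃ ρ : MvPolynomial {i // i ≠ j} K, ρ ≠ 0 ∧
      MvPolynomial.rename Subtype.val ρ ∈ Ideal.span {P, MvPolynomial.monomial (M • α p.1) 1 -
        MvPolynomial.monomial (M • α p.2) 1} ∧ ρ.totalDegree ≤ (d + M * d + 1) ^ 2 := by
    intro p hp
    rw [Finset.mem_offDiag] at hp
    obtain ⟨ρ, h0, h1, h2⟩ := exists_rename_val_mem_span_pair j hP (hPQ _ hp.1 _ hp.2.1 hp.2.2)
    refine ⟨ρ, h0, h1, h2.trans (Nat.pow_le_pow_left ?_ 2)⟩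
    have h3 : ∀ i ∈ S, (MvPolynomial.monomial (M • α i) (1 : K)).totalDegree ≤ M * d := by
      intro i hi
      refine (MvPolynomial.totalDegree_monomial_le _ _).trans ?_
      have h4 := hd i hi
      rw [Finsupp.sum_fintype _ _ (by simp)] at h4 ⊢
      change ∑ l, M * α i l ≤ M * d
      rw [← Finset.mul_sum]
      exact Nat.mul_le_mul_left _ h4
    have h5 := (MvPolynomial.totalDegree_sub (MvPolynomial.monomial (M • α p.1) (1 : K))
      (MvPolynomial.monomial (M • α p.2) 1)).trans (max_le (h3 _ hp.1) (h3 _ hp.2.1))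
    omega
  choose! ρ hρ0 hρmem hρd using hρ
  have hρB : (d + M * d + 1) ^ 2 < B := by
    refine lt_of_le_of_lt ?_ hB
    have : 1 ≤ S.card ^ 3 := Nat.one_le_pow _ _ hcard
    nlinarith [Nat.mul_le_mul_right ((d + M * d + 1) ^ 2) this]
  let spec := fun p : MvPolynomial s K =>
    (MvPolynomial.aeval (fun i => (X : K[X]) ^ m i) p).map (algebraMap K ℂ)
  have hspec0 : ∀ p : MvPolynomial s K, p ≠ 0 → p.totalDegree < B → spec p ≠ 0 := fun p hp hpB =>
    (Polynomial.map_ne_zero_iff (algebraMap K ℂ).injective).2 (aeval_X_pow_ne_zero hm hpB hp)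
  set h := ∏ p ∈ S.offDiag, spec (MvPolynomial.rename Subtype.val (ρ p)) with hh
  have hh0 : h ≠ 0 := Finset.prod_ne_zero_iff.2 fun p hp => hspec0 _
    (fun h0 => hρ0 p hp (MvPolynomial.rename_injective _ Subtype.val_injective (by simpa using h0)))
    (((MvPolynomial.totalDegree_rename_le _ _).trans (hρd p hp)).trans_lt hρB)
  have hhdeg : h.natDegree ≤ S.card ^ 2 * ((d + M * d + 1) ^ 2 * (m j / B)) := by
    refine (natDegree_prod_le _ _).trans ((Finset.sum_le_card_nsmul _ _
      ((d + M * d + 1) ^ 2 * (m j / B)) fun p hp => ?_).trans ?_)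
    · refine natDegree_map_le.trans ?_
      rw [MvPolynomial.aeval_rename]
      refine (natDegree_aeval_X_pow_le (m := fun i : {i // i ≠ j} => m i) (b := m j / B)
        (fun i => (Nat.le_div_iff_mul_le hB0).2 (hmj i i.2)) _).trans
        (Nat.mul_le_mul_right _ (hρd p hp))
    · rw [smul_eq_mul, Finset.offDiag_card]
      refine Nat.mul_le_mul_right _ ?_
      rw [sq]; exact Nat.sub_le _ _
  set f := spec P with hf
  have hf0 : f ≠ 0 := hspec0 P hP.ne_zero (hPd.trans_lt (by omega))
  obtain ⟨f₀, hf₀, hndvd⟩ := exists_eq_pow_rootMultiplicity_mul_and_not_dvd f hf0 0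
  rw [C_0, sub_zero] at hf₀ hndvd
  set t := rootMultiplicity 0 f
  have hf₀0 : f₀ ≠ 0 := fun h0 => hndvd (by simp [h0])
  -- every nonzero root of `f` is a root of `h`
  have hroots : f₀.roots ≤ S.card • h.roots := by
    rw [Multiset.le_iff_count]
    intro ζ
    rw [Multiset.count_nsmul, count_roots, count_roots]
    rcases Nat.eq_zero_or_pos (rootMultiplicity ζ f₀) with h0 | h0
    · rw [h0]; exact Nat.zero_le _
    have hζ := (rootMultiplicity_pos hf₀0).1 h0
    have hζ0 : ζ ≠ 0 := by
      rintro rfl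
      exact hndvd (by simpa using dvd_iff_isRoot.2 hζ)
    have hPζ : MvPolynomial.aeval (fun i => ζ ^ m i) P = 0 := by
      rw [← aeval_map_aeval_X_pow]
      change eval ζ f = 0
      rw [hf₀, eval_mul, hζ.eq_zero, mul_zero]
    have hfin : IsOfFinOrder ζ := by
      by_contra hnt
      exact hcon ζ hζ0 hnt hPζ
    have hGζ : ∑ i ∈ S, algebraMap K ℂ (γ i) * ζ ^ ((∑ l, α i l * m l : ℕ) : ℤ) = 0 := by
      have h1 : MvPolynomial.aeval (fun i => ζ ^ m i) G = 0 := by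
        obtain ⟨q, hq⟩ := hPG
        rw [hq, map_mul, hPζ, zero_mul]
      rw [← aeval_map_aeval_X_pow, hG, map_sum, Polynomial.map_sum, eval_finsetSum] at h1
      rw [← h1]
      refine Finset.sum_congr rfl fun i _ => ?_
      rw [aeval_X_pow_monomial, map_monomial, eval_monomial, zpow_natCast]
    obtain ⟨i, hi, i', hi', hii, hζM⟩ := hM ζ hfin _ hGζ
    have hmem : (i, i') ∈ S.offDiag := Finset.mem_offDiag.2 ⟨hi, hi', hii⟩
    have hhζ : h.IsRoot ζ := by
      rw [IsRoot.def, hh, eval_prod]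
      refine Finset.prod_eq_zero hmem ?_
      rw [aeval_map_aeval_X_pow]
      refine (Ideal.span_le.2 ?_ (hρmem _ hmem) :
        _ ∈ RingHom.ker (MvPolynomial.aeval (R := K) fun i => ζ ^ m i))
      rintro _ (rfl | rfl)
      · exact hPζ
      · rw [SetLike.mem_coe, RingHom.mem_ker, ← aeval_map_aeval_X_pow, map_sub,
          aeval_X_pow_monomial, aeval_X_pow_monomial, Polynomial.map_sub, map_monomial,
          map_monomial, eval_sub, eval_monomial, eval_monomial]
        simp only [Finsupp.smul_apply, smul_eq_mul, map_one, one_mul, mul_assoc,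
          ← Finset.mul_sum]
        rw [zpow_sub₀ hζ0, div_pow, zpow_natCast, zpow_natCast, div_eq_one_iff_eq (by positivity),
          ← pow_mul, ← pow_mul] at hζM
        rw [sub_eq_zero, mul_comm M, mul_comm M, hζM]
    have h1 : rootMultiplicity ζ f₀ < S.card := by
      by_contra! hle
      refine not_pow_card_dvd_sum_monomial hS (c := fun i => algebraMap K ℂ (γ i))
        (n := fun i => ∑ l, α i l * m l) (fun i hi => by simpa using hγ i hi) ?_ hζ0 ?_
      · intro i hi i' hi' hii heq
        refine hm (fun l => (α i l : ℤ) - α i' l) (fun h0 => hα i hi i' hi' hii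
          (Finsupp.ext fun l => ?_)) (fun l => ?_) ?_
        · have := congrFun h0 l
          simp only [Pi.zero_apply] at this
          omega
        · have hle : ∀ i ∈ S, α i l ≤ d := fun i hi => by
            refine le_trans ?_ (hd i hi)
            rw [Finsupp.sum_fintype _ _ (by simp)]
            exact Finset.single_le_sum (f := fun l => α i l) (fun _ _ => Nat.zero_le _)
              (Finset.mem_univ l)
          have h1 := hle i hi
          have h2 := hle i' hi'
          rw [abs_lt]; constructor <;> omega
        · have : ((∑ l, α i l * m l : ℕ) : ℤ) = ((∑ l, α i' l * m l : ℕ) : ℤ) := by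
            exact_mod_cast heq
          push_cast at this
          simp [sub_mul, this]
      · refine ((pow_dvd_pow _ hle).trans ((le_rootMultiplicity_iff hf₀0).1 le_rfl)).trans ?_
        have h2 : f ∣ spec G := by
          obtain ⟨q, hq⟩ := hPG
          rw [hq]
          exact ⟨spec q, by simp [hf, spec]⟩
        refine (Dvd.intro_left _ hf₀.symm).trans (h2.trans (dvd_of_eq ?_))
        simp only [spec, hG, map_sum, Polynomial.map_sum]
        refine Finset.sum_congr rfl fun i _ => ?_
        rw [aeval_X_pow_monomial, map_monomial]
    have h2 : 1 ≤ rootMultiplicity ζ h := (rootMultiplicity_pos hh0).2 hhζ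
    nlinarith
  have hf₀deg : f₀.natDegree ≤ S.card * h.natDegree := by
    have h1 := Multiset.card_le_card hroots
    rw [Multiset.card_nsmul,
      ← (IsAlgClosed.splits f₀).natDegree_eq_card_roots] at h1
    exact h1.trans (Nat.mul_le_mul_left _ (card_roots' h))
  have hcoeff : ∀ β ∈ P.support, f.coeff (∑ i, β i * m i) ≠ 0 := by
    intro β hβ
    rw [hf, coeff_map, coeff_aeval_X_pow hm (hPd.trans_lt (by omega))]
    · simpa using hβ
    · exact fun i => ((MvPolynomial.monomial_le_degreeOf i hβ).trans
        ((MvPolynomial.degreeOf_le_totalDegree _ _).trans hPd)).trans_lt (by omega)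
  obtain ⟨β, hβ, hβj⟩ : ∃ β ∈ P.support, β j ≠ 0 := by
    by_contra! h0
    refine hj ?_
    rw [MvPolynomial.degreeOf_eq_sup, ← Nat.le_zero]
    exact Finset.sup_le fun β hβ => (h0 β hβ).le
  obtain ⟨δ, hδ, hδj⟩ : ∃ δ ∈ P.support, δ j = 0 := by
    by_contra! h0
    refine hXj ?_
    rw [P.as_sum]
    exact Finset.dvd_sum fun β hβ => MvPolynomial.X_dvd_monomial.2 (Or.inr (h0 β hβ))
  have h1 : m j ≤ f.natDegree := by
    refine le_trans ?_ (le_natDegree_of_ne_zero (hcoeff β hβ))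
    refine le_trans ?_ (Finset.single_le_sum (f := fun i => β i * m i) (fun _ _ => Nat.zero_le _)
      (Finset.mem_univ j))
    exact Nat.le_mul_of_pos_left _ (Nat.pos_of_ne_zero hβj)
  have h2 : t ≤ ∑ i, δ i * m i := by
    by_contra! hlt
    exact hcoeff δ hδ (X_pow_dvd_iff.1 ⟨f₀, hf₀⟩ _ hlt)
  have h3 : ∑ i, δ i * m i ≤ d * (m j / B) := by
    calc ∑ i, δ i * m i ≤ ∑ i, δ i * (m j / B) := Finset.sum_le_sum fun i _ => by
          by_cases hij : i = j
          · simp [hij, hδj]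
          · exact Nat.mul_le_mul_left _ ((Nat.le_div_iff_mul_le hB0).2 (hmj i hij))
      _ = (δ.sum fun _ e => e) * (m j / B) := by
          rw [← Finset.sum_mul, Finsupp.sum_fintype _ _ (by simp)]
      _ ≤ _ := Nat.mul_le_mul_right _ ((MvPolynomial.le_totalDegree hδ).trans hPd)
  have h4 : f.natDegree = t + f₀.natDegree := by
    conv_lhs => rw [hf₀]
    rw [natDegree_mul (pow_ne_zero _ X_ne_zero) hf₀0, natDegree_X_pow]
  have h5 : m j ≤ (d + S.card ^ 3 * (d + M * d + 1) ^ 2) * (m j / B) := by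
    calc m j ≤ d * (m j / B) + S.card * (S.card ^ 2 * ((d + M * d + 1) ^ 2 * (m j / B))) := by
          have := Nat.mul_le_mul_left S.card hhdeg
          omega
      _ = _ := by ring
  have h6 := Nat.div_mul_le_self (m j) B
  have h7 : 0 < m j / B := Nat.pos_of_ne_zero fun h0 => by rw [h0] at h5; omega
  nlinarith [Nat.mul_lt_mul_of_pos_right hB h7]

end

section

/-- The maximum of the absolute values of the coordinates of an integer vector. -/
def supNatAbs {ι : Type*} [Fintype ι] (a : ι → ℤ) : ℕ := Finset.univ.sup fun i => (a i).natAbs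

variable {ι : Type*} [Fintype ι]

theorem natAbs_le_supNatAbs (a : ι → ℤ) (i : ι) : (a i).natAbs ≤ supNatAbs a :=
  Finset.le_sup (f := fun i => (a i).natAbs) (Finset.mem_univ i)

theorem abs_le_supNatAbs (a : ι → ℤ) (i : ι) : |a i| ≤ supNatAbs a := by
  rw [Int.abs_eq_natAbs]
  exact_mod_cast natAbs_le_supNatAbs a i

theorem supNatAbs_le {a : ι → ℤ} {b : ℕ} (h : ∀ i, |a i| ≤ b) : supNatAbs a ≤ b :=
  Finset.sup_le fun i _ => by
    have := h i
    rw [Int.abs_eq_natAbs] at this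
    exact_mod_cast this

theorem exists_abs_eq_supNatAbs {a : ι → ℤ} (h : 0 < supNatAbs a) : ∃ i, |a i| = supNatAbs a := by
  have hne : (Finset.univ : Finset ι).Nonempty := by
    by_contra h0
    rw [Finset.not_nonempty_iff_eq_empty] at h0
    simp [supNatAbs, h0] at h
  obtain ⟨i, -, hi⟩ := Finset.exists_mem_eq_sup _ hne fun i => (a i).natAbs
  refine ⟨i, ?_⟩
  rw [Int.abs_eq_natAbs]
  exact_mod_cast hi.symm

omit [Fintype ι] in
theorem exists_simultaneous_approximation (a : ι → ℤ) {J : Finset ι} (ha : ∀ i ∉ J, a i = 0)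
    {E Q : ℕ} (hE : 0 < E) (hQ : 0 < Q) :
    ∃ (s : ℕ) (c : ι → ℤ), 1 ≤ s ∧ s ≤ Q ^ J.card ∧ (∀ i ∉ J, c i = 0) ∧
      (∀ i, Q * |E * c i - s * a i| < E) ∧ ∀ i, |a i| = E → |c i| = s := by
  classical
  have hE' : (0 : ℤ) < E := by exact_mod_cast hE
  have hQ' : (0 : ℤ) < Q := by exact_mod_cast hQ
  have hmod : ∀ x : ℤ, 0 ≤ x % E ∧ x % E < E := fun x =>
    ⟨Int.emod_nonneg _ hE'.ne', Int.emod_lt_of_pos _ hE'⟩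
  have hcell : ∀ x : ℤ, 0 ≤ Q * (x % E) / E ∧ Q * (x % E) / E < Q := fun x => by
    have := hmod x
    refine ⟨Int.ediv_nonneg (by nlinarith) hE'.le, Int.ediv_lt_of_lt_mul hE' (by nlinarith)⟩
  let F : Fin (Q ^ J.card + 1) → J → Fin Q := fun l i =>
    ⟨(Q * ((l : ℤ) * a i % E) / E).toNat, by have := hcell ((l : ℤ) * a i); omega⟩
  obtain ⟨l₁, l₂, hne, heq⟩ := Fintype.exists_ne_map_eq_of_card_lt F (by simp)
  wlog hlt : l₁ < l₂ generalizing l₁ l₂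
  · exact this l₂ l₁ hne.symm heq.symm (lt_of_le_of_ne (not_lt.1 hlt) hne.symm)
  have hlt' : (l₁ : ℕ) < l₂ := hlt
  refine ⟨l₂ - l₁, fun i => (l₂ : ℤ) * a i / E - (l₁ : ℤ) * a i / E, by omega, by omega,
    fun i hi => by simp [ha i hi], fun i => ?_, fun i hi => ?_⟩
  · by_cases hi : i ∈ J
    · have h1 : Q * ((l₁ : ℤ) * a i % E) / E = Q * ((l₂ : ℤ) * a i % E) / E := by
        have := congrArg Fin.val (congrFun heq ⟨i, hi⟩)
        have h1 := hcell ((l₁ : ℤ) * a i)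
        have h2 := hcell ((l₂ : ℤ) * a i)
        simp only [F] at this
        omega
      have h2 := Int.mul_ediv_add_emod ((l₁ : ℤ) * a i) E
      have h3 := Int.mul_ediv_add_emod ((l₂ : ℤ) * a i) E
      have h4 : (E : ℤ) * ((l₂ : ℤ) * a i / E - (l₁ : ℤ) * a i / E) - ((l₂ - l₁ : ℕ) : ℤ) * a i =
          (l₁ : ℤ) * a i % E - (l₂ : ℤ) * a i % E := by
        push_cast [hlt'.le]
        linear_combination h3 - h2
      rw [h4, ← Nat.abs_cast Q, ← abs_mul, mul_sub, abs_lt]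
      have h5 := Int.mul_ediv_add_emod (Q * ((l₁ : ℤ) * a i % E)) E
      have h6 := Int.mul_ediv_add_emod (Q * ((l₂ : ℤ) * a i % E)) E
      have h7 := hmod (Q * ((l₁ : ℤ) * a i % E))
      have h8 := hmod (Q * ((l₂ : ℤ) * a i % E))
      rw [h1] at h5
      constructor <;> linarith
    · simpa [ha i hi] using hE
  · dsimp only
    rcases abs_choice (a i) with h | h
    · rw [hi] at h
      rw [← h, Int.mul_ediv_cancel _ hE'.ne', Int.mul_ediv_cancel _ hE'.ne', abs_of_pos] <;> omega
    · have h' : a i = -E := by omega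
      rw [h', mul_neg, mul_neg, ← neg_mul, ← neg_mul, Int.mul_ediv_cancel _ hE'.ne',
        Int.mul_ediv_cancel _ hE'.ne', abs_of_neg] <;> omega

theorem linearIndependent_update {V : Type*} [AddCommGroup V] [Module ℂ V] {κ : Type*} [Fintype κ]
    [DecidableEq κ] {e : κ → V} (he : LinearIndependent ℂ e) {μ : κ → ℂ} {j : κ} (hμ : μ j ≠ 0) :
    LinearIndependent ℂ (Function.update e j (∑ l, μ l • e l)) ∧
      Submodule.span ℂ (Set.range e) ≤
        Submodule.span ℂ (Set.range (Function.update e j (∑ l, μ l • e l))) := by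
  set f := ∑ l, μ l • e l with hf
  have hmem : ∀ l, Function.update e j f l ∈ Submodule.span ℂ (Set.range (Function.update e j f)) :=
    fun l => Submodule.subset_span ⟨l, rfl⟩
  have hle : Submodule.span ℂ (Set.range e) ≤
      Submodule.span ℂ (Set.range (Function.update e j f)) := by
    rw [Submodule.span_le]
    rintro _ ⟨l, rfl⟩
    by_cases hl : l = j
    · subst hl
      have h1 : e l = (μ l)⁻¹ • (f - ∑ i ∈ Finset.univ.erase l, μ i • e i) := by
        rw [hf, ← Finset.add_sum_erase _ _ (Finset.mem_univ l), add_sub_cancel_right, smul_smul,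
          inv_mul_cancel₀ hμ, one_smul]
      rw [h1]
      refine Submodule.smul_mem _ _ (Submodule.sub_mem _ ?_ (Submodule.sum_mem _ fun i hi =>
        Submodule.smul_mem _ _ ?_))
      · simpa using hmem l
      · simpa [Finset.ne_of_mem_erase hi] using hmem i
    · simpa [hl] using hmem l
  refine ⟨?_, hle⟩
  have : FiniteDimensional ℂ (Submodule.span ℂ (Set.range (Function.update e j f))) :=
    FiniteDimensional.span_of_finite _ (Set.finite_range _)
  rw [linearIndependent_iff_card_le_finrank_span]
  rw [linearIndependent_iff_card_eq_finrank_span] at he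
  rw [he]
  exact Submodule.finrank_mono hle

/-- Short vectors in the sense of Dirichlet's theorem lie outside the span of a minimal family. -/
theorem exists_approximation_notMem_span {J : Finset ι} {κ : Type*} [Fintype κ] {e : κ → ι → ℤ}
    (heJ : ∀ j, ∀ i ∉ J, e j i = 0)
    (he : LinearIndependent ℂ fun j i => (e j i : ℂ))
    (hmin : ∀ e' : κ → ι → ℤ, (∀ j, ∀ i ∉ J, e' j i = 0) →
      LinearIndependent ℂ (fun j i => (e' j i : ℂ)) →
      Submodule.span ℂ (Set.range fun j i => (e j i : ℂ)) ≤
        Submodule.span ℂ (Set.range fun j i => (e' j i : ℂ)) →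
      ∑ j, supNatAbs (e j) ≤ ∑ j, supNatAbs (e' j))
    (j : κ) {Q : ℕ} (hQ : 2 ≤ Q) (hJ : 1 ≤ J.card) (hE : 2 * Q ^ (3 * J.card) ≤ supNatAbs (e j)) :
    ∃ (s : ℕ) (c : ι → ℤ), 1 ≤ s ∧ s ≤ Q ^ J.card ∧ (∀ i ∉ J, c i = 0) ∧
      (∀ i, Q * |supNatAbs (e j) * c i - s * e j i| < supNatAbs (e j)) ∧ supNatAbs c = s ∧
      (fun i => (c i : ℂ)) ∉ Submodule.span ℂ (Set.range fun j i => (e j i : ℂ)) := by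
  classical
  set E := supNatAbs (e j) with hEdef
  have hQn : Q ≤ Q ^ J.card := Nat.le_self_pow (by omega) Q
  have hE2 : 2 * (Q ^ J.card) ^ 3 ≤ E := by rwa [← pow_mul, mul_comm J.card]
  have hE0 : 0 < E := lt_of_lt_of_le (by positivity) hE2
  obtain ⟨s, c, hs1, hsQ, hcJ, hc, hcs⟩ :=
    exists_simultaneous_approximation (e j) (heJ j) hE0 (by omega : 0 < Q)
  have hE8 : 8 * s ≤ E := by nlinarith [Nat.mul_le_mul (hQ.trans hQn) (hQ.trans hQn)]
  have hE' : (0 : ℤ) < E := by exact_mod_cast hE0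
  have hcle : ∀ i, |c i| ≤ s := fun i => by
    have h1 := hc i
    have h2 := abs_le_supNatAbs (e j) i
    rw [← hEdef] at h2
    have h3 : |E * c i| ≤ |E * c i - s * e j i| + |s * e j i| := by
      simpa using abs_add_le (E * c i - s * e j i) (s * e j i)
    rw [abs_mul, abs_mul, Nat.abs_cast, Nat.abs_cast] at h3
    have h4 : |E * c i - s * e j i| < E := by
      have : (1 : ℤ) ≤ Q := by omega
      nlinarith [abs_nonneg (E * c i - s * e j i)]
    have h5 : (s : ℤ) * |e j i| ≤ s * E := mul_le_mul_of_nonneg_left h2 (by positivity)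
    by_contra! h6
    have h7 : (s : ℤ) + 1 ≤ |c i| := h6
    nlinarith
  have hsc : supNatAbs c = s := by
    refine le_antisymm (supNatAbs_le hcle) ?_
    obtain ⟨i, hi⟩ := exists_abs_eq_supNatAbs (a := e j) (by omega)
    have := abs_le_supNatAbs c i
    rw [hcs i hi] at this
    exact_mod_cast this
  refine ⟨s, c, hs1, hsQ, hcJ, hc, hsc, fun hmem => ?_⟩
  -- a vector shorter than `e j` cannot replace it
  have key : ∀ (f : ι → ℤ) (μ : κ → ℂ), (∀ i ∉ J, f i = 0) → μ j ≠ 0 →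
      (fun i => (f i : ℂ)) = ∑ l, μ l • (fun i => (e l i : ℂ)) → E ≤ supNatAbs f := by
    intro f μ hfJ hμ hf
    have h0 : (fun l i => ((Function.update e j f l i : ℤ) : ℂ)) =
        Function.update (fun l i => (e l i : ℂ)) j (∑ l, μ l • (fun i => (e l i : ℂ))) := by
      rw [← hf]
      funext l
      by_cases hl : l = j
      · subst hl; simp
      · simp [hl]
    obtain ⟨h1, h2⟩ := linearIndependent_update he hμ
    have h3 := hmin (Function.update e j f) (fun l i hi => by
      by_cases hl : l = j
      · subst hl; simpa using hfJ i hi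
      · simpa [hl] using heJ l i hi) (by rw [h0]; exact h1) (by rw [h0]; exact h2)
    rw [← Finset.add_sum_erase _ _ (Finset.mem_univ j),
      ← Finset.add_sum_erase (a := j) _ (fun l => supNatAbs (Function.update e j f l))
        (Finset.mem_univ j)] at h3
    have h4 : ∑ l ∈ Finset.univ.erase j, supNatAbs (Function.update e j f l) =
        ∑ l ∈ Finset.univ.erase j, supNatAbs (e l) :=
      Finset.sum_congr rfl fun l hl => by simp [Finset.ne_of_mem_erase hl]
    rw [h4] at h3
    simpa [← hEdef] using h3
  obtain ⟨μ, hμ⟩ := Submodule.mem_span_range_iff_exists_fun ℂ |>.1 hmem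
  by_cases h0 : μ j = 0
  · set q := E / s with hq
    have hqs : (E : ℤ) = s * q + (E % s : ℕ) := by exact_mod_cast (Nat.div_add_mod E s).symm
    have hr : (E % s : ℕ) < s := Nat.mod_lt _ (by omega)
    have h1 := key (fun i => e j i - q * c i) (fun l => (if l = j then 1 else 0) - q * μ l)
      (fun i hi => by simp [heJ j i hi, hcJ i hi]) (by simp [h0]) (by
        simp only [sub_smul, Finset.sum_sub_distrib, mul_smul, ← Finset.smul_sum, hμ]
        funext i
        simp)
    have h2 : supNatAbs (fun i => e j i - q * c i) ≤ E - 1 := by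
      refine supNatAbs_le fun i => ?_
      have h3 := hc i
      have h4 : s * (e j i - q * c i) = -(E * c i - s * e j i) + (E % s : ℕ) * c i := by
        linear_combination c i * hqs
      have h5 : |(s : ℤ) * (e j i - q * c i)| ≤ |E * c i - s * e j i| + |((E % s : ℕ) : ℤ) * c i| := by
        rw [h4]
        refine (abs_add_le _ _).trans ?_
        rw [abs_neg]
      rw [abs_mul, abs_mul, Nat.abs_cast, Nat.abs_cast] at h5
      have h6 : ((E % s : ℕ) : ℤ) * |c i| ≤ s * s := by
        have := hcle i
        have h7 : ((E % s : ℕ) : ℤ) ≤ s := by exact_mod_cast hr.le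
        exact mul_le_mul h7 this (abs_nonneg _) (by positivity)
      have h7 : 2 * |E * c i - s * e j i| < E := by
        have : (2 : ℤ) ≤ Q := by exact_mod_cast hQ
        nlinarith [abs_nonneg (E * c i - s * e j i)]
      have h8 : (8 : ℤ) * s ≤ E := by exact_mod_cast hE8
      have h9 : (1 : ℤ) ≤ s := by exact_mod_cast hs1
      have h10 : ((E - 1 : ℕ) : ℤ) = E - 1 := by omega
      rw [h10]
      by_contra! h11
      have h12 : (E : ℤ) ≤ |e j i - q * c i| := by omega
      nlinarith
    omega
  · have := key c μ hcJ h0 hμ.symm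
    omega

end

section
variable {ι : Type}

/-- A family `W` of integer weights on `ι` giving linear relations compatible with the partition
`r`: every weight is supported in one class, all class indicators occur, and no coordinate is
nonzero on all nonzero weights. -/
structure IsRelationFamily (r : Setoid ι) (W : Set (ι → ℤ)) : Prop where
  rel_of_ne_zero : ∀ w ∈ W, ∀ i j, w i ≠ 0 → w j ≠ 0 → r i j
  indicator_mem : ∀ i, Set.indicator {j | r i j} 1 ∈ W
  exists_apply_eq_zero : ∀ i, ∃ w ∈ W, w ≠ 0 ∧ w i = 0

theorem isRelationFamily_range_indicator {r : Setoid ι} (hr : r ≠ ⊤) :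
    IsRelationFamily r (Set.range fun i => Set.indicator {j | r i j} 1) where
  rel_of_ne_zero := by
    rintro _ ⟨l, rfl⟩ i j hi hj
    exact r.trans (r.symm (Set.mem_of_indicator_ne_zero hi)) (Set.mem_of_indicator_ne_zero hj)
  indicator_mem i := ⟨i, rfl⟩
  exists_apply_eq_zero i := by
    obtain ⟨j, hj⟩ : ∃ j, ¬ r i j := by
      by_contra! h
      exact hr (Setoid.eq_top_iff.2 fun x y => r.trans (r.symm (h x)) (h y))
    refine ⟨_, ⟨j, rfl⟩, fun h => ?_, Set.indicator_of_notMem (fun h => hj (r.symm h)) _⟩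
    have := congrFun h j
    dsimp only at this
    rw [Set.indicator_of_mem (show j ∈ {l | r j l} from r.refl j)] at this
    exact one_ne_zero this

variable [Fintype ι]

/-- The weighted sums of `γ i * x i` vanish for a family of weights compatible with `r`. -/
def IsRelated (γ : ι → ℂ) (r : Setoid ι) (x : ι → ℂ) : Prop :=
  ∃ W, IsRelationFamily r W ∧ ∀ w ∈ W, ∑ i, (w i : ℂ) * γ i * x i = 0

theorem IsRelated.mul {γ : ι → ℂ} {r : Setoid ι} {x : ι → ℂ} (h : IsRelated γ r x) {c : ι → ℂ}
    (hc : ∀ i j, r i j → c i = c j) : IsRelated γ r fun i => c i * x i := by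
  obtain ⟨W, hW, h⟩ := h
  refine ⟨W, hW, fun w hw => ?_⟩
  by_cases h0 : ∃ i, w i ≠ 0
  · obtain ⟨i, hi⟩ := h0
    rw [← mul_zero (c i), ← h w hw, Finset.mul_sum]
    refine Finset.sum_congr rfl fun j _ => ?_
    by_cases hj : w j = 0
    · simp [hj]
    · rw [hc i j (hW.rel_of_ne_zero w hw i j hi hj)]
      ring
  · push Not at h0
    simp [h0]

open Classical in
theorem IsRelated.sum_class {γ : ι → ℂ} {r : Setoid ι} {x : ι → ℂ} (h : IsRelated γ r x) (i : ι) :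
    ∑ j with r i j, γ j * x j = 0 := by
  obtain ⟨W, hW, h⟩ := h
  rw [← h _ (hW.indicator_mem i), Finset.sum_filter]
  refine Finset.sum_congr rfl fun j _ => ?_
  by_cases hj : r i j
  · rw [if_pos hj, Set.indicator_of_mem (show j ∈ {j | r i j} from hj)]; simp
  · rw [if_neg hj, Set.indicator_of_notMem (show j ∉ {j | r i j} from hj)]; simp

open Classical in
theorem isRelated_of_sum_class {γ : ι → ℂ} {r : Setoid ι} (hr : r ≠ ⊤) {x : ι → ℂ}
    (h : ∀ i, ∑ j with r i j, γ j * x j = 0) : IsRelated γ r x := by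
  refine ⟨_, isRelationFamily_range_indicator hr, ?_⟩
  rintro _ ⟨i, rfl⟩
  rw [← h i, Finset.sum_filter]
  refine Finset.sum_congr rfl fun j _ => ?_
  dsimp only
  by_cases hj : r i j
  · rw [if_pos hj, Set.indicator_of_mem (show j ∈ {j | r i j} from hj)]; simp
  · rw [if_neg hj, Set.indicator_of_notMem (show j ∉ {j | r i j} from hj)]; simp

/-- The chosen representative of the class of `i`. -/
noncomputable def Setoid.rep (r : Setoid ι) (i : ι) : ι := (Quotient.mk r i).out

omit [Fintype ι] in
theorem Setoid.rep_rel (r : Setoid ι) (i : ι) : r (r.rep i) i := Quotient.mk_out (s := r) i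

omit [Fintype ι] in
theorem Setoid.rep_eq {r : Setoid ι} {i j : ι} (h : r i j) : r.rep i = r.rep j := by
  rw [Setoid.rep, Setoid.rep, Quotient.sound (s := r) h]

open Classical in
/-- The indices which are not the chosen representative of their class. -/
noncomputable def Setoid.nonrep (r : Setoid ι) : Finset ι := {i | r.rep i ≠ i}

theorem Setoid.rep_notMem_nonrep (r : Setoid ι) (i : ι) : r.rep i ∉ r.nonrep := by
  simp [Setoid.nonrep, Setoid.rep_eq (r.rep_rel i)]

theorem Setoid.rep_eq_self {r : Setoid ι} {i : ι} (hi : i ∉ r.nonrep) : r.rep i = i := by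
  simpa [Setoid.nonrep] using hi

theorem exists_gap {a : ι → ℤ} {i₁ : ι} {k : ℕ} :
    ∃ l < Fintype.card ι, ∀ i, a i ≤ a i₁ + l * k ∨ a i₁ + l * k + k ≤ a i := by
  by_contra! h
  have h' : ∀ l : Fin (Fintype.card ι), ∃ i, a i₁ + (l : ℕ) * k < a i ∧
      a i < a i₁ + (l : ℕ) * k + k := fun l => h l l.2
  choose f hf₁ hf₂ using h'
  have hinj : Function.Injective f := by
    have key : ∀ l l', f l = f l' → ¬ l < l' := fun l l' hll hlt => by
      have h1 := hf₂ l
      have h2 := hf₁ l'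
      rw [hll] at h1
      have h3 : ((l : ℕ) + 1 : ℤ) ≤ (l' : ℕ) := by exact_mod_cast hlt
      nlinarith
    intro l l' hll
    exact le_antisymm (not_lt.1 (key _ _ hll.symm)) (not_lt.1 (key _ _ hll))
  obtain ⟨l, hl⟩ := ((Fintype.bijective_iff_injective_and_card f).2 ⟨hinj, by simp⟩).2 i₁
  have := hf₁ l
  rw [hl] at this
  nlinarith [mul_nonneg (Int.natCast_nonneg (l : ℕ)) (Int.natCast_nonneg k)]

theorem exists_supNatAbs_le (K : IntermediateField ℚ ℂ) [FiniteDimensional ℚ K] (γ : ι → K)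
    (r : Setoid ι) {ε : ℝ} (hε : 0 < ε) : ∃ C : ℝ, 0 < C ∧ ∀ (a : ι → ℤ) (τ : ℂ),
      (∀ i ∉ r.nonrep, a i = 0) → IsAlgebraic ℚ τ → τ ≠ 0 → ¬ IsOfFinOrder τ →
      IsRelated (fun i => (γ i : ℂ)) r (fun i => τ ^ a i) →
      (∀ r' < r, ¬ IsRelated (fun i => (γ i : ℂ)) r' (fun i => τ ^ a i)) →
      (supNatAbs a : ℝ) ≤ C * ((minpoly K τ).natDegree : ℝ) ^ (1 + ε) := by
  classical
  obtain ⟨C, hC, hgap⟩ := exists_gap_le K γ hε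
  refine ⟨Fintype.card ι * (C + 1) + 1, by positivity, fun a τ ha hτ hτ0 hnt hrel hmin => ?_⟩
  have hD : (1 : ℝ) ≤ ((minpoly K τ).natDegree : ℝ) ^ (1 + ε) := by
    refine Real.one_le_rpow ?_ (by positivity)
    have : 0 < (minpoly K τ).natDegree := minpoly.natDegree_pos (hτ.tower_top K).isIntegral
    exact_mod_cast this
  set V := supNatAbs a with hV
  rcases Nat.eq_zero_or_pos V with hV0 | hV0
  · rw [hV0]; simp only [Nat.cast_zero]; positivity
  obtain ⟨i, hi⟩ := exists_abs_eq_supNatAbs hV0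
  obtain ⟨i₁, i₂, h12, haV⟩ : ∃ i₁ i₂, r i₁ i₂ ∧ a i₂ = a i₁ + V := by
    have h0 := ha _ (r.rep_notMem_nonrep i)
    rw [← hV] at hi
    rcases abs_choice (a i) with h | h
    · exact ⟨r.rep i, i, r.rep_rel i, by omega⟩
    · exact ⟨i, r.rep i, r.symm (r.rep_rel i), by omega⟩
  have hcard : 0 < Fintype.card ι := Fintype.card_pos_iff.2 ⟨i⟩
  set k := V / Fintype.card ι with hk
  have hVk : V ≤ Fintype.card ι * (k + 1) := (Nat.lt_mul_div_succ V hcard).le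
  suffices hkD : (k : ℝ) ≤ C * ((minpoly K τ).natDegree : ℝ) ^ (1 + ε) by
    have h1 : (V : ℝ) ≤ Fintype.card ι * (k + 1) := by exact_mod_cast hVk
    have h2 : (0 : ℝ) < Fintype.card ι := by exact_mod_cast hcard
    nlinarith
  rcases Nat.eq_zero_or_pos k with hk0 | hk0
  · rw [hk0]; simp only [Nat.cast_zero]; positivity
  obtain ⟨l, hl, hgapl⟩ := exists_gap (a := a) (i₁ := i₁) (k := k)
  set m := a i₁ + l * k with hm
  have hlk : ((l : ℤ) + 1) * k ≤ V := by
    have : (l + 1) * k ≤ V := (Nat.mul_le_mul_right k hl).trans (Nat.mul_div_le V _)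
    exact_mod_cast this
  have hi₁m : a i₁ ≤ m := by nlinarith [Int.natCast_nonneg (l : ℕ), Int.natCast_nonneg k]
  have hi₂m : ¬ a i₂ ≤ m := by
    have : (1 : ℤ) ≤ k := by exact_mod_cast hk0
    nlinarith
  have hsplit : (∑ i with r i₁ i ∧ a i ≤ m, (γ i : ℂ) * τ ^ a i) +
      ∑ i with r i₁ i ∧ ¬ a i ≤ m, (γ i : ℂ) * τ ^ a i = 0 := by
    rw [← hrel.sum_class i₁, ← Finset.filter_filter, ← Finset.filter_filter,
      Finset.sum_filter_add_sum_filter_not]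
  by_cases h0 : ∑ i with r i₁ i ∧ a i ≤ m, (γ i : ℂ) * τ ^ a i = 0
  · refine (hmin (r ⊓ Setoid.ker fun i => (r i₁ i ∧ a i ≤ m : Prop)) ?_ ?_).elim
    · refine lt_of_le_of_ne inf_le_left fun h => ?_
      have h3 := h ▸ h12
      have h4 : (r i₁ i₁ ∧ a i₁ ≤ m) = (r i₁ i₂ ∧ a i₂ ≤ m) := h3.2
      exact hi₂m (h4 ▸ (⟨r.refl i₁, hi₁m⟩ : r i₁ i₁ ∧ a i₁ ≤ m)).2
    · refine isRelated_of_sum_class (fun h => ?_) fun i => ?_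
      · have h3 : (r ⊓ Setoid.ker fun i => (r i₁ i ∧ a i ≤ m : Prop)) i₁ i₂ := h ▸ trivial
        have h4 : (r i₁ i₁ ∧ a i₁ ≤ m) = (r i₁ i₂ ∧ a i₂ ≤ m) := h3.2
        exact hi₂m (h4 ▸ (⟨r.refl i₁, hi₁m⟩ : r i₁ i₁ ∧ a i₁ ≤ m)).2
      · have hdef : ∀ j, (r ⊓ Setoid.ker fun i => (r i₁ i ∧ a i ≤ m : Prop)) i j ↔
            r i j ∧ ((r i₁ i ∧ a i ≤ m) ↔ (r i₁ j ∧ a j ≤ m)) := fun j => by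
          rw [← eq_iff_iff (a := r i₁ i ∧ a i ≤ m)]; rfl
        simp only [hdef]
        by_cases hi : r i₁ i
        · have hij : ∀ j, r i j ↔ r i₁ j := fun j => ⟨r.trans hi, r.trans (r.symm hi)⟩
          by_cases him : a i ≤ m
          · rw [← h0]
            refine Finset.sum_congr (Finset.filter_congr fun j _ => ?_) fun _ _ => rfl
            rw [hij]; tauto
          · rw [h0, zero_add] at hsplit
            rw [← hsplit]
            refine Finset.sum_congr (Finset.filter_congr fun j _ => ?_) fun _ _ => rfl
            rw [hij]; tauto
        · rw [← hrel.sum_class i]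
          refine Finset.sum_congr (Finset.filter_congr fun j _ => ?_) fun _ _ => rfl
          have : r i j → ¬ r i₁ j := fun h h' => hi (r.trans h' (r.symm h))
          tauto
  · refine hgap τ hτ hτ0 (fun n hn h => hnt (isOfFinOrder_iff_pow_eq_one.2 ⟨n, hn, h⟩)) k m
      _ _ a ?_ ?_ hsplit h0
    · simp
    · intro i hi
      have hi' := (Finset.mem_filter.1 hi).2.2
      exact (hgapl i).resolve_left hi'

end

section
open Polynomial Bivariate

theorem coeff_coeff_swap {K : Type*} [CommRing K] (p : K[X][Y]) (i j : ℕ) :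
    ((Bivariate.swap p).coeff i).coeff j = (p.coeff j).coeff i := by
  induction p using Polynomial.induction_on' with
  | add p q hp hq => simp only [map_add, coeff_add, hp, hq]
  | monomial n f =>
    induction f using Polynomial.induction_on' with
    | add f g hf hg => simp only [map_add, coeff_add, hf, hg]
    | monomial k c =>
      rw [Bivariate.swap_monomial_monomial]
      simp only [coeff_monomial]
      split_ifs <;> simp_all [coeff_monomial]

theorem natDegree_coeff_le_of_dvd {K : Type*} [Field K] {f g : K[X][Y]} (hfg : f ∣ g) (hg : g ≠ 0)
    {d : ℕ} (hd : ∀ i, (g.coeff i).natDegree ≤ d) (i : ℕ) : (f.coeff i).natDegree ≤ d := by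
  have h1 : (Bivariate.swap g).natDegree ≤ d := by
    refine natDegree_le_iff_coeff_eq_zero.2 fun n hn => ?_
    ext j
    rw [coeff_coeff_swap, coeff_zero]
    exact coeff_eq_zero_of_natDegree_lt ((hd j).trans_lt hn)
  have h2 : (Bivariate.swap f).natDegree ≤ d :=
    (natDegree_le_of_dvd (_root_.map_dvd Bivariate.swap hfg)
      ((map_ne_zero_iff _ Bivariate.swap.injective).2 hg)).trans h1
  refine natDegree_le_iff_coeff_eq_zero.2 fun n hn => ?_
  rw [← coeff_coeff_swap, coeff_eq_zero_of_natDegree_lt (h2.trans_lt hn), coeff_zero]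

variable {K : Type*} [Field K] {s : Type*}

/-- The substitution `u_j ↦ t ^ m j`, `v ↦ t ^ q * v`. -/
noncomputable def substBivariate (K : Type*) [Field K] (m : s → ℕ) (q : ℕ) :
    MvPolynomial (Option s) K →ₐ[K] K[X][Y] :=
  MvPolynomial.aeval fun o => o.elim (C (X ^ q) * X) fun j => C (X ^ m j)

theorem substBivariate_rename (m : s → ℕ) (q : ℕ) (ρ : MvPolynomial s K) :
    substBivariate K m q (MvPolynomial.rename some ρ) =
      C (MvPolynomial.aeval (fun j => (X : K[X]) ^ m j) ρ) := by
  rw [substBivariate, MvPolynomial.aeval_rename]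
  induction ρ using MvPolynomial.induction_on with
  | C a => simp
  | add p q hp hq => simp only [map_add, hp, hq]
  | mul_X p i hp => simp only [map_mul, hp]; simp

theorem substBivariate_monomial [Fintype s] (m : s → ℕ) (q : ℕ) (α : Option s →₀ ℕ) (c : K) :
    substBivariate K m q (MvPolynomial.monomial α c) =
      monomial (α none) (monomial (∑ j, α (some j) * m j + α none * q) c) := by
  rw [substBivariate, MvPolynomial.aeval_monomial, Finsupp.prod_fintype _ _ (by simp),
    Fintype.prod_option]
  simp only [Option.elim_none, Option.elim_some, mul_pow, ← C_pow, ← pow_mul]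
  rw [← map_prod, Finset.prod_pow_eq_pow_sum, ← C_mul_X_pow_eq_monomial, ← C_mul_X_pow_eq_monomial,
    pow_add, C_mul, C_mul]
  simp only [mul_comm (m _), mul_comm q]
  have : algebraMap K K[X][Y] c = C (C c) := rfl
  rw [this]
  ring

variable [Algebra K ℂ]

theorem aevalAeval_substBivariate (m : s → ℕ) (q : ℕ) {τ : ℂ} (hτ : τ ≠ 0)
    (p : MvPolynomial (Option s) K) :
    aevalAeval τ (τ ^ q)⁻¹ (substBivariate K m q p) =
      MvPolynomial.aeval (fun o : Option s => o.elim 1 fun j => τ ^ m j) p := by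
  rw [← AlgHom.comp_apply]
  congr 1
  ext o
  cases o with
  | none => simp [substBivariate, inv_mul_cancel₀ (pow_ne_zero q hτ)]
  | some j => simp [substBivariate]

theorem natDegree_minpoly_le [Fintype s] {ι : Type*} [Fintype ι] {S : Finset ι} (hS : S.Nonempty)
    {γ δ : ι → K} (hγ : ∀ i ∈ S, γ i ≠ 0) {α : ι → Option s →₀ ℕ} {e : s → ι → ℤ} {c : ι → ℤ}
    {n : s → ℕ} {nc nb q d : ℕ} (hα : ∀ i j, (α i (some j) : ℤ) = e j i + n j)
    (hα' : ∀ i, (α i none : ℤ) = nc - c i) (hc : ∀ i, |c i| ≤ nc)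
    (hd : ∀ i, ((α i).sum fun _ e => e) ≤ d)
    {m : s → ℕ} (hb : ∀ i, |∑ j, m j * e j i - q * c i| ≤ nb)
    (ha : ∀ i ∈ S, ∀ i' ∈ S, i ≠ i' → ∑ j, (m j : ℤ) * e j i ≠ ∑ j, m j * e j i')
    {R : MvPolynomial (Option s) K} (hR : Irreducible R)
    (hRG : R ∣ ∑ i ∈ S, MvPolynomial.monomial (α i) (γ i))
    (hRS : ¬ R ∣ ∑ i, MvPolynomial.monomial (α i) (δ i)) {B : ℕ}
    (hm : ∀ x : s → ℤ, x ≠ 0 → (∀ i, |x i| < B) → ∑ i, x i * (m i : ℤ) ≠ 0)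
    (hB : (2 * d + 1) ^ 2 < B) {τ : ℂ} (hτ : τ ≠ 0)
    (hR0 : MvPolynomial.aeval (fun o : Option s => o.elim 1 fun j => τ ^ m j) R = 0)
    (hS0 : MvPolynomial.aeval (fun o : Option s => o.elim 1 fun j => τ ^ m j)
      (∑ i, MvPolynomial.monomial (α i) (δ i)) = 0) :
    (minpoly K τ).natDegree ≤ (4 * nc + 1) * (2 * nb) := by
  classical
  have hαinj : ∀ i ∈ S, ∀ i' ∈ S, i ≠ i' → α i ≠ α i' := fun i hi i' hi' hii h => by
    refine ha i hi i' hi' hii (Finset.sum_congr rfl fun j _ => ?_)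
    have h1 := hα i j
    rw [h, hα i' j] at h1
    rw [show e j i = e j i' by linarith]
  have hG0 := sum_monomial_ne_zero hS hγ hαinj
  have hRd : R.totalDegree ≤ d := (MvPolynomial.totalDegree_le_of_dvd_of_isDomain hRG hG0).trans
    (totalDegree_sum_monomial_le S γ fun i _ => hd i)
  have hSd := totalDegree_sum_monomial_le Finset.univ δ fun i _ => hd i
  obtain ⟨ρ, hρ0, hρmem, hρd⟩ := exists_rename_some_mem_span_pair hR hRS
  set u := MvPolynomial.aeval (fun j => (X : K[X]) ^ m j) ρ with hu
  have hu0 : u ≠ 0 := aeval_X_pow_ne_zero hm (lt_of_le_of_lt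
    (hρd.trans (Nat.pow_le_pow_left (by omega) 2)) hB) hρ0
  -- the two polynomials with the superfluous powers of `t` removed
  let β : ι → ℕ := fun i => (∑ j, m j * e j i - q * c i + nb).toNat
  have hβ : ∀ i, (β i : ℤ) = ∑ j, m j * e j i - q * c i + nb := fun i =>
    Int.toNat_of_nonneg (by have := (abs_le.1 (hb i)).1; linarith)
  have hβle : ∀ i, β i ≤ 2 * nb := fun i => by
    have h1 := (abs_le.1 (hb i)).2
    have h2 := hβ i
    omega
  have hαle : ∀ i, α i none ≤ 2 * nc := fun i => by
    have h1 := (abs_le.1 (hc i)).1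
    have h2 := hα' i
    omega
  let g : Finset ι → (ι → K) → K[X][Y] := fun S δ => ∑ i ∈ S, monomial (α i none) (monomial (β i) (δ i))
  have hg : ∀ S δ, C (X ^ nb) * substBivariate K m q (∑ i ∈ S, MvPolynomial.monomial (α i) (δ i)) =
      C (X ^ (∑ j, m j * n j + q * nc)) * g S δ := by
    intro S δ
    simp only [g, map_sum, Finset.mul_sum]
    refine Finset.sum_congr rfl fun i _ => ?_
    rw [substBivariate_monomial, C_mul_monomial, C_mul_monomial, X_pow_mul_monomial,
      X_pow_mul_monomial]
    congr 3
    zify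
    rw [hβ, hα']
    simp only [hα, add_mul, Finset.sum_add_distrib, sub_mul, mul_comm (m _ : ℤ)]
    ring
  have hgv : ∀ S δ, (g S δ).natDegree ≤ 2 * nc := fun S δ =>
    natDegree_sum_le_of_forall_le _ _ fun i _ => (natDegree_monomial_le _).trans (hαle i)
  have hgt : ∀ S δ l, ((g S δ).coeff l).natDegree ≤ 2 * nb := fun S δ l => by
    simp only [g, finsetSum_coeff, coeff_monomial]
    refine natDegree_sum_le_of_forall_le _ _ fun i _ => ?_
    split_ifs
    · exact (natDegree_monomial_le _).trans (hβle i)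
    · simp
  have hg0 : g S γ ≠ 0 := by
    obtain ⟨i, hi⟩ := hS
    intro h
    have h1 : ((g S γ).coeff (α i none)).coeff (β i) = γ i := by
      simp only [g, finsetSum_coeff, coeff_monomial]
      rw [Finset.sum_eq_single i]
      · simp
      · intro i' hi' hne
        by_cases h2 : α i' none = α i none
        · rw [if_pos h2, coeff_monomial, if_neg]
          intro h3
          refine ha i' hi' i hi hne ?_
          have h4 := hβ i'
          have h5 := hα' i'
          rw [h3, hβ i] at h4
          rw [h2, hα' i] at h5
          have h6 : c i = c i' := by linarith
          rw [h6] at h4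
          linarith
        · rw [if_neg h2, coeff_zero]
      · exact fun h => (h hi).elim
    rw [h] at h1
    exact hγ i hi (by simpa using h1.symm)
  have ht : Prime (C (X : K[X]) : K[X][Y]) := prime_C_iff.2 prime_X
  have hΦR0 : substBivariate K m q R ≠ 0 := by
    intro h
    obtain ⟨r, hr⟩ := hRG
    have h1 := hg S γ
    rw [hr, map_mul, h, zero_mul, mul_zero] at h1
    refine hg0 ((mul_eq_zero.1 h1.symm).resolve_left ?_)
    simp
  obtain ⟨l, ψ, hψ, hRψ⟩ := WfDvdMonoid.max_power_factor hΦR0 ht.irreducible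
  have hψg : ψ ∣ g S γ := by
    have h1 : ψ ∣ C (X ^ (∑ j, m j * n j + q * nc)) * g S γ := by
      rw [← hg]
      refine Dvd.dvd.mul_left ?_ _
      exact (Dvd.intro_left _ hRψ.symm).trans (_root_.map_dvd (substBivariate K m q) hRG)
    refine IsRelPrime.dvd_of_dvd_mul_left ?_ h1
    rw [C_pow]
    exact ((ht.irreducible.isRelPrime_iff_not_dvd.2 hψ).symm).pow_right
  have hcop : IsCoprime (ψ.map (algebraMap K[X] (FractionRing K[X])))
      ((g Finset.univ δ).map (algebraMap K[X] (FractionRing K[X]))) := by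
    have h1 : C u ∈ Ideal.span {substBivariate K m q R,
        substBivariate K m q (∑ i, MvPolynomial.monomial (α i) (δ i))} := by
      have h2 := Ideal.mem_map_of_mem (substBivariate K m q) hρmem
      rw [Ideal.map_span, Set.image_pair, substBivariate_rename] at h2
      exact h2
    obtain ⟨x, y, hxy⟩ := Ideal.mem_span_pair.1 h1
    set w := algebraMap K[X] (FractionRing K[X]) (X ^ nb * u) with hw
    have hw0 : w ≠ 0 := by
      rw [hw, map_ne_zero_iff _ (IsFractionRing.injective K[X] (FractionRing K[X]))]
      exact mul_ne_zero (pow_ne_zero _ X_ne_zero) hu0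
    have h3 : C (X ^ nb * u) = (C (X ^ nb) * x * C X ^ l) * ψ +
        (y * C (X ^ (∑ j, m j * n j + q * nc))) * g Finset.univ δ := by
      rw [mul_assoc y, ← hg, C_mul, ← hxy, hRψ]
      ring
    have h4 := congrArg (Polynomial.map (algebraMap K[X] (FractionRing K[X]))) h3
    rw [Polynomial.map_add, Polynomial.map_mul, Polynomial.map_mul (q := g _ _), map_C, ← hw] at h4
    refine ⟨C w⁻¹ * map (algebraMap K[X] (FractionRing K[X])) (C (X ^ nb) * x * C X ^ l),
      C w⁻¹ * map (algebraMap K[X] (FractionRing K[X]))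
        (y * C (X ^ (∑ j, m j * n j + q * nc))), ?_⟩
    rw [mul_assoc (C w⁻¹), mul_assoc (C w⁻¹), ← mul_add, ← h4, ← C_mul, inv_mul_cancel₀ hw0, C_1]
  obtain ⟨ρ', hρ'0, hρ'mem, hρ'd⟩ := exists_C_mem_span_pair (natDegree (R := K)) natDegree_zero
    natDegree_one natDegree_neg natDegree_add_le (fun _ _ => natDegree_mul_le) ψ
    (g Finset.univ δ) (natDegree_coeff_le_of_dvd hψg hg0 (hgt S γ)) (hgt _ _) hcop
  have hψd : ψ.natDegree ≤ 2 * nc := (natDegree_le_of_dvd hψg hg0).trans (hgv _ _)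
  have hgd := hgv Finset.univ δ
  refine (?_ : (minpoly K τ).natDegree ≤ ρ'.natDegree).trans (hρ'd.trans
    (Nat.mul_le_mul_right _ (by omega)))
  have hev : ∀ p, aevalAeval τ (τ ^ q)⁻¹ (C p : K[X][Y]) = aeval τ p := fun p => by simp
  have hψ0 : aevalAeval τ (τ ^ q)⁻¹ ψ = 0 := by
    have h1 := aevalAeval_substBivariate m q hτ R
    rw [hR0, hRψ, map_mul, map_pow, hev, aeval_X] at h1
    exact (mul_eq_zero.1 h1).resolve_left (pow_ne_zero _ hτ)
  have hgδ0 : aevalAeval τ (τ ^ q)⁻¹ (g Finset.univ δ) = 0 := by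
    have h1 := congrArg (aevalAeval τ (τ ^ q)⁻¹) (hg Finset.univ δ)
    rw [map_mul, aevalAeval_substBivariate m q hτ, hS0, mul_zero, map_mul, hev, map_pow,
      aeval_X] at h1
    exact (mul_eq_zero.1 h1.symm).resolve_left (pow_ne_zero _ hτ)
  have hρ'τ : aeval τ ρ' = 0 := by
    rw [← hev]
    refine (Ideal.span_le.2 ?_ hρ'mem : _ ∈ RingHom.ker (aevalAeval (R := K) τ (τ ^ q)⁻¹))
    rintro _ (rfl | rfl)
    · exact hψ0
    · exact hgδ0
  exact natDegree_le_natDegree (minpoly.degree_le_of_ne_zero K τ hρ'0 hρ'τ)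

end

section
variable {ι : Type} [Fintype ι]

/-- Linear forms vanishing on all weights which are constant on the classes of `r`. -/
def IsOrth (r : Setoid ι) (c : ι → ℤ) : Prop :=
  ∀ b : ι → ℤ, (∀ i j, r i j → b i = b j) → ∑ i, c i * b i = 0

theorem IsOrth.mono {r r' : Setoid ι} (h : r' ≤ r) {c : ι → ℤ} (hc : IsOrth r' c) : IsOrth r c :=
  fun b hb => hc b fun i j hij => hb i j (h hij)

theorem isOrth_single_sub_single [DecidableEq ι] {r : Setoid ι} {i j : ι} (h : r i j) :
    IsOrth r (Pi.single i 1 - Pi.single j 1) := by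
  intro b hb
  simp [sub_mul, Finset.sum_sub_distrib, Pi.single_apply, hb i j h]

theorem sum_single_sub_single_mul [DecidableEq ι] (i j : ι) (a : ι → ℤ) :
    ∑ l, (Pi.single i 1 - Pi.single j 1 : ι → ℤ) l * a l = a i - a j := by
  simp [sub_mul, Finset.sum_sub_distrib, Pi.single_apply]

theorem exists_isOrth_forall_sum_eq_zero {r : Setoid ι} {s : Type*} [Fintype s]
    (hs : Fintype.card s < r.nonrep.card) (e : s → ι → ℤ) (he : ∀ j, ∀ i ∉ r.nonrep, e j i = 0) :
    ∃ c, c ≠ 0 ∧ IsOrth r c ∧ ∀ j, ∑ i, c i * e j i = 0 := by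
  classical
  let f : (r.nonrep → ℤ) →ₗ[ℤ] (s → ℤ) :=
    LinearMap.pi fun j => ∑ i : r.nonrep, e j i • LinearMap.proj i
  have hf : ¬ Function.Injective f := fun h => by
    have := card_le_of_injective ℤ f h
    rw [Fintype.card_coe] at this
    omega
  obtain ⟨x, hx, hx0⟩ : ∃ x, f x = 0 ∧ x ≠ 0 := by
    by_contra! h
    exact hf ((injective_iff_map_eq_zero f).2 h)
  set c : ι → ℤ := ∑ i : r.nonrep, x i • (Pi.single (i : ι) 1 - Pi.single (r.rep i) 1) with hc
  have hsum : ∀ a : ι → ℤ, ∑ l, c l * a l = ∑ i : r.nonrep, x i * (a i - a (r.rep i)) := by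
    intro a
    simp_rw [hc, Finset.sum_apply, Pi.smul_apply, smul_eq_mul, Finset.sum_mul]
    rw [Finset.sum_comm]
    refine Finset.sum_congr rfl fun i _ => ?_
    rw [← sum_single_sub_single_mul, Finset.mul_sum]
    exact Finset.sum_congr rfl fun l _ => mul_assoc _ _ _
  refine ⟨c, fun h0 => hx0 (funext fun i => ?_), fun b hb => ?_, fun j => ?_⟩
  · have h1 := hsum (Pi.single (i : ι) 1)
    rw [h0, Finset.sum_eq_single i] at h1
    · rw [Pi.single_eq_same, Pi.single_eq_of_ne fun h : r.rep i = i =>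
        r.rep_notMem_nonrep i (by rw [h]; exact i.2)] at h1
      simpa using h1.symm
    · intro l _ hl
      have h2 : r.rep l ≠ i := fun h => r.rep_notMem_nonrep l (h ▸ i.2)
      rw [Pi.single_eq_of_ne (fun h => hl (Subtype.ext h)), Pi.single_eq_of_ne h2]
      simp
    · simp
  · rw [hsum]
    exact Finset.sum_eq_zero fun i _ => by rw [hb _ _ (r.rep_rel i)]; simp
  · rw [hsum]
    have := congrFun hx j
    simp only [f, LinearMap.pi_apply, LinearMap.sum_apply, LinearMap.smul_apply,
      LinearMap.proj_apply, smul_eq_mul, Pi.zero_apply] at this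
    rw [← this]
    refine Finset.sum_congr rfl fun i _ => ?_
    rw [he j _ (r.rep_notMem_nonrep i)]
    ring

variable {s : Type*} [Fintype s]

/-- The exponent vectors `(e j i)_j`, translated by the sup norms so that they are nonnegative. -/
noncomputable def shiftExp (e : s → ι → ℤ) (i : ι) : s →₀ ℕ :=
  Finsupp.equivFunOnFinite.symm fun j => (e j i + supNatAbs (e j)).toNat

theorem shiftExp_apply (e : s → ι → ℤ) (i : ι) (j : s) :
    (shiftExp e i j : ℤ) = e j i + supNatAbs (e j) := by
  have h1 : shiftExp e i j = (e j i + supNatAbs (e j)).toNat := rfl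
  have := neg_abs_le (e j i)
  have := abs_le_supNatAbs (e j) i
  rw [h1, Int.toNat_of_nonneg (by linarith)]

theorem sum_shiftExp_le {e : s → ι → ℤ} {E : ℕ} (hE : ∀ j, supNatAbs (e j) ≤ E) (i : ι) :
    ((shiftExp e i).sum fun _ n => n) ≤ 2 * E * Fintype.card s := by
  rw [Finsupp.sum_fintype _ _ (fun _ => rfl), mul_comm, ← smul_eq_mul, ← Finset.card_univ]
  refine Finset.sum_le_card_nsmul _ _ _ fun j _ => ?_
  have h1 := shiftExp_apply e i j
  have h2 := le_abs_self (e j i)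
  have h3 := abs_le_supNatAbs (e j) i
  have h4 := hE j
  omega

variable {K : Type*} [Field K] [Algebra K ℂ]

/-- The polynomial encoding the relation `∑ i, w i * γ i * ∏ j, u j ^ e j i = 0`. -/
noncomputable def relPoly (γ : ι → K) (e : s → ι → ℤ) (w : ι → ℤ) : MvPolynomial s K :=
  ∑ i, MvPolynomial.monomial (shiftExp e i) (w i * γ i)

open Classical in
omit [Algebra K ℂ] in
theorem relPoly_indicator (γ : ι → K) (e : s → ι → ℤ) (r : Setoid ι) (i : ι) :
    relPoly γ e (Set.indicator {j | r i j} 1) =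
      ∑ j with r i j, MvPolynomial.monomial (shiftExp e j) (γ j) := by
  rw [relPoly, Finset.sum_filter]
  refine Finset.sum_congr rfl fun j _ => ?_
  by_cases hj : r i j
  · rw [if_pos hj, Set.indicator_of_mem (show j ∈ {j | r i j} from hj)]; simp
  · rw [if_neg hj, Set.indicator_of_notMem (show j ∉ {j | r i j} from hj)]; simp

theorem prod_pow_shiftExp (e : s → ι → ℤ) {u : s → ℂ} (hu : ∀ j, u j ≠ 0) (i : ι) :
    ∏ j, u j ^ shiftExp e i j = (∏ j, u j ^ supNatAbs (e j)) * ∏ j, u j ^ e j i := by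
  rw [← Finset.prod_mul_distrib]
  refine Finset.prod_congr rfl fun j _ => ?_
  rw [← zpow_natCast, ← zpow_natCast, shiftExp_apply, add_comm, zpow_add₀ (hu j)]

theorem aeval_relPoly_eq_zero_iff (γ : ι → K) (e : s → ι → ℤ) (w : ι → ℤ) {u : s → ℂ}
    (hu : ∀ j, u j ≠ 0) : MvPolynomial.aeval u (relPoly γ e w) = 0 ↔
      ∑ i, (w i : ℂ) * algebraMap K ℂ (γ i) * ∏ j, u j ^ e j i = 0 := by
  have h0 : (∏ j, u j ^ supNatAbs (e j)) ≠ 0 :=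
    Finset.prod_ne_zero_iff.2 fun j _ => pow_ne_zero _ (hu j)
  rw [← mul_eq_zero_iff_left h0 (b := ∑ i, (w i : ℂ) * _ * _), relPoly, map_sum, Finset.mul_sum]
  refine Eq.congr (Finset.sum_congr rfl fun i _ => ?_) rfl
  rw [MvPolynomial.aeval_monomial, Finsupp.prod_fintype _ _ (by simp), prod_pow_shiftExp e hu,
    map_mul, map_intCast]
  ring

theorem aeval_monomial_sub_monomial_eq_zero_iff (e : s → ι → ℤ) (M : ℕ) {u : s → ℂ}
    (hu : ∀ j, u j ≠ 0) (i i' : ι) :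
    MvPolynomial.aeval u (MvPolynomial.monomial (M • shiftExp e i) (1 : K) -
        MvPolynomial.monomial (M • shiftExp e i') 1) = 0 ↔
      (∏ j, u j ^ e j i) ^ M = (∏ j, u j ^ e j i') ^ M := by
  have h0 : (∏ j, u j ^ supNatAbs (e j)) ^ M ≠ 0 :=
    pow_ne_zero _ (Finset.prod_ne_zero_iff.2 fun j _ => pow_ne_zero _ (hu j))
  have h : ∀ i, MvPolynomial.aeval u (MvPolynomial.monomial (M • shiftExp e i) (1 : K)) =
      (∏ j, u j ^ supNatAbs (e j)) ^ M * (∏ j, u j ^ e j i) ^ M := fun i => by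
    rw [MvPolynomial.aeval_monomial, Finsupp.prod_fintype _ _ (by simp), ← mul_pow,
      ← prod_pow_shiftExp e hu, ← Finset.prod_pow, map_one, one_mul]
    exact Finset.prod_congr rfl fun j _ => by
      rw [Finsupp.smul_apply, smul_eq_mul, mul_comm, pow_mul]
  rw [map_sub, h, h, sub_eq_zero, mul_right_inj' h0]

omit [Fintype ι] in
theorem prod_pow_zpow {τ : ℂ} (hτ : τ ≠ 0) (m : s → ℕ) (e : s → ι → ℤ) (i : ι) :
    ∏ j, (τ ^ m j) ^ e j i = τ ^ ∑ j, (m j : ℤ) * e j i := by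
  classical
  have h : ∀ t : Finset s, ∏ j ∈ t, (τ ^ m j) ^ e j i = τ ^ ∑ j ∈ t, (m j : ℤ) * e j i := by
    intro t
    induction t using Finset.induction_on with
    | empty => simp
    | insert j t hj ih =>
      rw [Finset.prod_insert hj, Finset.sum_insert hj, ih, zpow_add₀ hτ, zpow_mul, zpow_natCast]
  exact h _

omit [Fintype ι] in
theorem prod_exp_zpow (z : s → ℂ) (e : s → ι → ℤ) (i : ι) :
    ∏ j, Complex.exp (z j) ^ e j i = Complex.exp (∑ j, z j * e j i) := by
  rw [Complex.exp_sum]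
  exact Finset.prod_congr rfl fun j _ => by rw [← Complex.exp_int_mul, mul_comm]

/-- The point `exp ∘ y` satisfies relations compatible with `r`, the `M`-th powers of its
coordinates are distinct within each class, and its transcendence degree is at least `k - 1`. -/
structure IsBadLog (K : Type*) [Field K] [Algebra K ℂ] (γ : ι → K) (r : Setoid ι) (M k : ℕ)
    (y : ι → ℂ) : Prop where
  isRelated : IsRelated (fun i => algebraMap K ℂ (γ i)) r fun i => Complex.exp (y i)
  pow_ne : ∀ i j, r i j → i ≠ j → Complex.exp (y i) ^ M ≠ Complex.exp (y j) ^ M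
  le_familyTrdeg : (k : ℕ∞) ≤ familyTrdeg K (fun i => Complex.exp (y i)) + 1

theorem IsBadLog.exists_irreducible [Nonempty ι] [Nonempty s] {γ : ι → K} (hγ : ∀ i, γ i ≠ 0)
    {r : Setoid ι} {M : ℕ} {e : s → ι → ℤ} {z : s → ℂ}
    (h : IsBadLog K γ r M (Fintype.card s) fun i => ∑ j, z j * e j i) :
    ∃ (W : Set (ι → ℤ)) (P : MvPolynomial s K), IsRelationFamily r W ∧ Irreducible P ∧
      (∀ w ∈ W, P ∣ relPoly γ e w) ∧
      (∀ i i', r i i' → i ≠ i' → ¬ P ∣ MvPolynomial.monomial (M • shiftExp e i) 1 -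
        MvPolynomial.monomial (M • shiftExp e i') 1) ∧ ∀ j, ¬ MvPolynomial.X j ∣ P := by
  classical
  obtain ⟨⟨W, hW, hrel⟩, hne, htr⟩ := h
  set u : s → ℂ := fun j => Complex.exp (z j) with hu
  have hu0 : ∀ j, u j ≠ 0 := fun j => Complex.exp_ne_zero _
  have htr' : (Fintype.card s : ℕ∞) ≤ familyTrdeg K u + 1 :=
    htr.trans (add_le_add_left (familyTrdeg_le_of_isAlgebraic fun i =>
      isAlgebraic_exp_sum_mul z e i) 1)
  obtain ⟨j, hj⟩ := exists_algebraicIndependent_ne htr'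
  have hrel' : ∀ w ∈ W, MvPolynomial.aeval u (relPoly γ e w) = 0 := fun w hw => by
    rw [aeval_relPoly_eq_zero_iff γ e w hu0, ← hrel w hw]
    exact Finset.sum_congr rfl fun i _ => by rw [prod_exp_zpow]
  have hQ : ∀ i i', r i i' → i ≠ i' → MvPolynomial.aeval u
      (MvPolynomial.monomial (M • shiftExp e i) (1 : K) -
        MvPolynomial.monomial (M • shiftExp e i') 1) ≠ 0 := fun i i' hi hii h0 => by
    rw [aeval_monomial_sub_monomial_eq_zero_iff e M hu0, prod_exp_zpow, prod_exp_zpow] at h0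
    exact hne i i' hi hii h0
  let i₀ := Classical.arbitrary ι
  have hG : relPoly γ e (Set.indicator {j | r i₀ j} 1) ≠ 0 := by
    rw [relPoly_indicator]
    refine sum_monomial_ne_zero ⟨i₀, by simp⟩ (fun i _ => hγ i) ?_
    intro i hi i' hi' hii h0
    simp only [Finset.mem_filter, Finset.mem_univ, true_and] at hi hi'
    exact hQ i i' (r.trans (r.symm hi) hi') hii (by rw [h0, sub_self, map_zero])
  obtain ⟨P, hP, hPu, hdvd⟩ := exists_irreducible_forall_dvd hj hG (hrel' _ (hW.indicator_mem i₀))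
  refine ⟨W, P, hW, hP, fun w hw => hdvd _ (hrel' w hw), fun i i' hi hii hd => ?_,
    fun l hd => ?_⟩
  · obtain ⟨q, hq⟩ := hd
    exact hQ i i' hi hii (by rw [hq, map_mul, hPu, zero_mul])
  · obtain ⟨q, hq⟩ : P ∣ MvPolynomial.X l :=
      ((hP.dvd_iff.1 hd).resolve_left MvPolynomial.X_prime.not_isUnit).dvd
    have := congrArg (MvPolynomial.aeval u) hq
    rw [map_mul, hPu, zero_mul, MvPolynomial.aeval_X] at this
    exact hu0 l this

end

section

theorem isAlgebraic_of_sum_zpow_eq_zero {K : Type*} [Field K] [Algebra K ℂ] {ι : Type*}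
    {S : Finset ι} (hS : S.Nonempty) {γ : ι → K} (hγ : ∀ i ∈ S, γ i ≠ 0) {a : ι → ℤ}
    (ha : ∀ i ∈ S, ∀ j ∈ S, i ≠ j → a i ≠ a j) {τ : ℂ} (hτ : τ ≠ 0)
    (h : ∑ i ∈ S, algebraMap K ℂ (γ i) * τ ^ a i = 0) : IsAlgebraic K τ := by
  set V : ℤ := ∑ i ∈ S, |a i|
  have hV : ∀ i ∈ S, ((a i + V).toNat : ℤ) = a i + V := fun i hi => by
    have h1 : |a i| ≤ V := Finset.single_le_sum (f := fun i => |a i|) (fun _ _ => abs_nonneg _) hi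
    have := neg_abs_le (a i)
    exact Int.toNat_of_nonneg (by linarith)
  refine ⟨∑ i ∈ S, Polynomial.monomial (a i + V).toNat (γ i), fun h0 => ?_, ?_⟩
  · obtain ⟨i, hi⟩ := hS
    have := congrArg (fun p => Polynomial.coeff p (a i + V).toNat) h0
    simp only [Polynomial.finsetSum_coeff, Polynomial.coeff_monomial, Polynomial.coeff_zero] at this
    rw [Finset.sum_eq_single i, if_pos rfl] at this
    · exact hγ i hi this
    · intro j hj hji
      refine if_neg fun he => ha j hj i hi hji ?_
      have := hV i hi
      have := hV j hj
      omega
    · exact fun hi' => absurd hi hi'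
  · rw [map_sum, ← mul_zero (τ ^ V), ← h, Finset.mul_sum]
    refine Finset.sum_congr rfl fun i hi => ?_
    rw [Polynomial.aeval_monomial, ← zpow_natCast, hV i hi, zpow_add₀ hτ]
    ring

theorem exists_injective_top {s : Type*} [Fintype s] (j : s) {N : ℕ} (hN : Fintype.card s ≤ N) :
    ∃ σ : s → ℕ, Function.Injective σ ∧ σ j = N ∧ ∀ i ≠ j, σ i < Fintype.card s := by
  classical
  let f := Fintype.equivFin s
  have h : ∀ i ≠ j, Function.update (fun i => (f i : ℕ)) j N i = f i :=
    fun i hi => Function.update_of_ne hi _ _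
  refine ⟨Function.update (fun i => (f i : ℕ)) j N, fun i i' hii => ?_,
    Function.update_self _ _ _, fun i hi => ?_⟩
  · by_contra hne
    by_cases hi : i = j
    · subst hi
      rw [Function.update_self, h _ (Ne.symm hne)] at hii
      exact absurd (f i').2 (by omega)
    · by_cases hi' : i' = j
      · subst hi'
        rw [Function.update_self, h _ hi] at hii
        exact absurd (f i).2 (by omega)
      · rw [h _ hi, h _ hi'] at hii
        exact hne (f.injective (Fin.ext hii))
  · rw [h i hi]
    exact (f i).2

theorem exists_degreeOf_ne_zero {K : Type*} [Field K] {s : Type*} {P : MvPolynomial s K}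
    (hP : Irreducible P) : ∃ j, P.degreeOf j ≠ 0 := by
  by_contra! h
  have h1 : P.vars = ∅ := Finset.eq_empty_of_forall_notMem fun j hj =>
    MvPolynomial.mem_vars_iff_degreeOf_ne_zero.1 hj (h j)
  rw [MvPolynomial.vars_eq_empty_iff_eq_C] at h1
  refine hP.not_isUnit ?_
  rw [h1]
  refine (IsUnit.mk0 (P.coeff 0) fun h0 => hP.ne_zero ?_).map MvPolynomial.C
  rw [h1, h0, map_zero]

theorem aeval_eq_of_degreeOf_eq_zero {K : Type*} [Field K] [Algebra K ℂ] {s : Type*}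
    {P : MvPolynomial s K} {j : s} (h : P.degreeOf j = 0) {u v : s → ℂ}
    (huv : ∀ i ≠ j, u i = v i) : MvPolynomial.aeval u P = MvPolynomial.aeval v P := by
  refine MvPolynomial.eval₂Hom_congr' rfl (fun i hi _ => huv i ?_) rfl
  rintro rfl
  exact MvPolynomial.mem_vars_iff_degreeOf_ne_zero.1 hi h

variable {ι : Type} [Fintype ι]

/-- The forms in `ℋ` separate the exponents in each class and detect relations for finer
partitions; away from them the sup norm of the exponents is bounded in terms of the degree. -/
structure IsControlled (K : IntermediateField ℚ ℂ) (γ : ι → K) (r : Setoid ι)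
    (ℋ : Finset (ι → ℤ)) (C ε : ℝ) : Prop where
  exists_sep : ∀ i j, r i j → i ≠ j → ∃ c ∈ ℋ, ∀ a : ι → ℤ, ∑ l, c l * a l = a i - a j
  finer : ∀ r' < r, ∀ (a : ι → ℤ) (τ : ℂ), IsAlgebraic ℚ τ → τ ≠ 0 → ¬ IsOfFinOrder τ →
    IsRelated (fun i => algebraMap K ℂ (γ i)) r' (fun i => τ ^ a i) → ∃ c ∈ ℋ, ∑ l, c l * a l = 0
  supNatAbs_le : ∀ (a : ι → ℤ) (τ : ℂ), (∀ i ∉ r.nonrep, a i = 0) → IsAlgebraic ℚ τ → τ ≠ 0 →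
    ¬ IsOfFinOrder τ → IsRelated (fun i => algebraMap K ℂ (γ i)) r (fun i => τ ^ a i) →
    (∀ r' < r, ¬ IsRelated (fun i => algebraMap K ℂ (γ i)) r' (fun i => τ ^ a i)) →
    (supNatAbs a : ℝ) ≤ C * ((minpoly K τ).natDegree : ℝ) ^ (1 + ε)

variable {K : IntermediateField ℚ ℂ} {γ : ι → K} {r : Setoid ι} {ℋ : Finset (ι → ℤ)} {C ε : ℝ}
  {s : Type*} [Fintype s]

theorem IsControlled.supNatAbs_le_of_aeval_eq_zero [FiniteDimensional ℚ K] [Nonempty ι]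
    (hℋ : IsControlled K γ r ℋ C ε) (hγ : ∀ i, γ i ≠ 0) {e : s → ι → ℤ}
    (he : ∀ j, ∀ i ∉ r.nonrep, e j i = 0) (heℋ : ∀ c ∈ ℋ, ∃ j, ∑ i, c i * e j i ≠ 0)
    {m : s → ℕ} {B : ℕ}
    (hm : ∀ x : s → ℤ, x ≠ 0 → (∀ i, |x i| < B) → ∑ i, x i * (m i : ℤ) ≠ 0)
    (hB : ∀ c ∈ ℋ, ∀ j, |∑ i, c i * e j i| < B) {W : Set (ι → ℤ)} (hW : IsRelationFamily r W)
    {P : MvPolynomial s K} (hPW : ∀ w ∈ W, P ∣ relPoly γ e w) {τ : ℂ} (hτ : τ ≠ 0)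
    (hnt : ¬ IsOfFinOrder τ) (hP : MvPolynomial.aeval (fun j => τ ^ m j) P = 0) :
    IsAlgebraic ℚ τ ∧
      (∀ i i', r i i' → i ≠ i' → ∑ j, (m j : ℤ) * e j i ≠ ∑ j, (m j : ℤ) * e j i') ∧
      (supNatAbs (fun i => ∑ j, (m j : ℤ) * e j i) : ℝ) ≤
        C * ((minpoly K τ).natDegree : ℝ) ^ (1 + ε) := by
  classical
  set a : ι → ℤ := fun i => ∑ j, (m j : ℤ) * e j i with ha
  have hca : ∀ c ∈ ℋ, ∑ i, c i * a i ≠ 0 := fun c hc => by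
    obtain ⟨j, hj⟩ := heℋ c hc
    convert hm (fun j => ∑ i, c i * e j i) (fun h => hj (congrFun h j)) (hB c hc) using 1
    simp_rw [ha, Finset.mul_sum, Finset.sum_mul]
    rw [Finset.sum_comm]
    exact Finset.sum_congr rfl fun j _ => Finset.sum_congr rfl fun i _ => by ring
  have hsep : ∀ i i', r i i' → i ≠ i' → a i ≠ a i' := fun i i' hi hii h => by
    obtain ⟨c, hc, hc'⟩ := hℋ.exists_sep i i' hi hii
    exact hca c hc (by rw [hc', h, sub_self])
  have hrel : IsRelated (fun i => algebraMap K ℂ (γ i)) r (fun i => τ ^ a i) := by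
    refine ⟨W, hW, fun w hw => ?_⟩
    obtain ⟨q, hq⟩ := hPW w hw
    have := (aeval_relPoly_eq_zero_iff γ e w (u := fun j => τ ^ m j)
      fun j => pow_ne_zero _ hτ).1 (by rw [hq, map_mul, hP, zero_mul])
    simp_rw [prod_pow_zpow hτ] at this
    exact this
  have halg : IsAlgebraic ℚ τ := by
    let i₀ := Classical.arbitrary ι
    have : IsAlgebraic K τ := by
      refine isAlgebraic_of_sum_zpow_eq_zero (S := {j | r i₀ j}) ⟨i₀, by simp⟩ (fun i _ => hγ i)
        ?_ hτ (hrel.sum_class i₀)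
      intro i hi i' hi' hii
      simp only [Finset.mem_filter, Finset.mem_univ, true_and] at hi hi'
      exact hsep i i' (r.trans (r.symm hi) hi') hii
    exact this.restrictScalars ℚ
  refine ⟨halg, hsep, hℋ.supNatAbs_le a τ (fun i hi => ?_) halg hτ hnt hrel
    fun r' hr' h => ?_⟩
  · exact Finset.sum_eq_zero fun j _ => by rw [he j i hi, mul_zero]
  · obtain ⟨c, hc, hc0⟩ := hℋ.finer r' hr' a τ halg hτ hnt h
    exact hca c hc hc0

theorem exists_root_pow [Nonempty ι] (hγ : ∀ i, γ i ≠ 0) {M : ℕ}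
    (hM : ∀ ζ : ℂ, IsOfFinOrder ζ → ∀ B : Finset ι, B.Nonempty → ∀ a : ι → ℤ,
      ∑ i ∈ B, algebraMap K ℂ (γ i) * ζ ^ a i = 0 →
        ∃ i ∈ B, ∃ j ∈ B, i ≠ j ∧ (ζ ^ (a i - a j)) ^ M = 1)
    {e : s → ι → ℤ} {E : ℕ} (hE : ∀ j, supNatAbs (e j) ≤ E) {W : Set (ι → ℤ)}
    (hW : IsRelationFamily r W) {P : MvPolynomial s K} (hP : Irreducible P)
    (hPW : ∀ w ∈ W, P ∣ relPoly γ e w)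
    (hPQ : ∀ i i', r i i' → i ≠ i' → ¬ P ∣ MvPolynomial.monomial (M • shiftExp e i) 1 -
        MvPolynomial.monomial (M • shiftExp e i') 1) {j : s} (hj : P.degreeOf j ≠ 0)
    (hXj : ¬ MvPolynomial.X j ∣ P) {σ : s → ℕ} (hσ : Function.Injective σ)
    (hσj : Fintype.card s ≤ σ j) (hσ' : ∀ i ≠ j, σ i < Fintype.card s) {B : ℕ}
    (hB : 2 * E * Fintype.card s + Fintype.card ι ^ 3 *
      (2 * E * Fintype.card s + M * (2 * E * Fintype.card s) + 1) ^ 2 < B) :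
    ∃ τ : ℂ, τ ≠ 0 ∧ ¬ IsOfFinOrder τ ∧ MvPolynomial.aeval (fun i => τ ^ B ^ σ i) P = 0 := by
  classical
  let i₀ := Classical.arbitrary ι
  have hB0 : 0 < B := by omega
  refine exists_not_isOfFinOrder_root (S := ({j | r i₀ j} : Finset ι)) (γ := γ) (M := M)
    (α := shiftExp e) (d := 2 * E * Fintype.card s) (B := B) ⟨i₀, by simp⟩ (fun i _ => hγ i)
    (fun ζ hζ a h => hM ζ hζ _ ⟨i₀, by simp⟩ a h) (fun i _ => sum_shiftExp_le hE i) hP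
    ?_ ?_ hj hXj ?_ ?_ (by positivity) (lt_of_le_of_lt ?_ hB)
  · rw [← relPoly_indicator]
    exact hPW _ (hW.indicator_mem i₀)
  · intro i hi i' hi' hii
    simp only [Finset.mem_filter, Finset.mem_univ, true_and] at hi hi'
    exact hPQ i i' (r.trans (r.symm hi) hi') hii
  · intro x hx hxB
    push_cast
    exact sum_mul_pow_ne_zero hσ hx hxB
  · intro i hi
    rw [← pow_succ]
    exact Nat.pow_le_pow_right hB0 ((hσ' i hi).trans_le hσj)
  · gcongr
    exact Finset.card_le_univ _

end

section

theorem supNatAbs_neg {ι : Type*} [Fintype ι] (c : ι → ℤ) : supNatAbs (-c) = supNatAbs c := by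
  simp [supNatAbs]

theorem zpow_pow_ne_zpow_pow {τ : ℂ} (hτ : τ ≠ 0) (hnt : ¬ IsOfFinOrder τ) {M : ℕ} (hM : 1 ≤ M)
    {a b : ℤ} (hab : a ≠ b) : (τ ^ a) ^ M ≠ (τ ^ b) ^ M := by
  intro h
  rw [← zpow_natCast, ← zpow_natCast, ← zpow_mul, ← zpow_mul] at h
  have h1 : τ ^ ((a - b) * M) = 1 := by
    rw [sub_mul, zpow_sub₀ hτ, h, div_self (zpow_ne_zero _ hτ)]
  have h2 : (a - b) * M ≠ 0 := mul_ne_zero (sub_ne_zero.2 hab) (by positivity)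
  refine hnt (isOfFinOrder_iff_pow_eq_one.2 ⟨((a - b) * M).natAbs, by positivity, ?_⟩)
  rcases Int.natAbs_eq ((a - b) * (M : ℤ)) with h3 | h3
  · rw [← zpow_natCast, ← h3, h1]
  · rw [← inv_inj, inv_one, ← zpow_natCast, ← zpow_neg, ← h3, h1]

theorem exists_irreducible_dvd_of_aeval_eq_zero {K : Type*} [Field K] [Algebra K ℂ] {s : Type*}
    {G : MvPolynomial s K} (hG : G ≠ 0) {p : s → ℂ} (hp : MvPolynomial.aeval p G = 0) :
    ∃ R, Irreducible R ∧ R ∣ G ∧ MvPolynomial.aeval p R = 0 := by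
  obtain ⟨f, hf, q, hq⟩ := UniqueFactorizationMonoid.exists_prime_factors G hG
  rw [← hq, map_mul, map_multiset_prod] at hp
  have h1 := (mul_eq_zero.1 hp).resolve_right ((q.isUnit.map (MvPolynomial.aeval p)).ne_zero)
  rw [Multiset.prod_eq_zero_iff, Multiset.mem_map] at h1
  obtain ⟨R, hR, hR0⟩ := h1
  exact ⟨R, (hf R hR).irreducible, (Multiset.dvd_prod hR).trans ⟨q, hq.symm⟩, hR0⟩

variable {ι : Type} [Fintype ι] {K : IntermediateField ℚ ℂ} {γ : ι → K} {r : Setoid ι}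

theorem IsControlled.degreeOf_ne_zero {ℋ : Finset (ι → ℤ)} {C ε : ℝ}
    {s : Type*} [Fintype s] [FiniteDimensional ℚ K] [Nonempty ι]
    (hℋ : IsControlled K γ r ℋ C ε) (hγ : ∀ i, γ i ≠ 0) {M : ℕ}
    (hM : ∀ ζ : ℂ, IsOfFinOrder ζ → ∀ B : Finset ι, B.Nonempty → ∀ a : ι → ℤ,
      ∑ i ∈ B, algebraMap K ℂ (γ i) * ζ ^ a i = 0 →
        ∃ i ∈ B, ∃ j ∈ B, i ≠ j ∧ (ζ ^ (a i - a j)) ^ M = 1)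
    {e : s → ι → ℤ} (he : ∀ j, ∀ i ∉ r.nonrep, e j i = 0)
    (heℋ : ∀ c ∈ ℋ, ∃ j, ∑ i, c i * e j i ≠ 0)
    {E : ℕ} (hE : ∀ j, supNatAbs (e j) ≤ E) {W : Set (ι → ℤ)}
    (hW : IsRelationFamily r W) {P : MvPolynomial s K} (hP : Irreducible P)
    (hPW : ∀ w ∈ W, P ∣ relPoly γ e w)
    (hPQ : ∀ i i', r i i' → i ≠ i' → ¬ P ∣ MvPolynomial.monomial (M • shiftExp e i) 1 -
        MvPolynomial.monomial (M • shiftExp e i') 1)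
    (hXP : ∀ j, ¬ MvPolynomial.X j ∣ P) {B : ℕ}
    (hB : 2 * E * Fintype.card s + Fintype.card ι ^ 3 *
      (2 * E * Fintype.card s + M * (2 * E * Fintype.card s) + 1) ^ 2 < B)
    (hB' : ∀ c ∈ ℋ, ∀ j, |∑ i, c i * e j i| < B) {j : s} (hj : 1 ≤ supNatAbs (e j)) :
    P.degreeOf j ≠ 0 := by
  classical
  intro h0
  obtain ⟨j₁, hj₁⟩ := exists_degreeOf_ne_zero hP
  obtain ⟨σ, hσ, hσj, hσ'⟩ := exists_injective_top j₁ le_rfl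
  obtain ⟨τ, hτ, hnt, hτP⟩ := exists_root_pow hγ hM hE hW hP hPW hPQ hj₁ (hXP j₁) hσ hσj.ge hσ' hB
  obtain ⟨i, hi⟩ := exists_abs_eq_supNatAbs hj
  set A := C * ((minpoly K τ).natDegree : ℝ) ^ (1 + ε)
  set T : ℤ := ∑ l ∈ Finset.univ.erase j, |(B : ℤ) ^ σ l * e l i| with hT
  have hs : 1 ≤ Fintype.card s := Fintype.card_pos_iff.2 ⟨j⟩
  have hB2 : 1 < B := by
    have h1 : 1 * 1 ≤ E * Fintype.card s := Nat.mul_le_mul (hj.trans (hE j)) hs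
    have h2 : 2 * E * Fintype.card s = 2 * (E * Fintype.card s) := by ring
    omega
  obtain ⟨N, hN⟩ := exists_nat_gt (max (A + T) (Fintype.card s : ℝ))
  have hNs : Fintype.card s < N := by exact_mod_cast (le_max_right _ _).trans_lt hN
  have hσle : ∀ l, σ l < N := fun l => by
    by_cases hl : l = j₁
    · rw [hl, hσj]; exact hNs
    · exact (hσ' l hl).trans hNs
  set ρ := Function.update σ j N with hρ
  have hρj : ρ j = N := Function.update_self _ _ _
  have hρl : ∀ l ≠ j, ρ l = σ l := fun l hl => Function.update_of_ne hl _ _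
  have hρi : Function.Injective ρ := fun l l' hll => by
    by_contra hne
    by_cases hl : l = j
    · subst hl
      rw [hρj, hρl _ (Ne.symm hne)] at hll
      exact absurd (hσle l') (by omega)
    · by_cases hl' : l' = j
      · subst hl'
        rw [hρj, hρl _ hl] at hll
        exact absurd (hσle l) (by omega)
      · rw [hρl _ hl, hρl _ hl'] at hll
        exact hne (hσ hll)
  have hτP' : MvPolynomial.aeval (fun l => τ ^ B ^ ρ l) P = 0 := by
    rw [← hτP]
    exact aeval_eq_of_degreeOf_eq_zero h0 fun l hl => by rw [hρl l hl]
  obtain ⟨-, -, hle⟩ := hℋ.supNatAbs_le_of_aeval_eq_zero hγ he heℋ (m := fun l => B ^ ρ l) (B := B)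
    (fun x hx hxB => by push_cast; exact sum_mul_pow_ne_zero hρi hx hxB) hB' hW hPW hτ hnt hτP'
  have h1 := abs_le_supNatAbs (fun i => ∑ l, ((B ^ ρ l : ℕ) : ℤ) * e l i) i
  rw [← Finset.add_sum_erase _ _ (Finset.mem_univ j), hρj] at h1
  have h2 : |∑ l ∈ Finset.univ.erase j, ((B ^ ρ l : ℕ) : ℤ) * e l i| ≤ T := by
    refine (Finset.abs_sum_le_sum_abs _ _).trans (Finset.sum_le_sum fun l hl => ?_)
    rw [hρl l (Finset.ne_of_mem_erase hl)]
    push_cast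
    exact le_rfl
  have h3 : ((B ^ N : ℕ) : ℤ) ≤ |((B ^ N : ℕ) : ℤ) * e j i| := by
    rw [abs_mul, hi, Nat.abs_cast]
    exact le_mul_of_one_le_right (by positivity) (by exact_mod_cast hj)
  have h4 := abs_sub_abs_le_abs_add (((B ^ N : ℕ) : ℤ) * e j i)
    (∑ l ∈ Finset.univ.erase j, ((B ^ ρ l : ℕ) : ℤ) * e l i)
  have h5 : ((B ^ N : ℕ) : ℤ) ≤ supNatAbs (fun i => ∑ l, ((B ^ ρ l : ℕ) : ℤ) * e l i) + T := by
    linarith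
  have h6 : ((B ^ N : ℕ) : ℝ) ≤ (supNatAbs (fun i => ∑ l, ((B ^ ρ l : ℕ) : ℤ) * e l i) : ℝ) + T := by
    exact_mod_cast h5
  have h7 : (N : ℝ) < ((B ^ N : ℕ) : ℝ) := by exact_mod_cast Nat.lt_pow_self hB2
  have h8 := (le_max_left _ _).trans_lt hN
  linarith

theorem natDegree_minpoly_le_or_exists_isBadLog [FiniteDimensional ℚ K] [Nonempty ι]
    (hγ : ∀ i, γ i ≠ 0) {M : ℕ} (hM1 : 1 ≤ M) {s : Type} [Fintype s] {e : s → ι → ℤ}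
    {E : ℕ} (hE : ∀ j, supNatAbs (e j) ≤ E) {W : Set (ι → ℤ)} (hW : IsRelationFamily r W)
    {m : s → ℕ} {τ : ℂ} (hτ : τ ≠ 0) (hnt : ¬ IsOfFinOrder τ)
    (hτW : ∀ w ∈ W, MvPolynomial.aeval (fun j => τ ^ m j) (relPoly γ e w) = 0)
    (hsep : ∀ i i', r i i' → i ≠ i' → ∑ j, (m j : ℤ) * e j i ≠ ∑ j, (m j : ℤ) * e j i')
    {B : ℕ} (hm : ∀ x : s → ℤ, x ≠ 0 → (∀ i, |x i| < B) → ∑ i, x i * (m i : ℤ) ≠ 0)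
    (hB : (2 * (2 * E * (Fintype.card s + 1)) + 1) ^ 2 < B) {c : ι → ℤ} (hc : supNatAbs c ≤ E)
    (hec : LinearIndependent ℂ fun (o : Option s) i => ((o.elim (-c) e : ι → ℤ) i : ℂ)) {q nb : ℕ}
    (hb : ∀ i, |∑ j, (m j : ℤ) * e j i - q * c i| ≤ nb) :
    (minpoly K τ).natDegree ≤ (4 * supNatAbs c + 1) * (2 * nb) ∨
      ∃ z : Option s → ℂ, IsBadLog K γ r M (Fintype.card (Option s))
        fun i => ∑ o, z o * ((o.elim (-c) e : ι → ℤ) i : ℂ) := by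
  classical
  set e' : Option s → ι → ℤ := fun o => o.elim (-c) e with he'
  set p : Option s → ℂ := fun o => o.elim 1 fun j => τ ^ m j with hp
  have hp0 : ∀ o, p o ≠ 0 := by rintro (_ | j) <;> simp [hp, hτ]
  have hpp : ∀ i, ∏ o, p o ^ e' o i = τ ^ ∑ j, (m j : ℤ) * e j i := fun i => by
    rw [Fintype.prod_option, ← prod_pow_zpow hτ]
    simp [hp, he']
  have hpW : ∀ w ∈ W, MvPolynomial.aeval p (relPoly γ e' w) = 0 := fun w hw => by
    rw [aeval_relPoly_eq_zero_iff γ e' w hp0]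
    have := (aeval_relPoly_eq_zero_iff γ e w fun j => pow_ne_zero (m j) hτ).1 (hτW w hw)
    simp_rw [hpp]
    simp_rw [prod_pow_zpow hτ] at this
    exact this
  let i₀ := Classical.arbitrary ι
  have hα : ∀ i, i ∈ ({j | r i₀ j} : Finset ι) → ∀ i' ∈ ({j | r i₀ j} : Finset ι), i ≠ i' →
      ∑ j, (m j : ℤ) * e j i ≠ ∑ j, (m j : ℤ) * e j i' := by
    intro i hi i' hi' hii
    simp only [Finset.mem_filter, Finset.mem_univ, true_and] at hi hi'
    exact hsep i i' (r.trans (r.symm hi) hi') hii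
  have hG : relPoly γ e' (Set.indicator {j | r i₀ j} 1) ≠ 0 := by
    rw [relPoly_indicator]
    refine sum_monomial_ne_zero ⟨i₀, by simp⟩ (fun i _ => hγ i) ?_
    intro i hi i' hi' hii h0
    refine hα i hi i' hi' hii (Finset.sum_congr rfl fun j _ => ?_)
    have h1 := shiftExp_apply e' i (some j)
    have h2 := shiftExp_apply e' i' (some j)
    rw [h0] at h1
    have h3 : e' (some j) = e j := rfl
    rw [h3] at h1 h2
    rw [show e j i = e j i' by linarith]
  obtain ⟨R, hR, hRG, hRp⟩ :=
    exists_irreducible_dvd_of_aeval_eq_zero hG (hpW _ (hW.indicator_mem i₀))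
  by_cases hRW : ∀ w ∈ W, R ∣ relPoly γ e' w
  · right
    obtain ⟨θ, hθ⟩ := exists_algebraicIndependent_complex K (Option s)
    obtain ⟨u, j, hj, hRu, hu⟩ := exists_generic_point hθ hR
    have hRp' : ∀ S, MvPolynomial.aeval p S ≠ 0 → MvPolynomial.aeval u S ≠ 0 := fun S hS =>
      hu S fun ⟨x, hx⟩ => hS (by rw [hx, map_mul, hRp, zero_mul])
    have hu0 : ∀ o, u o ≠ 0 := fun o => by
      have := hRp' (MvPolynomial.X o)
      simp only [MvPolynomial.aeval_X] at this
      exact this (hp0 o)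
    have hx : ∀ i, Complex.exp (∑ o, Complex.log (u o) * e' o i) = ∏ o, u o ^ e' o i := fun i => by
      rw [← prod_exp_zpow]
      exact Finset.prod_congr rfl fun o _ => by rw [Complex.exp_log (hu0 o)]
    refine ⟨fun o => Complex.log (u o), ⟨W, hW, fun w hw => ?_⟩, fun i i' hi hii => ?_, ?_⟩
    · obtain ⟨x, hx'⟩ := hRW w hw
      have := (aeval_relPoly_eq_zero_iff γ e' w hu0).1 (by rw [hx', map_mul, hRu, zero_mul])
      rw [← this]
      exact Finset.sum_congr rfl fun i _ => congrArg _ (hx i)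
    · have := hRp' (MvPolynomial.monomial (M • shiftExp e' i) 1 -
        MvPolynomial.monomial (M • shiftExp e' i') 1)
      rw [Ne, Ne, aeval_monomial_sub_monomial_eq_zero_iff e' M hp0,
        aeval_monomial_sub_monomial_eq_zero_iff e' M hu0, hpp, hpp] at this
      refine fun h => this (zpow_pow_ne_zpow_pow hτ hnt hM1 (hsep i i' hi hii)) ?_
      rw [← hx, ← hx]
      exact h
    · have h1 : familyTrdeg K u ≤
          familyTrdeg K fun i => Complex.exp (∑ o, Complex.log (u o) * e' o i) :=
        familyTrdeg_le_of_isAlgebraic fun o => by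
          have := isAlgebraic_exp_of_linearIndependent (K := K) hec (fun o => Complex.log (u o)) o
          rwa [Complex.exp_log (hu0 o)] at this
      have h2 := (card_le_familyTrdeg hj).trans ((familyTrdeg_mono u Subtype.val).trans h1)
      refine le_trans ?_ (add_le_add_left h2 1)
      have h3 : Fintype.card (Option s) = Fintype.card {i // i ≠ j} + 1 := by
        rw [Fintype.card_subtype_compl, Fintype.card_subtype_eq, Fintype.card_option]
        rfl
      rw [h3]
      push_cast
      exact le_rfl
  · left
    push Not at hRW
    obtain ⟨w, hw, hRw⟩ := hRW
    refine natDegree_minpoly_le (S := ({j | r i₀ j} : Finset ι)) (γ := γ)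
      (δ := fun i => (w i : K) * γ i) (α := shiftExp e') (e := e) (c := c)
      (n := fun j => supNatAbs (e j)) (q := q) (d := 2 * E * (Fintype.card s + 1)) (m := m)
      ⟨i₀, by simp⟩ (fun i _ => hγ i) (fun i j => shiftExp_apply e' i (some j)) (fun i => ?_)
      (abs_le_supNatAbs c) (fun i => ?_) hb hα hR ?_ hRw hm hB hτ hRp (hpW w hw)
    · have := shiftExp_apply e' i none
      rw [this, show e' none = -c from rfl, supNatAbs_neg, Pi.neg_apply]
      ring
    · rw [← Fintype.card_option]
      refine sum_shiftExp_le ?_ i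
      rintro (_ | j)
      · rw [show e' none = -c from rfl, supNatAbs_neg]; exact hc
      · exact hE j
    · rw [← relPoly_indicator]
      exact hRG

end

section

theorem le_sq_of_mul_degree_le {n Q E X D : ℕ} {C ε : ℝ} (hn : 1 ≤ n) (hC : 0 < C) (hQ : 1 ≤ Q)
    (hε : ε = 1 / (6 * n * (4 * n + 1))) (hQE : E < 2 * (Q + 1) ^ (3 * n)) (hX0 : 0 < X)
    (hX : X ≤ E ^ (4 * n + 1)) (hD : Q * D ≤ 30 * X)
    (hXD : (X : ℝ) ≤ 2 * (C * (D : ℝ) ^ (1 + ε))) : (Q : ℝ) ≤ (3600 * C) ^ 2 := by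
  have hn' : (1 : ℝ) ≤ n := by exact_mod_cast hn
  have hQ' : (1 : ℝ) ≤ Q := by exact_mod_cast hQ
  have hX' : (0 : ℝ) < X := by exact_mod_cast hX0
  have hε0 : 0 < ε := by rw [hε]; positivity
  have hε1 : ε ≤ 1 := by
    rw [hε, div_le_one (by positivity)]
    nlinarith
  have h1 : (X : ℝ) ≤ (4 * Q) ^ (3 * n * (4 * n + 1)) := by
    have h2 : E ≤ (4 * Q) ^ (3 * n) := by
      refine hQE.le.trans ?_
      calc 2 * (Q + 1) ^ (3 * n) ≤ 2 ^ (3 * n) * (Q + 1) ^ (3 * n) := by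
            gcongr
            exact le_self_pow₀ (by norm_num) (by omega)
        _ = (2 * (Q + 1)) ^ (3 * n) := (mul_pow _ _ _).symm
        _ ≤ (4 * Q) ^ (3 * n) := by
            exact Nat.pow_le_pow_left (by omega) _
    have h3 : X ≤ (4 * Q) ^ (3 * n * (4 * n + 1)) := by
      rw [pow_mul]
      exact hX.trans (Nat.pow_le_pow_left h2 _)
    exact_mod_cast h3
  have h2 : (X : ℝ) ^ ε ≤ 2 * √Q := by
    calc (X : ℝ) ^ ε ≤ ((4 * Q : ℝ) ^ (3 * n * (4 * n + 1))) ^ ε := by gcongr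
      _ = √(4 * Q) := by
        rw [← Real.rpow_natCast, ← Real.rpow_mul (by positivity), Real.sqrt_eq_rpow, hε]
        congr 1
        push_cast
        field_simp
        norm_num
      _ = 2 * √Q := by
        rw [Real.sqrt_mul (by norm_num), show (4 : ℝ) = 2 ^ 2 by norm_num,
          Real.sqrt_sq (by norm_num)]
  have h3 : (Q : ℝ) ^ (1 + ε) * X ≤ 2 * C * (900 * (X * X ^ ε)) := by
    calc (Q : ℝ) ^ (1 + ε) * X ≤ (Q : ℝ) ^ (1 + ε) * (2 * (C * (D : ℝ) ^ (1 + ε))) := by gcongr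
      _ = 2 * C * (Q * D) ^ (1 + ε) := by
        rw [Real.mul_rpow (by positivity) (by positivity)]; ring
      _ ≤ 2 * C * (30 * X) ^ (1 + ε) := by
        have h3 : (Q : ℝ) * D ≤ 30 * X := by exact_mod_cast hD
        exact mul_le_mul_of_nonneg_left (Real.rpow_le_rpow (by positivity) h3 (by positivity))
          (by positivity)
      _ = 2 * C * (30 ^ (1 + ε) * (X * X ^ ε)) := by
        rw [Real.mul_rpow (by positivity) (by positivity), Real.rpow_add hX', Real.rpow_one]
      _ ≤ 2 * C * (900 * (X * X ^ ε)) := by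
        gcongr
        calc (30 : ℝ) ^ (1 + ε) ≤ 30 ^ (2 : ℝ) :=
              Real.rpow_le_rpow_of_exponent_le (by norm_num) (by linarith)
          _ = 900 := by norm_num
  have h4 : (Q : ℝ) ≤ (Q : ℝ) ^ (1 + ε) := by
    conv_lhs => rw [← Real.rpow_one (Q : ℝ)]
    exact Real.rpow_le_rpow_of_exponent_le hQ' (by linarith)
  have h5 : (Q : ℝ) * X ≤ (3600 * C * √Q) * X := by
    calc (Q : ℝ) * X ≤ (Q : ℝ) ^ (1 + ε) * X := by gcongr
      _ ≤ 2 * C * (900 * (X * X ^ ε)) := h3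
      _ ≤ 2 * C * (900 * (X * (2 * √Q))) := by gcongr
      _ = (3600 * C * √Q) * X := by ring
  have h6 : √Q * √Q ≤ 3600 * C * √Q := by
    rw [Real.mul_self_sqrt (by positivity)]
    exact le_of_mul_le_mul_right h5 hX'
  have h7 : √Q ≤ 3600 * C := le_of_mul_le_mul_right h6 (by positivity)
  calc (Q : ℝ) = √Q ^ 2 := (Real.sq_sqrt (by positivity)).symm
    _ ≤ (3600 * C) ^ 2 := by gcongr

theorem abs_sum_erase_le {s : Type*} [Fintype s] [DecidableEq s] {j : s} {B E : ℕ} (hB : 1 ≤ B)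
    {σ : s → ℕ} (hσ : ∀ i ≠ j, σ i < Fintype.card s) {x : s → ℤ} (hx : ∀ i, |x i| ≤ E) :
    |∑ l ∈ Finset.univ.erase j, ((B ^ σ l : ℕ) : ℤ) * x l| ≤
      Fintype.card s * (B ^ (Fintype.card s - 1) * E) := by
  refine (Finset.abs_sum_le_sum_abs _ _).trans ?_
  calc ∑ l ∈ Finset.univ.erase j, |((B ^ σ l : ℕ) : ℤ) * x l|
      ≤ ∑ l ∈ Finset.univ.erase j, ((B : ℤ) ^ (Fintype.card s - 1) * E) := by
        refine Finset.sum_le_sum fun l hl => ?_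
        rw [abs_mul, Nat.abs_cast]
        have h1 := hσ l (Finset.ne_of_mem_erase hl)
        have h2 : B ^ σ l ≤ B ^ (Fintype.card s - 1) := Nat.pow_le_pow_right hB (by omega)
        exact mul_le_mul (by exact_mod_cast h2) (hx l) (abs_nonneg _) (by positivity)
    _ ≤ _ := by
        rw [Finset.sum_const, nsmul_eq_mul]
        gcongr
        exact Finset.card_le_univ _

theorem le_two_mul_supNatAbs {ι s : Type*} [Fintype ι] [Fintype s] {e : s → ι → ℤ} {B : ℕ} {j : s}
    (he : ∀ l, supNatAbs (e l) ≤ supNatAbs (e j)) (hj : 0 < supNatAbs (e j)) {σ : s → ℕ}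
    (hσj : σ j = Fintype.card s) (hσ : ∀ i ≠ j, σ i < Fintype.card s)
    (hB : 2 * Fintype.card s ≤ B) :
    B ^ Fintype.card s * supNatAbs (e j) ≤
      2 * supNatAbs fun i => ∑ l, ((B ^ σ l : ℕ) : ℤ) * e l i := by
  classical
  obtain ⟨i, hi⟩ := exists_abs_eq_supNatAbs hj
  set E := supNatAbs (e j)
  have hs : 1 ≤ Fintype.card s := Fintype.card_pos_iff.2 ⟨j⟩
  have h1 := abs_le_supNatAbs (fun i => ∑ l, ((B ^ σ l : ℕ) : ℤ) * e l i) i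
  rw [← Finset.add_sum_erase _ _ (Finset.mem_univ j), hσj] at h1
  have h2 := abs_sum_erase_le (j := j) (by omega : 1 ≤ B) hσ (x := fun l => e l i) (E := E)
    fun l => (abs_le_supNatAbs (e l) i).trans (by exact_mod_cast he l)
  have h3 := abs_sub_abs_le_abs_add (((B ^ Fintype.card s : ℕ) : ℤ) * e j i)
    (∑ l ∈ Finset.univ.erase j, ((B ^ σ l : ℕ) : ℤ) * e l i)
  rw [abs_mul, hi, Nat.abs_cast] at h3
  have h4 : (2 * Fintype.card s : ℤ) * (B ^ (Fintype.card s - 1) * E) ≤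
      B ^ Fintype.card s * E := by
    have h5 : (B : ℤ) ^ Fintype.card s = B * B ^ (Fintype.card s - 1) := by
      rw [← pow_succ', Nat.sub_add_cancel hs]
    rw [h5, mul_assoc (B : ℤ)]
    gcongr
    exact_mod_cast hB
  have h6 : ((B ^ Fintype.card s * E : ℕ) : ℤ) ≤
      2 * supNatAbs fun i => ∑ l, ((B ^ σ l : ℕ) : ℤ) * e l i := by
    push_cast at h1 h2 h3 h4 ⊢
    linarith
  exact_mod_cast h6

theorem mul_supNatAbs_sub_le {ι s : Type*} [Fintype ι] [Fintype s] {e : s → ι → ℤ} {B : ℕ} {j : s}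
    (he : ∀ l, supNatAbs (e l) ≤ supNatAbs (e j)) {σ : s → ℕ}
    (hσj : σ j = Fintype.card s) (hσ : ∀ i ≠ j, σ i < Fintype.card s) {Q t : ℕ} (ht : 1 ≤ t)
    (hB1 : 1 ≤ B) (hB : Q * t * Fintype.card s ≤ B) (hQt : Q * t ^ 2 ≤ supNatAbs (e j))
    {c : ι → ℤ}
    (hc : ∀ i, Q * |supNatAbs (e j) * c i - t * e j i| < supNatAbs (e j)) (hct : supNatAbs c = t) :
    Q * (t * supNatAbs fun i => ∑ l, ((B ^ σ l : ℕ) : ℤ) * e l i -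
      ((supNatAbs (e j) * B ^ Fintype.card s / t : ℕ) : ℤ) * c i) ≤
      3 * (B ^ Fintype.card s * supNatAbs (e j)) := by
  classical
  set E := supNatAbs (e j) with hE
  set k := Fintype.card s with hk
  set q := E * B ^ k / t with hq
  set b : ι → ℤ := fun i => ∑ l, ((B ^ σ l : ℕ) : ℤ) * e l i - (q : ℤ) * c i with hb
  rcases Nat.eq_zero_or_pos (supNatAbs b) with h0 | h0
  · rw [h0]
    simp
  obtain ⟨i, hi⟩ := exists_abs_eq_supNatAbs h0
  have hs : 1 ≤ k := Fintype.card_pos_iff.2 ⟨j⟩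
  have h2 := abs_sum_erase_le (j := j) hB1 hσ (x := fun l => e l i) (E := E)
    fun l => (abs_le_supNatAbs (e l) i).trans (by exact_mod_cast he l)
  set T := ∑ l ∈ Finset.univ.erase j, ((B ^ σ l : ℕ) : ℤ) * e l i with hT
  have hbi : (t : ℤ) * b i = t * T + -((B : ℤ) ^ k * (E * c i - t * e j i)) +
      (E * B ^ k - q * t) * c i := by
    simp only [hb]
    rw [← Finset.add_sum_erase _ _ (Finset.mem_univ j), hσj, ← hT]
    push_cast
    ring
  have hq1 : q * t ≤ E * B ^ k := Nat.div_mul_le_self _ _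
  have hq2 : E * B ^ k < (q + 1) * t := by
    rw [mul_comm (q + 1)]
    exact Nat.lt_mul_div_succ _ ht
  have h3 : |((E : ℤ) * B ^ k - q * t) * c i| ≤ t * t := by
    rw [abs_mul]
    refine mul_le_mul ?_ ((abs_le_supNatAbs c i).trans (by rw [hct])) (abs_nonneg _)
      (by positivity)
    have hq1' : (q : ℤ) * t ≤ E * B ^ k := by exact_mod_cast hq1
    have hq2' : (E : ℤ) * B ^ k < (q + 1) * t := by exact_mod_cast hq2
    rw [abs_le]
    constructor <;> nlinarith
  have h4 : (Q : ℤ) * |(B : ℤ) ^ k * (E * c i - t * e j i)| ≤ B ^ k * E := by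
    rw [abs_mul, abs_of_nonneg (by positivity : (0 : ℤ) ≤ (B : ℤ) ^ k), mul_left_comm]
    have := (hc i).le
    gcongr
  have h5 : (Q : ℤ) * |(t : ℤ) * T| ≤ B ^ k * E := by
    rw [abs_mul, Nat.abs_cast]
    have h6 : (B : ℤ) ^ k = B * B ^ (k - 1) := by rw [← pow_succ', Nat.sub_add_cancel hs]
    calc (Q : ℤ) * (t * |T|) ≤ Q * (t * (k * (B ^ (k - 1) * E))) := by gcongr
      _ = ((Q * t * k : ℕ) : ℤ) * (B ^ (k - 1) * E) := by push_cast; ring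
      _ ≤ B * (B ^ (k - 1) * E) := by
        gcongr
      _ = B ^ k * E := by rw [h6]; ring
  have h7 : (Q : ℤ) * (t * t) ≤ B ^ k * E := by
    calc (Q : ℤ) * (t * t) = ((Q * t ^ 2 : ℕ) : ℤ) := by push_cast; ring
      _ ≤ ((B ^ k * E : ℕ) : ℤ) := by
        refine Int.ofNat_le.2 (hQt.trans ?_)
        exact Nat.le_mul_of_pos_left _ (by positivity)
      _ = B ^ k * E := by push_cast; ring
  have h8 : (Q : ℤ) * (t * |b i|) ≤ 3 * (B ^ k * E) := by
    have h9 : (t : ℤ) * |b i| = |(t : ℤ) * b i| := by rw [abs_mul, Nat.abs_cast]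
    rw [h9, hbi]
    have h10 := abs_add_three ((t : ℤ) * T) (-((B : ℤ) ^ k * (E * c i - t * e j i)))
      ((E * B ^ k - q * t) * c i)
    rw [abs_neg] at h10
    calc _ ≤ (Q : ℤ) * (|(t : ℤ) * T| + |(B : ℤ) ^ k * (E * c i - t * e j i)| +
          |((E : ℤ) * B ^ k - q * t) * c i|) := by gcongr
      _ ≤ (Q : ℤ) * (|(t : ℤ) * T| + |(B : ℤ) ^ k * (E * c i - t * e j i)| + t * t) := by gcongr
      _ ≤ _ := by rw [mul_add, mul_add]; linarith
  rw [hi] at h8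
  exact_mod_cast h8

end

section

theorem exists_forall_ge_lt_pow_four (k L M H : ℕ) : ∃ A : ℕ, ∀ E ≥ A,
    2 * E * k + L ^ 3 * (2 * E * k + M * (2 * E * k) + 1) ^ 2 < E ^ 4 ∧
    (2 * (2 * E * (k + 1)) + 1) ^ 2 < E ^ 4 ∧ H * E < E ^ 4 ∧ 2 * k ≤ E ^ 4 ∧ k ≤ E ∧ 1 ≤ E := by
  refine ⟨2 * k + L ^ 3 * (2 * k + M * (2 * k) + 1) ^ 2 + (2 * (2 * (k + 1)) + 1) ^ 2 + H + 1,
    fun E hE => ?_⟩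
  have h1 : 1 ≤ E := by omega
  have key : ∀ a, a < E → a * E ^ 2 < E ^ 4 := fun a ha => by
    calc a * E ^ 2 < E * E ^ 2 := by gcongr
      _ = E ^ 3 := by ring
      _ ≤ E ^ 4 := Nat.pow_le_pow_right h1 (by norm_num)
  have h2 : ∀ a : ℕ, a * E + 1 ≤ (a + 1) * E := fun a => by rw [add_mul]; omega
  have h3 : E ≤ E ^ 2 := le_self_pow₀ h1 (by norm_num)
  have h4 : E ≤ E ^ 4 := le_self_pow₀ h1 (by norm_num)
  refine ⟨lt_of_le_of_lt ?_ (key (2 * k + L ^ 3 * (2 * k + M * (2 * k) + 1) ^ 2) (by omega)),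
    lt_of_le_of_lt ?_ (key ((2 * (2 * (k + 1)) + 1) ^ 2) (by omega)),
    lt_of_le_of_lt (Nat.mul_le_mul_left _ h3) (key H (by omega)), by omega, by omega, h1⟩
  · rw [add_mul, mul_assoc (L ^ 3), ← mul_pow]
    refine Nat.add_le_add ?_ (Nat.mul_le_mul_left _ (Nat.pow_le_pow_left ?_ 2))
    · calc 2 * E * k = 2 * k * E := by ring
        _ ≤ 2 * k * E ^ 2 := Nat.mul_le_mul_left _ h3
    · refine le_trans (le_of_eq ?_) (h2 _)
      ring
  · rw [← mul_pow]
    refine Nat.pow_le_pow_left (le_trans (le_of_eq ?_) (h2 _)) 2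
    ring

variable {ι : Type} [Fintype ι] {r : Setoid ι}

theorem exists_finset_isOrth {s : Type*} [Fintype s] (hs : Fintype.card s < r.nonrep.card)
    (A : ℕ) : ∃ ℋ : Finset (ι → ℤ), (∀ c ∈ ℋ, c ≠ 0 ∧ IsOrth r c) ∧
      ∀ e : s → ι → ℤ, (∀ j, ∀ i ∉ r.nonrep, e j i = 0) →
        (∀ c ∈ ℋ, ∃ j, ∑ i, c i * e j i ≠ 0) → ∃ j, A < supNatAbs (e j) := by
  classical
  choose! f hf using fun (e : s → ι → ℤ) (he : ∀ j, ∀ i ∉ r.nonrep, e j i = 0) =>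
    exists_isOrth_forall_sum_eq_zero hs e he
  refine ⟨((Fintype.piFinset fun _ : s => Fintype.piFinset fun _ : ι =>
    Finset.Icc (-A : ℤ) A).filter fun e => ∀ j, ∀ i ∉ r.nonrep, e j i = 0).image f,
    fun c hc => ?_, fun e he h => ?_⟩
  · obtain ⟨e, he, rfl⟩ := Finset.mem_image.1 hc
    have := hf e (Finset.mem_filter.1 he).2
    exact ⟨this.1, this.2.1⟩
  · by_contra! hA
    have hmem : e ∈ Fintype.piFinset fun _ : s => Fintype.piFinset fun _ : ι =>
        Finset.Icc (-A : ℤ) A := by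
      simp only [Fintype.mem_piFinset, Finset.mem_Icc]
      exact fun j i => abs_le.1 ((abs_le_supNatAbs (e j) i).trans (by exact_mod_cast hA j))
    obtain ⟨j, hj⟩ := h (f e) (Finset.mem_image_of_mem f (Finset.mem_filter.2 ⟨hmem, he⟩))
    exact hj ((hf e he).2.2 j)

/-- There are `card s` independent integral exponent vectors, outside any given finite set of
hyperplanes, whose span contains the logarithms of a point of large transcendence degree
satisfying the relations. -/
def HasBadTuple (K : Type*) [Field K] [Algebra K ℂ] (γ : ι → K) (r : Setoid ι) (M : ℕ)
    (s : Type*) [Fintype s] : Prop :=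
  ∀ ℋ : Finset (ι → ℤ), (∀ c ∈ ℋ, c ≠ 0 ∧ IsOrth r c) → ∃ e : s → ι → ℤ,
    (∀ j, ∀ i ∉ r.nonrep, e j i = 0) ∧ LinearIndependent ℂ (fun j i => (e j i : ℂ)) ∧
    (∃ z : s → ℂ, IsBadLog K γ r M (Fintype.card s) fun i => ∑ j, z j * e j i) ∧
    ∀ c ∈ ℋ, ∃ j, ∑ i, c i * e j i ≠ 0

theorem HasBadTuple.exists_minimal {K : Type*} [Field K] [Algebra K ℂ] {γ : ι → K} {M : ℕ}
    {s : Type*} [Fintype s] (h : HasBadTuple K γ r M s) {ℋ : Finset (ι → ℤ)}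
    (hℋ : ∀ c ∈ ℋ, c ≠ 0 ∧ IsOrth r c) : ∃ e : s → ι → ℤ,
    (∀ j, ∀ i ∉ r.nonrep, e j i = 0) ∧ LinearIndependent ℂ (fun j i => (e j i : ℂ)) ∧
    (∃ z : s → ℂ, IsBadLog K γ r M (Fintype.card s) fun i => ∑ j, z j * e j i) ∧
    (∀ c ∈ ℋ, ∃ j, ∑ i, c i * e j i ≠ 0) ∧
    ∀ e' : s → ι → ℤ, (∀ j, ∀ i ∉ r.nonrep, e' j i = 0) →
      LinearIndependent ℂ (fun j i => (e' j i : ℂ)) →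
      Submodule.span ℂ (Set.range fun j i => (e j i : ℂ)) ≤
        Submodule.span ℂ (Set.range fun j i => (e' j i : ℂ)) →
      ∑ j, supNatAbs (e j) ≤ ∑ j, supNatAbs (e' j) := by
  classical
  obtain ⟨e₀, he₀, hli₀, ⟨z, hz⟩, hc₀⟩ := h ℋ hℋ
  let p : ℕ → Prop := fun n => ∃ e : s → ι → ℤ, (∀ j, ∀ i ∉ r.nonrep, e j i = 0) ∧
    LinearIndependent ℂ (fun j i => (e j i : ℂ)) ∧
    Submodule.span ℂ (Set.range fun j i => (e₀ j i : ℂ)) ≤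
      Submodule.span ℂ (Set.range fun j i => (e j i : ℂ)) ∧ ∑ j, supNatAbs (e j) = n
  have hp : ∃ n, p n := ⟨_, e₀, he₀, hli₀, le_rfl, rfl⟩
  obtain ⟨e, he, hli, hspan, hn⟩ := Nat.find_spec hp
  refine ⟨e, he, hli, ?_, fun c hc => ?_, fun e' he' hli' hspan' => ?_⟩
  · have hy : (fun i => ∑ j, z j * (e₀ j i : ℂ)) ∈
        Submodule.span ℂ (Set.range fun j i => (e j i : ℂ)) := by
      refine hspan (Submodule.mem_span_range_iff_exists_fun ℂ |>.2 ⟨z, ?_⟩)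
      ext i
      simp
    obtain ⟨z', hz'⟩ := (Submodule.mem_span_range_iff_exists_fun ℂ).1 hy
    refine ⟨z', ?_⟩
    convert hz using 1
    rw [← hz']
    ext i
    simp
  · by_contra! h0
    obtain ⟨j, hj⟩ := hc₀ c hc
    let φ : (ι → ℂ) →ₗ[ℂ] ℂ := ∑ i, (c i : ℂ) • LinearMap.proj i
    have hφ : ∀ x : ι → ℂ, φ x = ∑ i, (c i : ℂ) * x i := fun x => by simp [φ]
    have h1 : Submodule.span ℂ (Set.range fun j i => (e j i : ℂ)) ≤ LinearMap.ker φ := by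
      rw [Submodule.span_le]
      rintro _ ⟨l, rfl⟩
      rw [SetLike.mem_coe, LinearMap.mem_ker, hφ]
      have h2 := h0 l
      beta_reduce
      exact_mod_cast h2
    have h2 := h1 (hspan (Submodule.subset_span ⟨j, rfl⟩))
    rw [LinearMap.mem_ker, hφ] at h2
    beta_reduce at h2
    exact hj (by exact_mod_cast h2)
  · rw [hn]
    exact Nat.find_min' hp ⟨e', he', hli', hspan.trans hspan', rfl⟩

theorem HasBadTuple.option {K : IntermediateField ℚ ℂ} [FiniteDimensional ℚ K] [Nonempty ι]
    {γ : ι → K} (hγ : ∀ i, γ i ≠ 0) {M : ℕ} (hM1 : 1 ≤ M)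
    (hM : ∀ ζ : ℂ, IsOfFinOrder ζ → ∀ B : Finset ι, B.Nonempty → ∀ a : ι → ℤ,
      ∑ i ∈ B, algebraMap K ℂ (γ i) * ζ ^ a i = 0 →
        ∃ i ∈ B, ∃ j ∈ B, i ≠ j ∧ (ζ ^ (a i - a j)) ^ M = 1)
    {ℋ : Finset (ι → ℤ)} {C ε : ℝ} (hctrl : IsControlled K γ r ℋ C ε) (hC : 0 < C)
    (hε : ε = 1 / (6 * r.nonrep.card * (4 * r.nonrep.card + 1)))
    (hℋ : ∀ c ∈ ℋ, c ≠ 0 ∧ IsOrth r c) {s : Type} [Fintype s] [Nonempty s]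
    (hs : Fintype.card s < r.nonrep.card) (h : HasBadTuple K γ r M s) :
    HasBadTuple K γ r M (Option s) := by
  classical
  intro ℋ₁ hℋ₁
  set n := r.nonrep.card with hn
  have hn1 : 1 ≤ n := by omega
  set H : ℕ := ∑ c ∈ ℋ, ∑ i, (c i).natAbs with hH
  obtain ⟨Q₀, hQ₀⟩ := exists_nat_gt ((3600 * C) ^ 2)
  obtain ⟨A, hA⟩ := exists_forall_ge_lt_pow_four (Fintype.card s) (Fintype.card ι) M H
  obtain ⟨ℋ₂, hℋ₂, hshort⟩ := exists_finset_isOrth hs (A + 2 * (Q₀ + 2) ^ (3 * n))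
  obtain ⟨e, he, hli, ⟨z, hz⟩, hc, hmin⟩ := h.exists_minimal (ℋ := ℋ ∪ ℋ₁ ∪ ℋ₂) fun c hc => by
    rcases Finset.mem_union.1 hc with hc | hc
    · rcases Finset.mem_union.1 hc with hc | hc
      · exact hℋ c hc
      · exact hℋ₁ c hc
    · exact hℋ₂ c hc
  have hcℋ : ∀ c ∈ ℋ, ∃ j, ∑ i, c i * e j i ≠ 0 := fun c hc' =>
    hc c (Finset.mem_union_left _ (Finset.mem_union_left _ hc'))
  have hcℋ₁ : ∀ c ∈ ℋ₁, ∃ j, ∑ i, c i * e j i ≠ 0 := fun c hc' =>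
    hc c (Finset.mem_union_left _ (Finset.mem_union_right _ hc'))
  obtain ⟨j₁, hj₁⟩ := hshort e he fun c hc' => hc c (Finset.mem_union_right _ hc')
  obtain ⟨j, hj⟩ := Finite.exists_max fun j => supNatAbs (e j)
  set E := supNatAbs (e j) with hE
  have hEA : A + 2 * (Q₀ + 2) ^ (3 * n) < E := hj₁.trans_le (hj j₁)
  obtain ⟨hE1, hE2, hE3, hE4, hE5, hE6⟩ := hA E (by omega)
  set B := E ^ 4 with hB
  have hB1 : 1 ≤ B := by omega
  have hB' : ∀ c ∈ ℋ, ∀ j, |∑ i, c i * e j i| < B := fun c hc' l => by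
    have h1 : |∑ i, c i * e l i| ≤ H * E := by
      calc |∑ i, c i * e l i| ≤ ∑ i, |c i * e l i| := Finset.abs_sum_le_sum_abs _ _
        _ ≤ ∑ i, ((c i).natAbs : ℤ) * E := by
          refine Finset.sum_le_sum fun i _ => ?_
          rw [abs_mul, Int.abs_eq_natAbs (c i)]
          have h2 := abs_le_supNatAbs (e l) i
          have h3 : (supNatAbs (e l) : ℤ) ≤ E := by exact_mod_cast hj l
          gcongr
          exact h2.trans h3
        _ = ((∑ i, (c i).natAbs : ℕ) : ℤ) * E := by push_cast; rw [Finset.sum_mul]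
        _ ≤ H * E := by
          gcongr
          exact Finset.single_le_sum (f := fun c : ι → ℤ => ∑ i, (c i).natAbs)
            (fun _ _ => Nat.zero_le _) hc'
    exact h1.trans_lt (by exact_mod_cast hE3)
  obtain ⟨W, P, hW, hP, hPW, hPQ, hXP⟩ := hz.exists_irreducible hγ
  have hdeg := hctrl.degreeOf_ne_zero hγ hM he hcℋ hj hW hP hPW hPQ hXP hE1 hB' (j := j) hE6
  obtain ⟨σ, hσ, hσj, hσ'⟩ := exists_injective_top j le_rfl
  obtain ⟨τ, hτ, hnt, hτP⟩ := exists_root_pow hγ hM hj hW hP hPW hPQ hdeg (hXP j) hσ hσj.ge hσ' hE1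
  have hm : ∀ x : s → ℤ, x ≠ 0 → (∀ i, |x i| < B) →
      ∑ i, x i * ((B ^ σ i : ℕ) : ℤ) ≠ 0 := fun x hx hxB => by
    push_cast
    exact sum_mul_pow_ne_zero hσ hx (by exact_mod_cast hxB)
  obtain ⟨halg, hsep, hle⟩ := hctrl.supNatAbs_le_of_aeval_eq_zero hγ he hcℋ hm hB' hW hPW hτ hnt hτP
  have hX := le_two_mul_supNatAbs hj hE6 hσj hσ' hE4
  set Q := Nat.findGreatest (fun Q => 2 * Q ^ (3 * n) ≤ E) E with hQ
  have hQge : Q₀ + 2 ≤ Q := by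
    refine Nat.le_findGreatest ?_ (by omega)
    have : Q₀ + 2 ≤ (Q₀ + 2) ^ (3 * n) := le_self_pow₀ (by omega) (by omega)
    omega
  have hQE : 2 * Q ^ (3 * n) ≤ E :=
    Nat.findGreatest_spec (P := fun Q => 2 * Q ^ (3 * n) ≤ E) (m := Q₀ + 2) (n := E) (by
      have : Q₀ + 2 ≤ (Q₀ + 2) ^ (3 * n) := le_self_pow₀ (by omega) (by omega)
      omega) (by omega)
  have hQlt : E < 2 * (Q + 1) ^ (3 * n) := by
    by_contra! h1
    have h2 : Q + 1 ≤ (Q + 1) ^ (3 * n) := le_self_pow₀ (by omega) (by omega)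
    have := Nat.le_findGreatest (P := fun Q => 2 * Q ^ (3 * n) ≤ E) (n := E) (by omega) h1
    omega
  obtain ⟨t, c, ht1, htQ, hcJ, hct, hcn, hcspan⟩ :=
    exists_approximation_notMem_span he hli hmin j (by omega) hn1 hQE
  have hpow : ∀ l ≤ 3 * n, Q ^ l ≤ E := fun l hl => by
    have := Nat.pow_le_pow_right (show 0 < Q by omega) hl
    omega
  have hQt : Q * t ^ 2 ≤ E := by
    calc Q * t ^ 2 ≤ Q * (Q ^ n) ^ 2 := by gcongr
      _ = Q ^ (2 * n + 1) := by ring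
      _ ≤ E := hpow _ (by omega)
  have hQtB : Q * t * Fintype.card s ≤ B := by
    calc Q * t * Fintype.card s ≤ Q * Q ^ n * E := by gcongr
      _ = Q ^ (n + 1) * E := by ring
      _ ≤ E * E := by gcongr; exact hpow _ (by omega)
      _ = E ^ 2 := by ring
      _ ≤ E ^ 4 := Nat.pow_le_pow_right hE6 (by norm_num)
  have hnb := mul_supNatAbs_sub_le hj hσj hσ' ht1 hB1 hQtB hQt hct hcn
  set nb := supNatAbs fun i => ∑ l, ((B ^ σ l : ℕ) : ℤ) * e l i -
      ((E * B ^ Fintype.card s / t : ℕ) : ℤ) * c i with hnb'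
  have htE : t ≤ E := htQ.trans (hpow _ (by omega))
  have hli' : LinearIndependent ℂ fun (o : Option s) i => ((o.elim (-c) e : ι → ℤ) i : ℂ) := by
    rw [linearIndependent_option]
    refine ⟨hli, fun hmem => hcspan ?_⟩
    rw [← Submodule.neg_mem_iff]
    have hneg : (-fun i => (c i : ℂ)) = fun i => ((-c) i : ℂ) :=
      funext fun i => (Int.cast_neg (c i)).symm
    rw [hneg]
    exact hmem
  rcases natDegree_minpoly_le_or_exists_isBadLog hγ hM1 hj hW hτ hnt (m := fun l => B ^ σ l)
    (fun w hw => by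
      obtain ⟨x, hx⟩ := hPW w hw
      rw [hx, map_mul, hτP, zero_mul]) hsep hm hE2 (hcn.le.trans htE) hli'
    (q := E * B ^ Fintype.card s / t) (nb := nb)
    (fun i => abs_le_supNatAbs (fun i => ∑ l, ((B ^ σ l : ℕ) : ℤ) * e l i -
      ((E * B ^ Fintype.card s / t : ℕ) : ℤ) * c i) i) with hD | ⟨z', hz'⟩
  · exfalso
    rw [hcn] at hD
    have hD' : Q * (minpoly K τ).natDegree ≤ 30 * (B ^ Fintype.card s * E) := by
      calc Q * (minpoly K τ).natDegree ≤ Q * ((4 * t + 1) * (2 * nb)) := by gcongr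
        _ ≤ Q * ((5 * t) * (2 * nb)) := by gcongr; omega
        _ = 10 * (Q * (t * nb)) := by ring
        _ ≤ 10 * (3 * (B ^ Fintype.card s * E)) := by gcongr
        _ = _ := by ring
    have hXE : B ^ Fintype.card s * E ≤ E ^ (4 * n + 1) := by
      rw [hB, ← pow_mul, ← pow_succ]
      exact Nat.pow_le_pow_right hE6 (by omega)
    have := le_sq_of_mul_degree_le hn1 hC (by omega) hε hQlt (by positivity) hXE hD' (by
      have h1 : ((B ^ Fintype.card s * E : ℕ) : ℝ) ≤
          2 * (supNatAbs fun i => ∑ l, ((B ^ σ l : ℕ) : ℤ) * e l i : ℕ) := by exact_mod_cast hX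
      linarith)
    have h2 : (Q₀ : ℝ) ≤ Q := by exact_mod_cast (by omega : Q₀ ≤ Q)
    linarith
  · refine ⟨fun o => o.elim (-c) e, ?_, hli', ⟨z', hz'⟩, fun c' hc' => ?_⟩
    · rintro (_ | l) i hi
      · simp [hcJ i hi]
      · exact he l i hi
    · obtain ⟨l, hl⟩ := hcℋ₁ c' hc'
      exact ⟨some l, hl⟩

end

section
variable {ι : Type} [Fintype ι] {r : Setoid ι}

theorem not_isBadLog_card_nonrep {K : Type*} [Field K] [Algebra K ℂ] [Nonempty ι] {γ : ι → K}
    (hγ : ∀ i, γ i ≠ 0) {M : ℕ} {y : ι → ℂ} (hy : ∀ i ∉ r.nonrep, y i = 0) :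
    ¬ IsBadLog K γ r M r.nonrep.card y := by
  classical
  rintro ⟨⟨W, hW, hrel⟩, -, htr⟩
  have key : ∀ w ∈ W, (∀ i ∈ r.nonrep, w i = 0) → w = 0 := by
    intro w hw hw0
    by_contra hne
    obtain ⟨i, hi⟩ := Function.ne_iff.1 hne
    have h1 := hrel w hw
    rw [Finset.sum_eq_single i] at h1
    · simp [hγ, Complex.exp_ne_zero] at h1
      exact hi h1
    · intro j _ hji
      suffices w j = 0 by simp [this]
      by_contra hj
      have h2 := hW.rel_of_ne_zero w hw i j hi hj
      refine hji ?_
      rw [← Setoid.rep_eq_self (fun h => hj (hw0 j h)), ← Setoid.rep_eq h2,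
        Setoid.rep_eq_self (fun h => hi (hw0 i h))]
    · simp
  rcases r.nonrep.eq_empty_or_nonempty with h0 | ⟨i₀, hi₀⟩
  · obtain ⟨i⟩ := ‹Nonempty ι›
    have h1 := congrFun (key _ (hW.indicator_mem i) (by simp [h0])) i
    rw [Set.indicator_of_mem (show i ∈ {j | r i j} from r.refl i)] at h1
    exact one_ne_zero h1
  · have : Nonempty r.nonrep := ⟨⟨i₀, hi₀⟩⟩
    set x : ι → ℂ := fun i => Complex.exp (y i) with hx
    have hle : familyTrdeg K x ≤ familyTrdeg K (fun i : r.nonrep => x i) := by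
      refine familyTrdeg_le_of_isAlgebraic fun i => ?_
      by_cases hi : i ∈ r.nonrep
      · exact isAlgebraic_adjoin_range (fun i : r.nonrep => x i) ⟨i, hi⟩
      · have : x i = 1 := by simp [hx, hy i hi]
        rw [this]
        exact isAlgebraic_one
    obtain ⟨j, hj⟩ := exists_algebraicIndependent_ne (K := K) (u := fun i : r.nonrep => x i) (by
      rw [Fintype.card_coe]
      exact htr.trans (add_le_add_left hle 1))
    obtain ⟨w, hw, hwne, hwj⟩ := hW.exists_apply_eq_zero j
    refine hwne (key w hw fun i hi => ?_)
    by_cases hij : i = j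
    · rw [hij, hwj]
    let X' : ι → MvPolynomial {i : r.nonrep // i ≠ j} K := fun i =>
      if h : ∃ hi : i ∈ r.nonrep, (⟨i, hi⟩ : r.nonrep) ≠ j then
        MvPolynomial.X ⟨⟨i, h.1⟩, h.2⟩ else 1
    let Q : MvPolynomial {i : r.nonrep // i ≠ j} K :=
      ∑ i, MvPolynomial.C ((w i : K) * γ i) * X' i
    have hQ : Q = 0 := by
      refine (injective_iff_map_eq_zero _).1 hj Q ?_
      rw [← hrel w hw, map_sum]
      refine Finset.sum_congr rfl fun l _ => ?_
      rw [map_mul, MvPolynomial.aeval_C, map_mul, map_intCast]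
      by_cases hl : ∃ hi : l ∈ r.nonrep, (⟨l, hi⟩ : r.nonrep) ≠ j
      · simp only [X', dif_pos hl, MvPolynomial.aeval_X, hx]
      · simp only [X', dif_neg hl, map_one]
        by_cases hlJ : l ∈ r.nonrep
        · have : l = j := by
            by_contra h
            exact hl ⟨hlJ, fun h' => h (congrArg Subtype.val h')⟩
          simp [this, hwj]
        · simp [hx, hy l hlJ]
    have hi' : ∃ hi : i ∈ r.nonrep, (⟨i, hi⟩ : r.nonrep) ≠ j :=
      ⟨hi, fun h' => hij (congrArg Subtype.val h')⟩
    have h1 := congrArg (MvPolynomial.coeff (Finsupp.single ⟨⟨i, hi'.1⟩, hi'.2⟩ 1)) hQ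
    simp only [Q, MvPolynomial.coeff_sum, MvPolynomial.coeff_C_mul, MvPolynomial.coeff_zero] at h1
    rw [Finset.sum_eq_single i] at h1
    · simp only [X', dif_pos hi', MvPolynomial.coeff_X, if_true, mul_one] at h1
      have : CharZero K := (algebraMap K ℂ).charZero
      exact Int.cast_eq_zero.1 ((mul_eq_zero.1 h1).resolve_right (hγ i))
    · intro l _ hli
      by_cases hl : ∃ hi : l ∈ r.nonrep, (⟨l, hi⟩ : r.nonrep) ≠ j
      · simp only [X', dif_pos hl]
        rw [MvPolynomial.coeff_X, if_neg, mul_zero]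
        intro h
        have := Finsupp.single_left_injective one_ne_zero h
        exact hli (congrArg (fun x : {i : r.nonrep // i ≠ j} => ((x : r.nonrep) : ι)) this)
      · simp only [X', dif_neg hl]
        rw [MvPolynomial.coeff_one, if_neg, mul_zero]
        intro h
        have := DFunLike.congr_fun h ⟨⟨i, hi'.1⟩, hi'.2⟩
        simp at this
    · simp

theorem IsOrth.sum_sub_rep {c : ι → ℤ} (hc : IsOrth r c) (a : ι → ℤ) :
    ∑ i, c i * (a i - a (r.rep i)) = ∑ i, c i * a i := by
  simp only [mul_sub, Finset.sum_sub_distrib]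
  rw [hc (fun i => a (r.rep i)) fun i j h => by rw [Setoid.rep_eq h], sub_zero]

theorem exists_finset_isOrth_separating (r : Setoid ι) : ∃ ℋ : Finset (ι → ℤ),
    (∀ c ∈ ℋ, c ≠ 0 ∧ IsOrth r c) ∧
    ∀ i j, r i j → i ≠ j → ∃ c ∈ ℋ, ∀ a : ι → ℤ, ∑ l, c l * a l = a i - a j := by
  classical
  refine ⟨(Finset.univ.filter fun p : ι × ι => r p.1 p.2 ∧ p.1 ≠ p.2).image
    fun p => Pi.single p.1 1 - Pi.single p.2 1, fun c hc => ?_, fun i j hij hne =>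
    ⟨_, Finset.mem_image_of_mem _ (Finset.mem_filter.2 ⟨Finset.mem_univ (i, j), hij, hne⟩),
      sum_single_sub_single_mul i j⟩⟩
  obtain ⟨⟨i, j⟩, hp, rfl⟩ := Finset.mem_image.1 hc
  obtain ⟨-, hij, hne⟩ := Finset.mem_filter.1 hp
  refine ⟨fun h => ?_, isOrth_single_sub_single hij⟩
  have := congrFun h i
  simp [show i ≠ j from hne] at this

theorem hasBadTuple_unit {K : Type*} [Field K] [Algebra K ℂ] {γ : ι → K} {M : ℕ} (hM : 1 ≤ M)
    (hr : r.nonrep.Nonempty)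
    (h : ∀ ℋ : Finset (ι → ℤ), (∀ c ∈ ℋ, c ≠ 0 ∧ IsOrth r c) → ∃ (a : ι → ℤ) (τ : ℂ),
      τ ≠ 0 ∧ ¬ IsOfFinOrder τ ∧ IsRelated (fun i => algebraMap K ℂ (γ i)) r (fun i => τ ^ a i) ∧
      ∀ c ∈ ℋ, ∑ i, c i * a i ≠ 0) : HasBadTuple K γ r M Unit := by
  classical
  intro ℋ hℋ
  obtain ⟨ℋ', hℋ', hsep⟩ := exists_finset_isOrth_separating r
  obtain ⟨a, τ, hτ, hnt, hrel, ha⟩ := h (ℋ ∪ ℋ') fun c hc => by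
    rcases Finset.mem_union.1 hc with hc | hc
    · exact hℋ c hc
    · exact hℋ' c hc
  have hne : ∀ i j, r i j → i ≠ j → a i ≠ a j := fun i j hij hij' => by
    obtain ⟨c, hc, hca⟩ := hsep i j hij hij'
    rw [← sub_ne_zero, ← hca]
    exact ha c (Finset.mem_union_right _ hc)
  have hexp : ∀ i, Complex.exp (∑ _j : Unit, Complex.log τ * ((a i - a (r.rep i) : ℤ) : ℂ)) =
      τ ^ (a i - a (r.rep i)) := fun i => by
    rw [Fintype.sum_unique, mul_comm, Complex.exp_int_mul, Complex.exp_log hτ]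
  refine ⟨fun _ i => a i - a (r.rep i), fun _ i hi => by
    beta_reduce; rw [Setoid.rep_eq_self hi, sub_self],
    ?_, ⟨fun _ => Complex.log τ, ?_, fun i j hij hij' => ?_, ?_⟩, fun c hc => ⟨(), ?_⟩⟩
  · rw [linearIndependent_unique_iff]
    obtain ⟨i, hi⟩ := hr
    refine Function.ne_iff.2 ⟨i, ?_⟩
    have := hne i (r.rep i) (r.symm (r.rep_rel i)) fun h => r.rep_notMem_nonrep i (by rwa [← h])
    simpa [sub_eq_zero] using this
  · simp only [hexp]
    have := hrel.mul (c := fun i => τ ^ (-a (r.rep i))) fun i j hij => by rw [Setoid.rep_eq hij]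
    convert this using 2 with i
    rw [← zpow_add₀ hτ]
    congr 1
    ring
  · simp only [hexp]
    refine zpow_pow_ne_zpow_pow hτ hnt hM ?_
    rw [Setoid.rep_eq hij]
    exact fun h => hne i j hij hij' (by linarith)
  · simp
  · have := ha c (Finset.mem_union_left _ hc)
    rwa [← (hℋ c hc).2.sum_sub_rep a] at this

theorem finite_setoid (α : Type*) [Finite α] : Finite (Setoid α) :=
  Finite.of_injective (fun (r : Setoid α) (i j : α) => r i j) fun _ _ h =>
    Setoid.ext fun i j => iff_of_eq (congrFun (congrFun h i) j)

theorem exists_finset_isOrth_of_isRelated [Nonempty ι] {K : IntermediateField ℚ ℂ}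
    [FiniteDimensional ℚ K] {γ : ι → K} (hγ : ∀ i, γ i ≠ 0) (r : Setoid ι) :
    ∃ ℋ : Finset (ι → ℤ), (∀ c ∈ ℋ, c ≠ 0 ∧ IsOrth r c) ∧
      ∀ (a : ι → ℤ) (τ : ℂ), IsAlgebraic ℚ τ → τ ≠ 0 → ¬ IsOfFinOrder τ →
        IsRelated (fun i => algebraMap K ℂ (γ i)) r (fun i => τ ^ a i) →
        ∃ c ∈ ℋ, ∑ i, c i * a i = 0 := by
  classical
  have := finite_setoid ι
  induction r using WellFoundedLT.induction with
  | ind r ih =>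
  by_contra! hfail
  obtain ⟨M, hM1, hM⟩ := exists_bounded_order_of_sum_roots_of_unity_eq_zero
    (fun i => algebraMap K ℂ (γ i))
    (fun i => (Algebra.IsAlgebraic.isAlgebraic (R := ℚ) (γ i)).algebraMap)
    (fun i => by simpa using hγ i)
  choose! ℱ hℱ hℱ' using ih
  obtain ⟨ℋ₀, hℋ₀, hsep⟩ := exists_finset_isOrth_separating r
  have := Fintype.ofFinite (Setoid ι)
  set ℋ := ℋ₀ ∪ (Finset.univ.filter (· < r)).biUnion ℱ with hℋdef
  have hℋ : ∀ c ∈ ℋ, c ≠ 0 ∧ IsOrth r c := fun c hc => by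
    rcases Finset.mem_union.1 hc with hc | hc
    · exact hℋ₀ c hc
    · obtain ⟨r', hr', hc⟩ := Finset.mem_biUnion.1 hc
      have hr' := (Finset.mem_filter.1 hr').2
      exact ⟨(hℱ r' hr' c hc).1, (hℱ r' hr' c hc).2.mono hr'.le⟩
  have hr : r.nonrep.Nonempty := by
    rw [Finset.nonempty_iff_ne_empty]
    intro h0
    obtain ⟨a, τ, -, hτ, -, hrel, -⟩ := hfail ∅ (by simp)
    obtain ⟨i⟩ := ‹Nonempty ι›
    have h1 := hrel.sum_class i
    rw [Finset.sum_eq_single i] at h1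
    · exact zpow_ne_zero (a i) hτ (by simpa [hγ] using h1)
    · intro j hj hji
      refine absurd ?_ hji
      rw [← Setoid.rep_eq_self (show j ∉ r.nonrep by simp [h0]),
        ← Setoid.rep_eq (Finset.mem_filter.1 hj).2,
        Setoid.rep_eq_self (show i ∉ r.nonrep by simp [h0])]
    · intro h
      exact absurd (Finset.mem_filter.2 ⟨Finset.mem_univ i, r.refl i⟩) h
  set n := r.nonrep.card with hn
  have hn1 : 1 ≤ n := Finset.card_pos.2 hr
  set ε : ℝ := 1 / (6 * n * (4 * n + 1)) with hε
  have hε0 : 0 < ε := by positivity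
  obtain ⟨C, hC, hCle⟩ := exists_supNatAbs_le K γ r hε0
  have hctrl : IsControlled K γ r ℋ C ε :=
    { exists_sep := fun i j hij hne => by
        obtain ⟨c, hc, hca⟩ := hsep i j hij hne
        exact ⟨c, Finset.mem_union_left _ hc, hca⟩
      finer := fun r' hr' a τ h1 h2 h3 h4 => by
        obtain ⟨c, hc, hca⟩ := hℱ' r' hr' a τ h1 h2 h3 h4
        exact ⟨c, Finset.mem_union_right _ (Finset.mem_biUnion.2
          ⟨r', Finset.mem_filter.2 ⟨Finset.mem_univ _, hr'⟩, hc⟩), hca⟩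
      supNatAbs_le := hCle }
  have hbad : ∀ k, 1 ≤ k → k ≤ n → ∃ (s : Type) (_ : Fintype s), Nonempty s ∧
      Fintype.card s = k ∧ HasBadTuple K γ r M s := by
    intro k hk
    induction k, hk using Nat.le_induction with
    | base =>
      refine fun _ => ⟨Unit, inferInstance, inferInstance, rfl, hasBadTuple_unit hM1 hr ?_⟩
      intro ℋ hℋ
      obtain ⟨a, τ, -, h2, h3, h4, h5⟩ := hfail ℋ hℋ
      exact ⟨a, τ, h2, h3, h4, h5⟩
    | succ k _ ihk =>
      intro hkn
      obtain ⟨s, _, _, hs, hbad⟩ := ihk (by omega)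
      exact ⟨Option s, inferInstance, inferInstance, by rw [Fintype.card_option, hs],
        hbad.option hγ hM1 hM hctrl hC hε hℋ (by omega)⟩
  obtain ⟨s, _, _, hs, hbad⟩ := hbad n hn1 le_rfl
  obtain ⟨e, he, -, ⟨z, hz⟩, -⟩ := hbad ∅ (by simp)
  rw [hs] at hz
  exact not_isBadLog_card_nonrep hγ (fun i hi => Finset.sum_eq_zero fun j _ => by simp [he j i hi]) hz

end

section

open Classical in
theorem exists_finset_isOrth_top {ι : Type} [Fintype ι] [Nonempty ι] {K : IntermediateField ℚ ℂ}
    [FiniteDimensional ℚ K] {γ : ι → K} (hγ : ∀ i, γ i ≠ 0) :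
    ∃ ℋ : Finset (ι → ℤ), (∀ c ∈ ℋ, c ≠ 0 ∧ IsOrth ⊤ c) ∧
      ∀ (a : ι → ℤ) (τ : ℂ), IsAlgebraic ℚ τ → τ ≠ 0 → ¬ IsOfFinOrder τ →
        ∑ i, algebraMap K ℂ (γ i) * τ ^ a i = 0 →
        ∑ i, (a i : ℂ) * (algebraMap K ℂ (γ i) * τ ^ a i) = 0 → ∃ c ∈ ℋ, ∑ i, c i * a i = 0 := by
  obtain ⟨ℋ₁, hℋ₁, h₁⟩ := exists_finset_isOrth_of_isRelated hγ ⊤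
  obtain ⟨ℋ₂, hℋ₂, h₂⟩ := exists_finset_isOrth_separating (⊤ : Setoid ι)
  refine ⟨ℋ₁ ∪ ℋ₂, fun c hc => (Finset.mem_union.1 hc).elim (hℋ₁ c) (hℋ₂ c),
    fun a τ halg hτ hnt h0 h0' => ?_⟩
  by_cases hconst : ∃ i j, a i ≠ a j
  · obtain ⟨i₁, j₁, hne⟩ := hconst
    suffices hrel : IsRelated (fun i => algebraMap K ℂ (γ i)) ⊤ (fun i => τ ^ a i) by
      obtain ⟨c, hc, hca⟩ := h₁ a τ halg hτ hnt hrel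
      exact ⟨c, Finset.mem_union_left _ hc, hca⟩
    refine ⟨insert 1 (Set.range fun l i => a i - a l), ?_, ?_⟩
    · refine ⟨fun _ _ _ _ _ _ => trivial, fun i => Or.inl ?_, fun i => ⟨_, Or.inr ⟨i, rfl⟩, ?_,
        sub_self _⟩⟩
      · ext j
        exact Set.indicator_of_mem (show j ∈ {j | (⊤ : Setoid ι) i j} from trivial) _
      · intro h
        have h1 := congrFun h i₁
        have h2 := congrFun h j₁
        simp only [Pi.zero_apply] at h1 h2
        exact hne (by linarith)
    · rintro _ (rfl | ⟨l, rfl⟩)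
      · simpa using h0
      · have : ∀ i, ((a i - a l : ℤ) : ℂ) * algebraMap K ℂ (γ i) * τ ^ a i =
            (a i : ℂ) * (algebraMap K ℂ (γ i) * τ ^ a i) -
              (a l : ℂ) * (algebraMap K ℂ (γ i) * τ ^ a i) := fun i => by push_cast; ring
        simp only [this]
        rw [Finset.sum_sub_distrib, h0', ← Finset.mul_sum, h0, mul_zero, sub_zero]
  · push Not at hconst
    have hnontriv : Nontrivial ι := by
      by_contra h
      rw [not_nontrivial_iff_subsingleton] at h
      obtain ⟨i⟩ := ‹Nonempty ι›
      rw [Fintype.sum_subsingleton _ i] at h0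
      exact mul_ne_zero (by simpa using hγ i) (zpow_ne_zero _ hτ) h0
    obtain ⟨i, j, hij⟩ := exists_pair_ne ι
    obtain ⟨c, hc, hca⟩ := h₂ i j trivial hij
    exact ⟨c, Finset.mem_union_right _ hc, by rw [hca, hconst i j, sub_self]⟩

theorem LaurentPolynomial.exists_addMonoidHom_C_mul_T {R : Type*} [CommRing R] (h : ℤ → R) :
    ∃ L : LaurentPolynomial R →+ R, ∀ (n : ℤ) (r : R),
      L (LaurentPolynomial.C r * LaurentPolynomial.T n) = r * h n := by
  refine ⟨{ toFun := fun f => f.coeff.sum (fun n r => r * h n)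
            map_zero' := by simp
            map_add' := fun f g => by
              rw [AddMonoidAlgebra.coeff_add]
              exact Finsupp.sum_add_index' (by simp) fun _ _ _ => add_mul _ _ _ }, fun n r => ?_⟩
  rw [← LaurentPolynomial.single_eq_C_mul_T]
  change (AddMonoidAlgebra.single n r).coeff.sum (fun n r => r * h n) = r * h n
  rw [AddMonoidAlgebra.coeff_single, Finsupp.sum_single_index (zero_mul _)]

theorem sum_mul_eq_zero_of_sq_dvd {R : Type*} [CommRing R] {N : ℕ} {γ : Fin (N + 1) → R}
    {a : Fin N → ℤ} {x : R}
    (hf : (LaurentPolynomial.T 1 - LaurentPolynomial.C x) ^ 2 ∣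
      (LaurentPolynomial.C (γ 0) + ∑ j : Fin N, LaurentPolynomial.C (γ j.succ) *
        LaurentPolynomial.T (a j) : LaurentPolynomial R)) {h : ℤ → R}
    (hh : ∀ n, h (n + 2) - 2 * x * h (n + 1) + x ^ 2 * h n = 0) :
    ∑ i, γ i * h ((Fin.cons 0 a : Fin (N + 1) → ℤ) i) = 0 := by
  obtain ⟨L, hL⟩ := LaurentPolynomial.exists_addMonoidHom_C_mul_T h
  have key : ∀ g, L ((LaurentPolynomial.T 1 - LaurentPolynomial.C x) ^ 2 * g) = 0 := by
    intro g
    induction g using LaurentPolynomial.induction_on' with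
    | add p q hp hq => rw [mul_add, map_add, hp, hq, add_zero]
    | C_mul_T n r =>
      have : (LaurentPolynomial.T 1 - LaurentPolynomial.C x) ^ 2 *
          (LaurentPolynomial.C r * LaurentPolynomial.T n) =
          LaurentPolynomial.C r * LaurentPolynomial.T (n + 2) -
          LaurentPolynomial.C (2 * x * r) * LaurentPolynomial.T (n + 1) +
          LaurentPolynomial.C (x ^ 2 * r) * LaurentPolynomial.T n := by
        rw [show n + 2 = n + 1 + 1 by ring, LaurentPolynomial.T_add, LaurentPolynomial.T_add]
        simp only [map_mul, map_pow, map_ofNat]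
        ring
      rw [this, map_add, map_sub, hL, hL, hL]
      linear_combination r * hh n
  obtain ⟨g, hg⟩ := hf
  have h0 := hL 0 (γ 0)
  rw [LaurentPolynomial.T_zero, mul_one] at h0
  rw [← key g, ← hg, map_add, h0, map_sum, Fin.sum_univ_succ]
  simp [hL]

theorem Fintype.sum_eq_sum_subtype {ι M : Type*} [Fintype ι] [AddCommMonoid M] {p : ι → Prop}
    [DecidablePred p] {f : ι → M} (hf : ∀ i, ¬ p i → f i = 0) :
    ∑ i, f i = ∑ i : {i // p i}, f i := by
  rw [← Fintype.sum_subtype_add_sum_subtype p f,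
    Finset.sum_eq_zero fun (i : {i // ¬ p i}) _ => hf i i.2, add_zero]

theorem exists_finset_forall_sum_eq_zero_of_sq_dvd
    (N : ℕ) (γ : Fin (N + 1) → ℂ) (hγ : ∀ i, IsAlgebraic ℚ (γ i)) :
    ∃ S : Finset (Fin N → ℤ), (∀ c ∈ S, c ≠ 0) ∧
      ∀ a : Fin N → ℤ, (∃ i, γ i ≠ 0) →
        ∀ τ : ℂ, IsAlgebraic ℚ τ → τ ≠ 0 → ¬ IsOfFinOrder τ →
        ∑ i, γ i * τ ^ (Fin.cons 0 a : Fin (N + 1) → ℤ) i = 0 →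
        ∑ i, γ i * (((Fin.cons 0 a : Fin (N + 1) → ℤ) i : ℂ) *
          τ ^ (Fin.cons 0 a : Fin (N + 1) → ℤ) i) = 0 →
        ∃ c ∈ S, ∑ i, c i * a i = 0 := by
  classical
  by_cases hne : ∃ i, γ i ≠ 0
  swap
  · exact ⟨∅, by simp, fun a h => absurd h hne⟩
  let ι := {i // γ i ≠ 0}
  have : Nonempty ι := nonempty_subtype.2 hne
  let K : IntermediateField ℚ ℂ := IntermediateField.adjoin ℚ (Set.range γ)
  have : FiniteDimensional ℚ K := IntermediateField.finiteDimensional_adjoin (by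
    rintro _ ⟨i, rfl⟩
    exact (hγ i).isIntegral)
  let γ' : ι → K := fun i => ⟨γ i, IntermediateField.subset_adjoin _ _ ⟨i, rfl⟩⟩
  obtain ⟨ℋ, hℋ, h⟩ := exists_finset_isOrth_top (γ := γ') fun i h =>
    i.2 (congrArg Subtype.val h)
  let ext : (ι → ℤ) → Fin (N + 1) → ℤ := fun c i => if h : γ i ≠ 0 then c ⟨i, h⟩ else 0
  have hext : ∀ (c : ι → ℤ) (b : Fin (N + 1) → ℤ),
      ext c 0 * b 0 + ∑ j : Fin N, ext c j.succ * b j.succ = ∑ i, c i * b i := by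
    intro c b
    rw [← Fin.sum_univ_succ (fun i => ext c i * b i),
      Fintype.sum_eq_sum_subtype (p := fun i => γ i ≠ 0)]
    · exact Finset.sum_congr rfl fun i _ => by rw [show ext c i = c i from dif_pos i.2]
    · intro i hi
      rw [show ext c i = 0 from dif_neg hi, zero_mul]
  have hsum : ∀ u : Fin (N + 1) → ℂ, ∑ i, γ i * u i = ∑ i : ι, γ i * u i := by
    intro u
    refine Fintype.sum_eq_sum_subtype (p := fun i => γ i ≠ 0) fun i hi => ?_
    rw [not_not.1 hi, zero_mul]
  refine ⟨ℋ.image fun c j => ext c j.succ, fun c hc => ?_, fun a _ τ halg hτ hnt h0 h0' => ?_⟩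
  · obtain ⟨c, hc', rfl⟩ := Finset.mem_image.1 hc
    obtain ⟨hc0, hco⟩ := hℋ c hc'
    intro h1
    have h2 := hext c 1
    have h3 : ∀ j : Fin N, ext c j.succ = 0 := fun j => congrFun h1 j
    have h4 := hco 1 fun _ _ _ => rfl
    simp only [Pi.one_apply] at h2 h4
    rw [h4] at h2
    simp only [h3, Finset.sum_const_zero, add_zero, mul_one] at h2
    refine hc0 (funext fun i => ?_)
    have h5 : ext c i = c i := dif_pos i.2
    rw [← h5]
    exact Fin.cases h2 h3 (i : Fin (N + 1))
  · obtain ⟨c, hc, hca⟩ := h (fun i => (Fin.cons 0 a : Fin (N + 1) → ℤ) i) τ halg hτ hnt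
      ((hsum _).symm.trans h0) (by
        refine Eq.trans ?_ ((hsum _).symm.trans h0')
        exact Finset.sum_congr rfl fun i _ => mul_left_comm _ _ _)
    refine ⟨_, Finset.mem_image_of_mem _ hc, ?_⟩
    rw [← hca, ← hext]
    simp

end

open LaurentPolynomial

/-- **Corollary.** Let `N ≥ 1` and `γ = (γ_0, …, γ_N) ∈ ℚ̄^{N+1}`.  The set of vectors
`a ∈ ℤ^N` such that the Laurent polynomial `γ_0 + γ_1 t^{a_1} + ⋯ + γ_N t^{a_N} ∈ ℚ̄[t^{±1}]`
is nonzero and has a multiple root in `ℚ̄^×` which is not a root of unity, is contained in a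
finite union of proper linear subspaces of `ℤ^N` (kernels of nonzero linear forms). -/
theorem exponents_with_multiple_root_in_finite_union_of_hyperplanes
    (N : ℕ) (hN : 1 ≤ N) (γ : Fin (N + 1) → ℂ) (hγ : ∀ i, IsAlgebraic ℚ (γ i)) :
    ∃ S : Finset (Fin N → ℤ), (∀ c ∈ S, c ≠ 0) ∧
      ∀ a : Fin N → ℤ,
        (C (γ 0) + ∑ j : Fin N, C (γ j.succ) * T (a j) : LaurentPolynomial ℂ) ≠ 0 →
        (∃ ξ : ℂˣ, IsAlgebraic ℚ (ξ : ℂ) ∧ ¬ IsOfFinOrder ξ ∧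
          (T 1 - C ((ξ : ℂ))) ^ 2 ∣
            (C (γ 0) + ∑ j : Fin N, C (γ j.succ) * T (a j) : LaurentPolynomial ℂ)) →
        ∃ c ∈ S, ∑ i, c i * a i = 0 := by
  obtain ⟨S, hS, h⟩ := exists_finset_forall_sum_eq_zero_of_sq_dvd N γ hγ
  refine ⟨S, hS, fun a hne ⟨ξ, halg, hξ, hdvd⟩ => h a ?_ ξ halg ξ.ne_zero ?_ ?_ ?_⟩
  · by_contra! h0
    exact hne (by simp [h0])
  · rwa [Units.isOfFinOrder_val]
  · refine sum_mul_eq_zero_of_sq_dvd hdvd (h := fun n => (ξ : ℂ) ^ n) fun n => ?_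
    rw [zpow_add₀ ξ.ne_zero, zpow_add₀ ξ.ne_zero, zpow_one, zpow_ofNat]
    ring
  · refine sum_mul_eq_zero_of_sq_dvd hdvd (h := fun n => (n : ℂ) * (ξ : ℂ) ^ n) fun n => ?_
    rw [zpow_add₀ ξ.ne_zero, zpow_add₀ ξ.ne_zero, zpow_one, zpow_ofNat]
    push_cast
    ring
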